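/- arXiv:0802.3361 — 3 statements merged into one kernel-verified Lean document; each statement's English description precedes it below -/
import Mathlib

section
/- For any positive integers m and j, the sum of the reciprocals of the primes p such that m*p + j is also prime is convergent. -/
namespace BrunSum

open Finset ArithmeticFunction BoundingSieve
open scoped ArithmeticFunction.Moebius ArithmeticFunction.sigma

theorem sum_moebius_divisors (n : ℕ) : ∑ d ∈ n.divisors, μ d = if n = 1 then 1 else 0 := by
  rw [← coe_zeta_mul_apply, coe_zeta_mul_moebius, one_apply]

/-- Summing the Möbius function over an interval of the divisor lattice. -/
theorem sum_moebius_of_dvd_of_dvd {P l l' : ℕ} (hP : P ≠ 0) (hl' : Squarefree l')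
    (hl'P : l' ∣ P) :
    ∑ d ∈ P.divisors with l ∣ d ∧ d ∣ l', (μ d : ℝ) = if l = l' then (μ l : ℝ) else 0 := by
  by_cases hll : l ∣ l'
  · obtain ⟨e, rfl⟩ := hll
    have hcop : l.Coprime e := Nat.coprime_of_squarefree_mul hl'
    have hl0 : l ≠ 0 := left_ne_zero_of_mul hl'.ne_zero
    have he0 : e ≠ 0 := right_ne_zero_of_mul hl'.ne_zero
    have hset : P.divisors.filter (fun d => l ∣ d ∧ d ∣ l * e) =
        e.divisors.image (fun c => l * c) := by
      ext d
      simp only [mem_filter, Nat.mem_divisors, mem_image]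
      constructor
      · rintro ⟨_, ⟨c, rfl⟩, h⟩
        exact ⟨c, ⟨Nat.dvd_of_mul_dvd_mul_left (Nat.pos_of_ne_zero hl0) h, he0⟩, rfl⟩
      · rintro ⟨c, ⟨hc, _⟩, rfl⟩
        have := mul_dvd_mul_left l hc
        exact ⟨⟨this.trans hl'P, hP⟩, dvd_mul_right _ _, this⟩
    rw [hset, sum_image fun a _ b _ h => Nat.eq_of_mul_eq_mul_left (Nat.pos_of_ne_zero hl0) h]
    have hmul : ∀ c ∈ e.divisors, (μ (l * c) : ℝ) = μ l * μ c := fun c hc => by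
      rw [isMultiplicative_moebius.map_mul_of_coprime
        (hcop.coprime_dvd_right (Nat.dvd_of_mem_divisors hc)), Int.cast_mul]
    rw [sum_congr rfl hmul, ← mul_sum, ← Int.cast_sum, sum_moebius_divisors]
    by_cases he : e = 1
    · simp [he]
    · simp [he, hl0]
  · rw [if_neg (by rintro rfl; exact hll dvd_rfl), filter_false_of_mem, sum_empty]
    rintro d - ⟨h₁, h₂⟩
    exact hll (h₁.trans h₂)

/-- Selberg's choice of weights of level `D`. -/
theorem exists_selbergWeights (s : BoundingSieve) {D : ℕ} (hD : 1 ≤ D) :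
    ∃ w : ℕ → ℝ, w 1 = 1 ∧ (∀ d, D < d → w d = 0) ∧
      (∀ d ∈ s.prodPrimes.divisors, |w d| ≤ (s.nu d)⁻¹) ∧
      s.mainSum (lambdaSquared w) =
        (∑ l ∈ s.prodPrimes.divisors with l ≤ D, s.selbergTerms l)⁻¹ := by
  have hP := prodPrimes_ne_zero (s := s)
  set A := s.prodPrimes.divisors.filter (· ≤ D) with hA
  set S := ∑ l ∈ A, s.selbergTerms l with hS
  have hApos : ∀ l ∈ A, 0 < s.selbergTerms l := fun l hl =>
    selbergTerms_pos (Nat.dvd_of_mem_divisors (mem_filter.1 hl).1)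
  have hSpos : 0 < S := sum_pos hApos ⟨1, by simp [hA, hP, hD]⟩
  have hν1 : s.nu 1 = 1 := s.nu_mult.map_one
  let w : ℕ → ℝ := fun d => μ d * (s.nu d)⁻¹ * S⁻¹ * ∑ l ∈ A with d ∣ l, s.selbergTerms l
  refine ⟨w, ?_, ?_, ?_, ?_⟩
  · simp only [w, hν1, one_dvd, filter_true, ← hS]
    simp [hSpos.ne']
  · intro d hd
    have : A.filter (d ∣ ·) = ∅ := by
      refine filter_false_of_mem fun l hl hdl => ?_
      rw [hA, mem_filter, Nat.mem_divisors] at hl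
      have := Nat.le_of_dvd (Nat.pos_of_ne_zero (ne_zero_of_dvd_ne_zero hP hl.1.1)) hdl
      omega
    simp only [w, this, sum_empty, mul_zero]
  · intro d hd
    have hν := nu_pos_of_dvd_prodPrimes (Nat.dvd_of_mem_divisors hd)
    have h1 : |(μ d : ℝ)| ≤ 1 := by exact_mod_cast abs_moebius_le_one
    have h2 : 0 ≤ ∑ l ∈ A with d ∣ l, s.selbergTerms l :=
      sum_nonneg fun l hl => (hApos l (mem_filter.1 hl).1).le
    have h3 : ∑ l ∈ A with d ∣ l, s.selbergTerms l ≤ S :=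
      sum_le_sum_of_subset_of_nonneg (filter_subset _ _) fun l hl _ => (hApos l hl).le
    simp only [w]
    rw [abs_mul, abs_mul, abs_mul, abs_of_pos (inv_pos.2 hν), abs_of_pos (inv_pos.2 hSpos),
      abs_of_nonneg h2]
    calc |(μ d : ℝ)| * (s.nu d)⁻¹ * S⁻¹ * ∑ l ∈ A with d ∣ l, s.selbergTerms l
        ≤ 1 * (s.nu d)⁻¹ * S⁻¹ * S := by gcongr
      _ = (s.nu d)⁻¹ := by field_simp
  · rw [mainSum_lambdaSquared_eq_sum_mul_sum_sq]
    have hy : ∀ l ∈ s.prodPrimes.divisors,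
        (∑ d ∈ s.prodPrimes.divisors, if l ∣ d then s.nu d * w d else 0) =
          if l ≤ D then S⁻¹ * μ l * s.selbergTerms l else 0 := by
      intro l hl
      calc (∑ d ∈ s.prodPrimes.divisors, if l ∣ d then s.nu d * w d else 0)
          = ∑ d ∈ s.prodPrimes.divisors, ∑ l' ∈ A,
              S⁻¹ * s.selbergTerms l' * if l ∣ d ∧ d ∣ l' then (μ d : ℝ) else 0 := by
            refine sum_congr rfl fun d hd => ?_
            have hν := (nu_pos_of_dvd_prodPrimes (Nat.dvd_of_mem_divisors hd)).ne'
            by_cases hld : l ∣ d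
            · simp only [hld, if_true, true_and, w, sum_filter, mul_sum]
              refine sum_congr rfl fun l' _ => ?_
              split_ifs
              · field_simp
              · simp
            · simp [hld]
        _ = ∑ l' ∈ A, S⁻¹ * s.selbergTerms l' * if l = l' then (μ l : ℝ) else 0 := by
            rw [sum_comm]
            refine sum_congr rfl fun l' hl' => ?_
            have hl'P := (mem_filter.1 hl').1
            rw [← mul_sum, ← sum_filter, sum_moebius_of_dvd_of_dvd hP
              (squarefree_of_mem_divisors_prodPrimes hl'P) (Nat.dvd_of_mem_divisors hl'P)]
        _ = _ := by
            simp only [mul_ite, mul_zero, sum_ite_eq, hA, mem_filter, hl, true_and]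
            congr 1
            ring
    calc _ = ∑ l ∈ s.prodPrimes.divisors,
          if l ≤ D then S⁻¹ * S⁻¹ * s.selbergTerms l else 0 := by
          refine sum_congr rfl fun l hl => ?_
          rw [hy l hl]
          split_ifs
          · have hg := (selbergTerms_pos (Nat.dvd_of_mem_divisors hl)).ne'
            have hμ : (μ l : ℝ) ^ 2 = 1 := by
              exact_mod_cast moebius_sq_eq_one_of_squarefree
                (squarefree_of_mem_divisors_prodPrimes hl)
            calc _ = S⁻¹ * S⁻¹ * (μ l : ℝ) ^ 2 *
                  ((s.selbergTerms l)⁻¹ * s.selbergTerms l) * s.selbergTerms l := by ring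
              _ = _ := by rw [hμ, inv_mul_cancel₀ hg]; ring
          · simp
      _ = S⁻¹ := by
          rw [← sum_filter, ← mul_sum, ← hA, ← hS, mul_assoc, inv_mul_cancel₀ hSpos.ne', mul_one]

/-- The Selberg sieve, with a crude but explicit error term. -/
theorem siftedSum_le_of_rem_le (s : BoundingSieve) {D : ℕ} (hD : 1 ≤ D)
    (hν : ∀ d ∈ s.prodPrimes.divisors, (s.nu d)⁻¹ ≤ d)
    (hrem : ∀ d ∈ s.prodPrimes.divisors, |s.rem d| ≤ d) :
    s.siftedSum ≤
      s.totalMass * (∑ l ∈ s.prodPrimes.divisors with l ≤ D, s.selbergTerms l)⁻¹ + D ^ 10 := by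
  obtain ⟨w, hw1, hwD, hwν, hmain⟩ := exists_selbergWeights s hD
  have hP := prodPrimes_ne_zero (s := s)
  rw [← hmain]
  refine (siftedSum_le_mainSum_errSum_of_upperMoebius _ (upperMoebius_lambdaSquared w hw1)).trans ?_
  gcongr
  have hwle : ∀ d ∈ s.prodPrimes.divisors, |w d| ≤ D := fun d hd => by
    by_cases h : d ≤ D
    · exact (hwν d hd).trans ((hν d hd).trans (by exact_mod_cast h))
    · rw [hwD d (not_le.1 h)]; simp
  have hterm : ∀ d ∈ s.prodPrimes.divisors, ∀ d₁ ∈ d.divisors, ∀ d₂ ∈ d.divisors,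
      |if d = d₁.lcm d₂ then w d₁ * w d₂ else 0| ≤ if d ≤ D ^ 2 then (D : ℝ) ^ 2 else 0 := by
    intro d hd d₁ h₁ d₂ h₂
    have hsub := Nat.divisors_subset_of_dvd hP (Nat.dvd_of_mem_divisors hd)
    have hw1 := hwle d₁ (hsub h₁)
    have hw2 := hwle d₂ (hsub h₂)
    by_cases hdD : d ≤ D ^ 2
    · rw [if_pos hdD]
      split_ifs
      · rw [abs_mul, sq]
        gcongr
      · rw [abs_zero]; positivity
    · rw [if_neg hdD]
      split_ifs with h
      · have : D < d₁ ∨ D < d₂ := by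
          by_contra! hc
          apply hdD
          calc d = d₁.lcm d₂ := h
            _ ≤ d₁ * d₂ := Nat.le_of_dvd (Nat.mul_pos (Nat.pos_of_mem_divisors h₁)
                (Nat.pos_of_mem_divisors h₂)) (Nat.lcm_dvd_mul _ _)
            _ ≤ D * D := Nat.mul_le_mul hc.1 hc.2
            _ = D ^ 2 := (sq D).symm
        rcases this with h | h <;> simp [hwD _ h]
      · simp
  have hlam : ∀ d ∈ s.prodPrimes.divisors,
      |lambdaSquared w d| * |s.rem d| ≤ if d ≤ D ^ 2 then (D : ℝ) ^ 8 else 0 := by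
    intro d hd
    have h1 : |lambdaSquared w d| ≤
        (d : ℝ) * (d * if d ≤ D ^ 2 then (D : ℝ) ^ 2 else 0) := by
      have hcard : (#d.divisors : ℝ) ≤ d := by exact_mod_cast Nat.card_divisors_le_self d
      have hnn : (0 : ℝ) ≤ if d ≤ D ^ 2 then (D : ℝ) ^ 2 else 0 := by positivity
      unfold lambdaSquared
      calc _ ≤ ∑ d₁ ∈ d.divisors, ∑ d₂ ∈ d.divisors,
            if d ≤ D ^ 2 then (D : ℝ) ^ 2 else 0 := by
            refine (abs_sum_le_sum_abs _ _).trans (sum_le_sum fun d₁ h₁ => ?_)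
            exact (abs_sum_le_sum_abs _ _).trans (sum_le_sum fun d₂ h₂ => hterm d hd d₁ h₁ d₂ h₂)
        _ = #d.divisors * (#d.divisors * if d ≤ D ^ 2 then (D : ℝ) ^ 2 else 0) := by
            simp only [sum_const, nsmul_eq_mul]
        _ ≤ _ := by gcongr
    have h2 := hrem d hd
    by_cases hdD : d ≤ D ^ 2
    · rw [if_pos hdD] at h1 ⊢
      have hd' : (d : ℝ) ≤ (D : ℝ) ^ 2 := by exact_mod_cast hdD
      calc |lambdaSquared w d| * |s.rem d| ≤ (d * (d * (D : ℝ) ^ 2)) * d := by gcongr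
        _ ≤ ((D : ℝ) ^ 2 * ((D : ℝ) ^ 2 * (D : ℝ) ^ 2)) * (D : ℝ) ^ 2 := by gcongr
        _ = (D : ℝ) ^ 8 := by ring
    · rw [if_neg hdD] at h1 ⊢
      rw [le_antisymm (by simpa using h1) (abs_nonneg _), zero_mul]
  calc s.errSum (lambdaSquared w)
      ≤ ∑ d ∈ s.prodPrimes.divisors, if d ≤ D ^ 2 then (D : ℝ) ^ 8 else 0 := sum_le_sum hlam
    _ = #(s.prodPrimes.divisors.filter (· ≤ D ^ 2)) * (D : ℝ) ^ 8 := by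
        rw [← sum_filter, sum_const, nsmul_eq_mul]
    _ ≤ (D : ℝ) ^ 2 * (D : ℝ) ^ 8 := by
        gcongr
        have : s.prodPrimes.divisors.filter (· ≤ D ^ 2) ⊆ Icc 1 (D ^ 2) := fun d hd => by
          rw [mem_filter] at hd
          exact mem_Icc.2 ⟨Nat.pos_of_mem_divisors hd.1, hd.2⟩
        have := card_le_card this
        rw [Nat.card_Icc, Nat.add_sub_cancel] at this
        exact_mod_cast this
    _ = (D : ℝ) ^ 10 := by ring

/-- If `h` is completely multiplicative and agrees with `nu` on the sifting primes, the Selberg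
terms up to `D` dominate the sum of `h` over integers up to `D` composed of sifting primes. -/
theorem sum_le_sum_selbergTerms (s : BoundingSieve) (h : ℕ →* ℝ) (hnn : ∀ n, 0 ≤ h n)
    (hlt : ∀ {p : ℕ}, p.Prime → ‖h p‖ < 1)
    (heq : ∀ p, p.Prime → p ∣ s.prodPrimes → h p = s.nu p) (D : ℕ) {B : Finset ℕ}
    (hB : ∀ n ∈ B, n ≠ 0 ∧ n ≤ D ∧ ∀ p, p.Prime → p ∣ n → p ∣ s.prodPrimes) :
    ∑ n ∈ B, h n ≤ ∑ l ∈ s.prodPrimes.divisors with l ≤ D, s.selbergTerms l := by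
  have hP := prodPrimes_ne_zero (s := s)
  have hmaps : ∀ n ∈ B, ∏ p ∈ n.primeFactors, p ∈ s.prodPrimes.divisors.filter (· ≤ D) := by
    intro n hn
    obtain ⟨h0, hD, hp⟩ := hB n hn
    rw [mem_filter, Nat.mem_divisors]
    refine ⟨⟨?_, hP⟩, (Nat.le_of_dvd (Nat.pos_of_ne_zero h0) (Nat.prod_primeFactors_dvd n)).trans hD⟩
    refine (prod_dvd_prod_of_subset _ _ _ fun p hpn => ?_).trans
      (Nat.prod_primeFactors_dvd s.prodPrimes)
    have hpp := Nat.prime_of_mem_primeFactors hpn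
    exact Nat.mem_primeFactors.2 ⟨hpp, hp p hpp (Nat.dvd_of_mem_primeFactors hpn), hP⟩
  rw [← sum_fiberwise_of_maps_to hmaps]
  refine sum_le_sum fun l hl => ?_
  have hlP : l ∣ s.prodPrimes := Nat.dvd_of_mem_divisors (mem_filter.1 hl).1
  have hlsq := squarefree_of_dvd_prodPrimes hlP
  have hl0 : 0 < l := Nat.pos_of_ne_zero hlsq.ne_zero
  have hpl : ∀ p ∈ l.primeFactors, h p = s.nu p := fun p hp =>
    heq p (Nat.prime_of_mem_primeFactors hp) ((Nat.dvd_of_mem_primeFactors hp).trans hlP)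
  have hhl : h l = s.nu l := by
    rw [← prod_primeFactors_nu hlP, ← prod_congr rfl hpl, ← map_prod,
      Nat.prod_primeFactors_of_squarefree hlsq]
  obtain ⟨hsum, hprod⟩ :=
    EulerProduct.summable_and_hasSum_factoredNumbers_prod_filter_prime_geometric (f := h) hlt
      l.primeFactors
  have hprod' : ∑' m : Nat.factoredNumbers l.primeFactors, h m =
      ∏ p ∈ l.primeFactors, (1 - s.nu p)⁻¹ := by
    rw [hprod.tsum_eq, filter_true_of_mem fun p hp => Nat.prime_of_mem_primeFactors hp]
    exact prod_congr rfl fun p hp => by rw [hpl p hp]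
  set F := B.filter (fun n => ∏ p ∈ n.primeFactors, p = l) with hF
  have hdvd : ∀ n ∈ F, l * (n / l) = n := fun n hn => by
    refine Nat.mul_div_cancel' ?_
    rw [← (mem_filter.1 hn).2]
    exact Nat.prod_primeFactors_dvd n
  have hfac : ∀ n ∈ F, n / l ∈ Nat.factoredNumbers l.primeFactors := fun n hn => by
    have h0 := (hB n (mem_filter.1 hn).1).1
    rw [Nat.mem_factoredNumbers_iff_primeFactors_subset]
    refine ⟨fun hz => h0 ?_, ?_⟩
    · rw [← hdvd n hn, hz, mul_zero]
    · have h1 : l.primeFactors = n.primeFactors := by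
        rw [← (mem_filter.1 hn).2]
        exact Nat.primeFactors_prod fun p hp => Nat.prime_of_mem_primeFactors hp
      rw [h1]
      exact Nat.primeFactors_mono (Nat.div_dvd_of_dvd ⟨_, (hdvd n hn).symm⟩) h0
  rw [selbergTerms_apply, ← hprod', ← hhl]
  calc ∑ n ∈ F, h n = h l * ∑ n ∈ F, h (n / l) := by
        rw [mul_sum]
        exact sum_congr rfl fun n hn => by rw [← map_mul, hdvd n hn]
    _ ≤ h l * ∑' m : Nat.factoredNumbers l.primeFactors, h m := by
        refine mul_le_mul_of_nonneg_left ?_ (hnn l)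
        rw [← sum_attach]
        let e : F → Nat.factoredNumbers l.primeFactors := fun n => ⟨n / l, hfac n n.2⟩
        have he : Function.Injective e := fun a b hab => by
          have : (a : ℕ) / l = b / l := congrArg Subtype.val hab
          apply Subtype.ext
          rw [← hdvd a a.2, this, hdvd b b.2]
        calc ∑ n ∈ F.attach, h (n / l) = ∑ m ∈ F.attach.map ⟨e, he⟩, h m := by
              rw [sum_map]; rfl
          _ ≤ _ := hprod.summable.sum_le_tsum _ fun m _ => hnn m

theorem card_divisors_le_two_pow_cardFactors {n : ℕ} (hn : n ≠ 0) :
    #n.divisors ≤ 2 ^ cardFactors n := by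
  rw [Nat.card_divisors hn, cardFactors_eq_sum_factorization, Finsupp.sum,
    ← prod_pow_eq_pow_sum, Nat.support_factorization]
  exact prod_le_prod' fun p _ => Nat.lt_two_pow_self

/-- The completely multiplicative function `2 ^ Ω(n) / n`, restricted to `n` coprime to `Q`. -/
noncomputable def coprimeTwoPowDiv (Q : ℕ) : ℕ →* ℝ where
  toFun n := if n.Coprime Q then 2 ^ cardFactors n / n else 0
  map_one' := by simp
  map_mul' a b := by
    by_cases ha : a.Coprime Q
    · by_cases hb : b.Coprime Q
      · by_cases ha0 : a = 0
        · simp [ha0]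
        by_cases hb0 : b = 0
        · simp [hb0]
        rw [if_pos ha, if_pos hb, if_pos (ha.mul_left hb), cardFactors_mul ha0 hb0, pow_add,
          Nat.cast_mul, mul_div_mul_comm]
      · rw [if_neg hb, if_neg fun h => hb (Nat.Coprime.coprime_mul_left h), mul_zero]
    · rw [if_neg ha, if_neg fun h => ha (Nat.Coprime.coprime_mul_right h), zero_mul]

theorem coprimeTwoPowDiv_apply (Q n : ℕ) :
    coprimeTwoPowDiv Q n = if n.Coprime Q then 2 ^ cardFactors n / (n : ℝ) else 0 := rfl

theorem sq_sum_inv_le_sum_coprimeTwoPowDiv {Q E : ℕ} {T : Finset ℕ}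
    (hT : ∀ a ∈ T, a ≠ 0 ∧ a ≤ E ∧ a.Coprime Q) :
    (∑ a ∈ T, (a : ℝ)⁻¹) ^ 2 ≤
      ∑ n ∈ Icc 1 (E ^ 2) with n.Coprime Q, coprimeTwoPowDiv Q n := by
  have hmaps : ∀ x ∈ T ×ˢ T, x.1 * x.2 ∈ (Icc 1 (E ^ 2)).filter (·.Coprime Q) := by
    intro x hx
    obtain ⟨h1, h2⟩ := mem_product.1 hx
    obtain ⟨a0, aE, aQ⟩ := hT _ h1
    obtain ⟨b0, bE, bQ⟩ := hT _ h2
    rw [mem_filter, mem_Icc, sq]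
    exact ⟨⟨Nat.mul_pos (Nat.pos_of_ne_zero a0) (Nat.pos_of_ne_zero b0),
      Nat.mul_le_mul aE bE⟩, aQ.mul_left bQ⟩
  rw [sq, sum_mul_sum, ← sum_product', ← sum_fiberwise_of_maps_to hmaps]
  refine sum_le_sum fun n hn => ?_
  obtain ⟨hn1, hnQ⟩ := mem_filter.1 hn
  have hn0 : n ≠ 0 := (Nat.lt_of_lt_of_le one_pos (mem_Icc.1 hn1).1).ne'
  rw [coprimeTwoPowDiv_apply, if_pos hnQ]
  have hsub : (T ×ˢ T).filter (fun x => x.1 * x.2 = n) ⊆ n.divisorsAntidiagonal := fun x hx =>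
    Nat.mem_divisorsAntidiagonal.2 ⟨(mem_filter.1 hx).2, hn0⟩
  have hcard : #((T ×ˢ T).filter (fun x => x.1 * x.2 = n)) ≤ 2 ^ cardFactors n := by
    refine (card_le_card hsub).trans ?_
    rw [← Nat.map_div_right_divisors, card_map]
    exact card_divisors_le_two_pow_cardFactors hn0
  calc _ = ∑ x ∈ T ×ˢ T with x.1 * x.2 = n, (n : ℝ)⁻¹ := by
        refine sum_congr rfl fun x hx => ?_
        rw [← (mem_filter.1 hx).2, Nat.cast_mul, mul_inv]
    _ = #((T ×ˢ T).filter (fun x => x.1 * x.2 = n)) * (n : ℝ)⁻¹ := by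
        rw [sum_const, nsmul_eq_mul]
    _ ≤ 2 ^ cardFactors n * (n : ℝ)⁻¹ := by
        gcongr
        exact_mod_cast hcard
    _ = _ := (div_eq_mul_inv _ _).symm

theorem log_div_le_sum_inv (Q K : ℕ) (hQ : 0 < Q) :
    Real.log K / Q ≤ ∑ a ∈ (range K).image (fun k => k * Q + 1), (a : ℝ)⁻¹ := by
  rw [sum_image fun a _ b _ hab => Nat.eq_of_mul_eq_mul_right hQ (Nat.succ_injective hab)]
  have hlog : Real.log K ≤ ∑ k ∈ range K, ((k : ℝ) + 1)⁻¹ := by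
    rcases Nat.eq_zero_or_pos K with rfl | hK
    · simp
    have := log_add_one_le_harmonic K
    rw [harmonic] at this
    push_cast at this
    refine (Real.log_le_log (by exact_mod_cast hK) (by linarith)).trans this
  calc Real.log K / Q ≤ (∑ k ∈ range K, ((k : ℝ) + 1)⁻¹) / Q := by gcongr
    _ = ∑ k ∈ range K, (((k : ℝ) + 1) * Q)⁻¹ := by
        rw [sum_div]
        exact sum_congr rfl fun k _ => by rw [mul_inv, div_eq_mul_inv]
    _ ≤ _ := by
        refine sum_le_sum fun k _ => ?_
        have : (1 : ℝ) ≤ Q := by exact_mod_cast hQ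
        push_cast
        gcongr
        linarith

theorem abs_card_filter_modEq_sub_le (N c : ℕ) {d : ℕ} (hd : 0 < d) :
    |(#{n ∈ range N | n ≡ c [MOD d]} : ℝ) - N / d| ≤ 1 := by
  rw [← Nat.count_eq_card_filter_range, Nat.count_modEq_card N hd c]
  have hd' : (0 : ℝ) < d := by exact_mod_cast hd
  have hdm : (N : ℝ) / d = (N / d : ℕ) + (N % d : ℕ) / d := by
    rw [eq_comm, ← sub_eq_zero]
    have : ((d * (N / d) + N % d : ℕ) : ℝ) = N := by rw [Nat.div_add_mod]
    push_cast at this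
    field_simp
    linarith
  have h1 : ((N % d : ℕ) : ℝ) / d ≤ 1 := by
    rw [div_le_one hd']
    exact_mod_cast (Nat.mod_lt N hd).le
  have h0 : 0 ≤ ((N % d : ℕ) : ℝ) / d := by positivity
  rw [hdm, abs_le]
  push_cast
  split_ifs <;> constructor <;> linarith

theorem exists_dvd_and_dvd_linear_iff_modEq {a b m : ℕ} (j : ℕ) (hab : a.Coprime b)
    (hbm : b.Coprime m) (hb : 0 < b) :
    ∃ c, ∀ n, a ∣ n ∧ b ∣ m * n + j ↔ n ≡ c [MOD a * b] := by
  obtain ⟨k, hk0, hkb⟩ := Nat.chineseRemainder hbm.symm 0 ((b - 1) * j)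
  obtain ⟨c₀, rfl⟩ := (Nat.modEq_zero_iff_dvd).1 hk0
  obtain ⟨c, hca, hcb⟩ := Nat.chineseRemainder hab 0 c₀
  have hroot : m * c₀ + j ≡ 0 [MOD b] := by
    refine (hkb.add_right j).trans ?_
    have : (b - 1) * j + j = b * j := by
      obtain ⟨b, rfl⟩ := Nat.exists_eq_succ_of_ne_zero hb.ne'
      simp [Nat.succ_mul]
    rw [this]
    exact (Nat.modEq_zero_iff_dvd).2 (dvd_mul_right _ _)
  refine ⟨c, fun n => ?_⟩
  rw [← Nat.modEq_and_modEq_iff_modEq_mul hab]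
  refine and_congr ?_ ?_
  · rw [← Nat.modEq_zero_iff_dvd]
    exact ⟨fun h => h.trans hca.symm, fun h => h.trans hca⟩
  · rw [← Nat.modEq_zero_iff_dvd]
    constructor
    · intro h
      exact (Nat.ModEq.cancel_left_of_coprime hbm
        (Nat.ModEq.add_right_cancel' j (h.trans hroot.symm))).trans hcb.symm
    · intro h
      exact (((h.trans hcb).mul_left m).add_right j).trans hroot

theorem abs_card_filter_dvd_sub_le (N : ℕ) {m j d : ℕ} (hd : Squarefree d) (hdm : d.Coprime m)
    (hdj : d.Coprime j) :
    |(#{n ∈ range N | d ∣ n * (m * n + j)} : ℝ) - #d.divisors / d * N| ≤ #d.divisors := by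
  have hd0 := hd.ne_zero
  have hmaps : ∀ n ∈ (range N).filter (fun n => d ∣ n * (m * n + j)),
      (d.gcd n, d / d.gcd n) ∈ d.divisorsAntidiagonal := fun n _ =>
    Nat.mem_divisorsAntidiagonal.2 ⟨Nat.mul_div_cancel' (Nat.gcd_dvd_left d n), hd0⟩
  have hcard : #d.divisors = #d.divisorsAntidiagonal := by
    rw [← Nat.map_div_right_divisors, card_map]
  have hconst : (#d.divisorsAntidiagonal : ℝ) / d * N =
      ∑ _x ∈ d.divisorsAntidiagonal, (N : ℝ) / d := by
    rw [sum_const, nsmul_eq_mul]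
    ring
  rw [card_eq_sum_card_fiberwise hmaps, hcard, hconst, Nat.cast_sum, ← sum_sub_distrib,
    card_eq_sum_ones d.divisorsAntidiagonal, Nat.cast_sum]
  refine (abs_sum_le_sum_abs _ _).trans (sum_le_sum fun x hx => ?_)
  rw [Nat.cast_one]
  obtain ⟨a, b⟩ := x
  obtain ⟨rfl, -⟩ := Nat.mem_divisorsAntidiagonal.1 hx
  have hab : a.Coprime b := Nat.coprime_of_squarefree_mul hd
  have hb0 : 0 < b := Nat.pos_of_ne_zero (right_ne_zero_of_mul hd0)
  have ha0 : 0 < a := Nat.pos_of_ne_zero (left_ne_zero_of_mul hd0)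
  obtain ⟨c, hc⟩ := exists_dvd_and_dvd_linear_iff_modEq j hab
    (Nat.Coprime.coprime_mul_left hdm) hb0
  have hset : ((range N).filter (fun n => a * b ∣ n * (m * n + j))).filter
      (fun n => ((a * b).gcd n, a * b / (a * b).gcd n) = (a, b)) =
      (range N).filter (fun n => n ≡ c [MOD a * b]) := by
    rw [filter_filter]
    refine filter_congr fun n _ => ?_
    rw [← hc n, Prod.mk.injEq]
    constructor
    · rintro ⟨h1, h2, -⟩
      refine ⟨h2 ▸ Nat.gcd_dvd_right _ _, ?_⟩
      have hbn : b.Coprime n := by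
        refine Nat.eq_one_of_dvd_coprimes hab ?_ (Nat.gcd_dvd_left b n)
        rw [← h2]
        exact Nat.gcd_dvd_gcd_mul_left_left _ _ _
      exact hbn.dvd_of_dvd_mul_left ((dvd_mul_left b a).trans h1)
    · rintro ⟨h1, h2⟩
      have hbn : b.gcd n = 1 := by
        refine Nat.eq_one_of_dvd_coprimes (Nat.Coprime.coprime_mul_left hdj)
          (Nat.gcd_dvd_left b n) ?_
        exact (Nat.dvd_add_right ((Nat.gcd_dvd_right b n).mul_left m)).1
          ((Nat.gcd_dvd_left b n).trans h2)
      have hg : (a * b).gcd n = a := by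
        rw [Nat.gcd_comm, hab.gcd_mul, Nat.gcd_comm n b, hbn, mul_one]
        exact Nat.gcd_eq_right h1
      refine ⟨mul_dvd_mul h1 h2, hg, ?_⟩
      rw [hg, Nat.mul_div_cancel_left _ ha0]
  rw [hset]
  exact abs_card_filter_modEq_sub_le N c (Nat.mul_pos ha0 hb0)

/-- The product of the primes up to `D` not dividing `Q`. -/
def primorialCoprime (Q D : ℕ) : ℕ := ∏ p ∈ range (D + 1) with p.Prime ∧ ¬ p ∣ Q, p

theorem prime_dvd_primorialCoprime_iff {Q D p : ℕ} (hp : p.Prime) :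
    p ∣ primorialCoprime Q D ↔ p ≤ D ∧ ¬ p ∣ Q := by
  rw [primorialCoprime, hp.prime.dvd_finsetProd_iff]
  constructor
  · rintro ⟨q, hq, hpq⟩
    rw [mem_filter, mem_range] at hq
    obtain rfl := (Nat.prime_dvd_prime_iff_eq hp hq.2.1).1 hpq
    exact ⟨by omega, hq.2.2⟩
  · rintro ⟨h1, h2⟩
    exact ⟨p, by simp [hp, h2, h1], dvd_rfl⟩

theorem squarefree_primorialCoprime (Q D : ℕ) : Squarefree (primorialCoprime Q D) := by
  refine Finset.squarefree_prod_of_pairwise_isCoprime (fun p hp q hq hpq => ?_) fun p hp => ?_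
  · simp only [coe_filter, Set.mem_ofPred_eq] at hp hq
    exact Nat.coprime_iff_isRelPrime.1 ((Nat.coprime_primes hp.2.1 hq.2.1).2 hpq)
  · exact (mem_filter.1 hp).2.1.prime.irreducible.squarefree

/-- The density `τ(d) / d`. -/
noncomputable def divisorDensity : ArithmeticFunction ℝ :=
  pdiv ((σ 0 : ArithmeticFunction ℕ) : ArithmeticFunction ℝ)
    ((ArithmeticFunction.id : ArithmeticFunction ℕ) : ArithmeticFunction ℝ)

theorem divisorDensity_apply (d : ℕ) : divisorDensity d = #d.divisors / (d : ℝ) := by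
  simp [divisorDensity, pdiv_apply, sigma_zero_apply]

theorem divisorDensity_prime {p : ℕ} (hp : p.Prime) : divisorDensity p = 2 / (p : ℝ) := by
  rw [divisorDensity_apply, hp.divisors, card_pair hp.one_lt.ne]
  norm_num

theorem isMultiplicative_divisorDensity : divisorDensity.IsMultiplicative :=
  isMultiplicative_sigma.natCast.pdiv isMultiplicative_id.natCast

/-- The sieve of the values `n * (m * n + j)`, `n < N`, by the primes up to `D` prime to
`2 * m * j`. -/
noncomputable def linearPairSieve (m j D N : ℕ) : BoundingSieve where
  support := (range N).image fun n => n * (m * n + j)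
  prodPrimes := primorialCoprime (2 * m * j) D
  prodPrimes_squarefree := squarefree_primorialCoprime _ _
  weights _ := 1
  weights_nonneg _ := zero_le_one
  totalMass := N
  nu := divisorDensity
  nu_mult := isMultiplicative_divisorDensity
  nu_pos_of_prime p hp _ := by
    rw [divisorDensity_prime hp]
    have := hp.pos
    positivity
  nu_lt_one_of_prime p hp hdvd := by
    have h2 : p ≠ 2 := by
      rintro rfl
      exact ((prime_dvd_primorialCoprime_iff hp).1 hdvd).2 ⟨m * j, by ring⟩
    have h3 : 2 < p := lt_of_le_of_ne hp.two_le h2.symm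
    rw [divisorDensity_prime hp, div_lt_one (by exact_mod_cast hp.pos)]
    exact_mod_cast h3

theorem mul_linear_injective {m j : ℕ} (hj : 0 < j) :
    Function.Injective fun n : ℕ => n * (m * n + j) := by
  refine StrictMono.injective fun a b hab => ?_
  exact Nat.mul_lt_mul_of_lt_of_le hab (by gcongr) (by omega)

theorem linearPairSieve_siftedSum_le {m j Q D N : ℕ} (hj : 0 < j) (hD : 1 ≤ D)
    (hQ : Q = 2 * m * j) :
    (linearPairSieve m j D N).siftedSum ≤
      N * (∑ n ∈ Icc 1 D with n.Coprime Q, coprimeTwoPowDiv Q n)⁻¹ + D ^ 10 := by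
  subst hQ
  set Q := 2 * m * j with hQ
  set s := linearPairSieve m j D N with hs
  have hP : s.prodPrimes = primorialCoprime Q D := rfl
  have hcopQ : ∀ d ∈ s.prodPrimes.divisors, d.Coprime Q := fun d hd =>
    Nat.coprime_of_dvd fun p hp hpd hpQ =>
      ((prime_dvd_primorialCoprime_iff hp).1 (hpd.trans (Nat.dvd_of_mem_divisors hd))).2 hpQ
  have hone : 1 ≤ ∑ n ∈ Icc 1 D with n.Coprime Q, coprimeTwoPowDiv Q n := by
    have hnn : ∀ n, 0 ≤ coprimeTwoPowDiv Q n := fun n => by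
      rw [coprimeTwoPowDiv_apply]; positivity
    calc (1 : ℝ) = coprimeTwoPowDiv Q 1 := (map_one _).symm
      _ ≤ _ := single_le_sum (f := fun n => coprimeTwoPowDiv Q n) (fun n _ => hnn n) (by simp [hD])
  refine (siftedSum_le_of_rem_le s hD (fun d hd => ?_) fun d hd => ?_).trans ?_
  · have hd0 := Nat.pos_of_mem_divisors hd
    change (divisorDensity d)⁻¹ ≤ d
    rw [divisorDensity_apply, inv_div]
    refine div_le_self (Nat.cast_nonneg d) ?_
    exact_mod_cast card_pos.2 ⟨1, Nat.one_mem_divisors.2 hd0.ne'⟩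
  · have hc := hcopQ d hd
    have hc' := hc
    rw [hQ] at hc
    have h := abs_card_filter_dvd_sub_le N (squarefree_of_mem_divisors_prodPrimes hd)
      (Nat.Coprime.coprime_mul_left_right (Nat.Coprime.coprime_mul_right_right hc))
      (Nat.Coprime.coprime_mul_left_right hc)
    have hrem : s.rem d = #{n ∈ range N | d ∣ n * (m * n + j)} - #d.divisors / (d : ℝ) * N := by
      rw [← divisorDensity_apply]
      change (∑ n ∈ (range N).image (fun n => n * (m * n + j)), if d ∣ n then (1 : ℝ) else 0) -
        divisorDensity d * N = _
      rw [sum_image fun a _ b _ hab => mul_linear_injective hj hab, sum_boole]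
    rw [hrem]
    exact h.trans (by exact_mod_cast Nat.card_divisors_le_self d)
  · have hle : ∑ n ∈ Icc 1 D with n.Coprime Q, coprimeTwoPowDiv Q n ≤
        ∑ l ∈ s.prodPrimes.divisors with l ≤ D, s.selbergTerms l := by
      refine sum_le_sum_selbergTerms s _ (fun n => ?_) (fun {p} hp => ?_) (fun p hp hpP => ?_) D
        fun n hn => ?_
      · rw [coprimeTwoPowDiv_apply]; positivity
      · rw [coprimeTwoPowDiv_apply]
        split_ifs with h
        · have h2 : p ≠ 2 := by
            rintro rfl
            exact hp.one_lt.ne' (Nat.eq_one_of_dvd_coprimes h dvd_rfl ⟨m * j, by rw [hQ]; ring⟩)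
          have h3 : 2 < p := lt_of_le_of_ne hp.two_le h2.symm
          rw [cardFactors_apply_prime hp, pow_one, Real.norm_of_nonneg (by positivity),
            div_lt_one (by exact_mod_cast hp.pos)]
          exact_mod_cast h3
        · simp
      · change _ = divisorDensity p
        rw [coprimeTwoPowDiv_apply, divisorDensity_prime hp, cardFactors_apply_prime hp, pow_one,
          if_pos ((Nat.Prime.coprime_iff_not_dvd hp).2
            ((prime_dvd_primorialCoprime_iff hp).1 hpP).2)]
      · obtain ⟨h1, hcop⟩ := mem_filter.1 hn
        rw [mem_Icc] at h1
        refine ⟨by omega, h1.2, fun p hp hpn => ?_⟩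
        refine (prime_dvd_primorialCoprime_iff hp).2 ⟨(Nat.le_of_dvd h1.1 hpn).trans h1.2, ?_⟩
        exact (Nat.Prime.coprime_iff_not_dvd hp).1 (hcop.coprime_dvd_left hpn)
    change (N : ℝ) * _ + _ ≤ _
    gcongr

theorem card_primes_le_siftedSum {m j D N : ℕ} (hm : 0 < m) (hj : 0 < j) :
    (#{p ∈ range N | p.Prime ∧ (m * p + j).Prime} : ℝ) ≤
      D + 1 + (linearPairSieve m j D N).siftedSum := by
  have hsift : (linearPairSieve m j D N).siftedSum =
      #{n ∈ range N | (primorialCoprime (2 * m * j) D).Coprime (n * (m * n + j))} := by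
    change (∑ n ∈ (range N).image (fun n => n * (m * n + j)),
      if (primorialCoprime (2 * m * j) D).Coprime n then (1 : ℝ) else 0) = _
    rw [sum_image fun a _ b _ hab => mul_linear_injective hj hab, sum_boole]
  rw [hsift]
  have hsub : (range N).filter (fun p => p.Prime ∧ (m * p + j).Prime) ⊆ range (D + 1) ∪
      (range N).filter
        (fun n => (primorialCoprime (2 * m * j) D).Coprime (n * (m * n + j))) := by
    intro p hp
    obtain ⟨hpN, hp1, hp2⟩ := mem_filter.1 hp
    rw [mem_union, mem_range, mem_filter]
    by_cases hpD : p < D + 1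
    · exact Or.inl hpD
    · refine Or.inr ⟨hpN, Nat.coprime_of_dvd fun q hq hqP hqf => ?_⟩
      have hqD := ((prime_dvd_primorialCoprime_iff hq).1 hqP).1
      have hlt : p < m * p + j := by nlinarith
      rcases (Nat.Prime.dvd_mul hq).1 hqf with h | h
      · rw [Nat.prime_dvd_prime_iff_eq hq hp1] at h
        omega
      · rw [Nat.prime_dvd_prime_iff_eq hq hp2] at h
        omega
  have := (card_le_card hsub).trans (card_union_le _ _)
  rw [card_range] at this
  exact_mod_cast this

/-- An upper bound of the right order of magnitude, along the powers of `2 ^ 24`. -/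
theorem exists_card_primes_le {m j : ℕ} (hm : 0 < m) (hj : 0 < j) :
    ∃ C : ℝ, 0 ≤ C ∧ ∀ k : ℕ, 0 < k →
      (#{p ∈ range (2 ^ (24 * k)) | p.Prime ∧ (m * p + j).Prime} : ℝ) ≤
        C * 2 ^ (24 * k) / k ^ 2 := by
  set Q := 2 * m * j with hQ
  have hQ0 : 0 < Q := by positivity
  have hlog2 : 0 < Real.log 2 := Real.log_pos one_lt_two
  refine ⟨3 * (Q : ℝ) ^ 20 + (Q : ℝ) ^ 2 / Real.log 2 ^ 2, by positivity, fun k hk => ?_⟩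
  set E := 2 ^ k * Q with hE
  have hE0 : 1 ≤ E := Nat.mul_pos (by positivity) hQ0
  have hD : 1 ≤ E ^ 2 := Nat.one_le_pow _ _ hE0
  set N := 2 ^ (24 * k) with hN
  have h1 := card_primes_le_siftedSum (D := E ^ 2) (N := N) hm hj
  have h2 := linearPairSieve_siftedSum_le (N := N) hj hD hQ
  have hS : (k * Real.log 2 / Q) ^ 2 ≤
      ∑ n ∈ Icc 1 (E ^ 2) with n.Coprime Q, coprimeTwoPowDiv Q n := by
    refine le_trans ?_ (sq_sum_inv_le_sum_coprimeTwoPowDiv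
      (T := (range (2 ^ k)).image fun i => i * Q + 1) fun a ha => ?_)
    · have := log_div_le_sum_inv Q (2 ^ k) hQ0
      push_cast at this
      rw [Real.log_pow] at this
      gcongr
    · obtain ⟨i, hi, rfl⟩ := mem_image.1 ha
      rw [mem_range] at hi
      refine ⟨by omega, ?_, by simp⟩
      calc i * Q + 1 ≤ i * Q + Q := by omega
        _ = (i + 1) * Q := by ring
        _ ≤ 2 ^ k * Q := Nat.mul_le_mul_right Q hi
  have hk' : (0 : ℝ) < k := by exact_mod_cast hk
  have hQ' : (0 : ℝ) < Q := by exact_mod_cast hQ0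
  have hmain : (N : ℝ) * (∑ n ∈ Icc 1 (E ^ 2) with n.Coprime Q, coprimeTwoPowDiv Q n)⁻¹ ≤
      (Q : ℝ) ^ 2 / Real.log 2 ^ 2 * N / k ^ 2 := by
    calc _ ≤ (N : ℝ) * ((k * Real.log 2 / Q) ^ 2)⁻¹ := by gcongr
      _ = _ := by field_simp
  have hE20 : (1 : ℝ) ≤ (E : ℝ) ^ 20 := one_le_pow₀ (by exact_mod_cast hE0)
  have hE2 : (E : ℝ) ^ 2 ≤ (E : ℝ) ^ 20 :=
    pow_le_pow_right₀ (by exact_mod_cast hE0) (by norm_num)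
  have hEN : (E : ℝ) ^ 20 ≤ (Q : ℝ) ^ 20 * N / k ^ 2 := by
    rw [le_div_iff₀ (by positivity)]
    have hk2 : (k : ℝ) ≤ 2 ^ k := by exact_mod_cast Nat.lt_two_pow_self.le
    calc (E : ℝ) ^ 20 * k ^ 2 ≤ (E : ℝ) ^ 20 * (2 ^ k) ^ 4 := by
          gcongr
          calc (k : ℝ) ^ 2 ≤ (2 ^ k) ^ 2 := by gcongr
            _ ≤ (2 ^ k) ^ 4 := pow_le_pow_right₀ (one_le_pow₀ one_le_two) (by norm_num)
      _ = (Q : ℝ) ^ 20 * N := by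
          rw [hE, hN]
          push_cast
          rw [mul_comm 24 k, pow_mul]
          ring
  have hcast : ((2 : ℝ) ^ (24 * k)) = N := by rw [hN]; push_cast; rfl
  rw [hcast]
  push_cast at h1 h2
  calc _ ≤ (E : ℝ) ^ 2 + 1 + ((Q : ℝ) ^ 2 / Real.log 2 ^ 2 * N / k ^ 2 + ((E : ℝ) ^ 2) ^ 10) :=
        h1.trans (by linarith)
    _ ≤ 3 * (E : ℝ) ^ 20 + (Q : ℝ) ^ 2 / Real.log 2 ^ 2 * N / k ^ 2 := by
        rw [← pow_mul]; linarith
    _ ≤ 3 * ((Q : ℝ) ^ 20 * N / k ^ 2) + (Q : ℝ) ^ 2 / Real.log 2 ^ 2 * N / k ^ 2 := by gcongr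
    _ = _ := by ring

/-- A set of naturals whose counting function is `O(x / log² x)` along a geometric sequence has
bounded sums of reciprocals. -/
theorem sum_one_div_le_of_card_le {q : ℕ → Prop} [DecidablePred q] {C : ℝ} (hC : 0 ≤ C) {b : ℕ}
    (hb : 0 < b)
    (h : ∀ k : ℕ, 0 < k → (#{p ∈ range (2 ^ (b * k)) | q p} : ℝ) ≤ C * 2 ^ (b * k) / k ^ 2)
    (N : ℕ) :
    ∑ p ∈ range N with q p, (1 : ℝ) / p ≤ C * 2 ^ b * ∑' k : ℕ, 1 / ((k : ℝ) + 1) ^ 2 := by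
  have hsummable : Summable fun k : ℕ => 1 / ((k : ℝ) + 1) ^ 2 := by
    have := (summable_nat_add_iff 1).2 (Real.summable_one_div_nat_pow.2 one_lt_two)
    simpa using this
  have hind : ∀ K : ℕ, ∑ p ∈ range (2 ^ (b * K)) with q p, (1 : ℝ) / p ≤
      C * 2 ^ b * ∑ k ∈ range K, 1 / ((k : ℝ) + 1) ^ 2 := by
    intro K
    induction K with
    | zero => simp [sum_filter]
    | succ K ih =>
      have hle : 2 ^ (b * K) ≤ 2 ^ (b * (K + 1)) :=
        Nat.pow_le_pow_right two_pos (Nat.mul_le_mul_left b K.le_succ)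
      have hblock : ∑ p ∈ Ico (2 ^ (b * K)) (2 ^ (b * (K + 1))) with q p, (1 : ℝ) / p ≤
          C * 2 ^ b * (1 / ((K : ℝ) + 1) ^ 2) := by
        have hsub : (Ico (2 ^ (b * K)) (2 ^ (b * (K + 1)))).filter q ⊆
            (range (2 ^ (b * (K + 1)))).filter q := by
          rw [range_eq_Ico]
          exact filter_subset_filter _ (Ico_subset_Ico_left (Nat.zero_le _))
        calc _ ≤ ∑ p ∈ Ico (2 ^ (b * K)) (2 ^ (b * (K + 1))) with q p,
              (1 : ℝ) / 2 ^ (b * K) := by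
              refine sum_le_sum fun p hp => ?_
              have hp' : ((2 : ℝ) ^ (b * K)) ≤ p := by
                exact_mod_cast (mem_Ico.1 (mem_filter.1 hp).1).1
              gcongr
          _ = #((Ico (2 ^ (b * K)) (2 ^ (b * (K + 1)))).filter q) * (1 / 2 ^ (b * K)) := by
              rw [sum_const, nsmul_eq_mul]
          _ ≤ (C * 2 ^ (b * (K + 1)) / ((K + 1 : ℕ) : ℝ) ^ 2) * (1 / 2 ^ (b * K)) := by
              gcongr
              exact le_trans (by exact_mod_cast card_le_card hsub) (h (K + 1) K.succ_pos)
          _ = _ := by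
              rw [mul_add, pow_add, mul_one]
              push_cast
              field_simp
      rw [sum_filter, ← sum_range_add_sum_Ico _ hle, ← sum_filter, ← sum_filter, sum_range_succ,
        mul_add (C * 2 ^ b)]
      exact add_le_add ih hblock
  have hNle : N ≤ 2 ^ (b * N) :=
    Nat.lt_two_pow_self.le.trans (Nat.pow_le_pow_right two_pos (Nat.le_mul_of_pos_left N hb))
  calc ∑ p ∈ range N with q p, (1 : ℝ) / p
      ≤ ∑ p ∈ range (2 ^ (b * N)) with q p, (1 : ℝ) / p :=
        sum_le_sum_of_subset_of_nonneg
          (filter_subset_filter _ (range_subset_range.2 hNle)) fun _ _ _ => by positivity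
    _ ≤ C * 2 ^ b * ∑ k ∈ range N, 1 / ((k : ℝ) + 1) ^ 2 := hind N
    _ ≤ _ := by
        gcongr
        exact hsummable.sum_le_tsum _ fun _ _ => by positivity

end BrunSum

/-- Brun-type theorem: for positive integers `m`, `j`, the sum of reciprocals of
primes `p` such that `m*p + j` is also prime converges (partial sums are bounded). -/
theorem stmt_0 (m j : ℕ) (hm : 0 < m) (hj : 0 < j) :
    ∃ C : ℝ, ∀ N : ℕ,
      ∑ p ∈ (Finset.range N).filter (fun p => p.Prime ∧ (m * p + j).Prime),
        (1 : ℝ) / p ≤ C := by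
  obtain ⟨C, hC, h⟩ := BrunSum.exists_card_primes_le hm hj
  exact ⟨_, BrunSum.sum_one_div_le_of_card_le hC (by norm_num) h⟩
end

section
/- For every sufficiently large n, there exists an n-bit prime p (i.e. 2^(n-1) ≤ p < 2^n) such that flipping any single bit of the binary expansion of p yields a composite number or the number 1. -/
open MeasureTheory Filter Topology FourierTransform Real

/-- The Fourier transform of an even real-valued function is real-valued. -/
theorem im_fourier_ofReal_eq_zero_of_even {f : ℝ → ℝ} (hf : ∀ x, f (-x) = f x) (u : ℝ) :
    (𝓕 (fun x ↦ (f x : ℂ)) u).im = 0 := by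
  rw [← Complex.conj_eq_iff_im, Real.fourier_real_eq_integral_exp_smul, ← integral_conj,
    ← integral_neg_eq_self]
  refine integral_congr_ae (.of_forall fun x ↦ ?_)
  simp [hf, ← Complex.exp_conj, Complex.conj_ofNat]

/-- Linearity of the Fourier transform, for integrable functions and a real scalar. -/
theorem fourier_add_smul {f g : ℝ → ℂ} (hf : Integrable f) (hg : Integrable g) (c u : ℝ) :
    𝓕 (fun x ↦ f x + c • g x) u = 𝓕 f u + c * 𝓕 g u := by
  have hf' := (Real.fourierIntegral_convergent_iff u).2 hf
  have hg' := (Real.fourierIntegral_convergent_iff u).2 hg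
  simp only [RCLike.inner_apply, conj_trivial, mul_comm u] at hf' hg'
  simp only [Real.fourier_real_eq, ← integral_const_mul]
  rw [← integral_add hf' (hg'.const_mul _)]
  refine integral_congr_ae (.of_forall fun x ↦ ?_)
  simp only [Circle.smul_def, smul_eq_mul, Complex.real_smul]
  ring

/-- There is a compactly supported continuous function whose Fourier transform is real-valued,
integrable, nonpositive outside a bounded set, and has positive integral. -/
theorem exists_fourier_nonpos_outside :
    ∃ (φ : ℝ → ℂ) (k : ℝ → ℝ) (δ : ℝ), Continuous φ ∧ HasCompactSupport φ ∧
      (∀ u, 𝓕 φ u = k u) ∧ Integrable k ∧ 0 < ∫ u, k u ∧ 0 < δ ∧ ∀ u, δ ≤ |u| → k u ≤ 0 := by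
  let B : ContDiffBump (0 : ℝ) := default
  let f : ℝ → ℂ := fun x ↦ (B x : ℂ)
  have hfs : HasCompactSupport f := B.hasCompactSupport.comp_left (g := fun x : ℝ ↦ (x : ℂ)) rfl
  have hfd : ContDiff ℝ (⊤ : ℕ∞) f := Complex.ofRealCLM.contDiff.comp B.contDiff
  have hds : HasCompactSupport (deriv f) := hfs.deriv
  have hdd : ContDiff ℝ (⊤ : ℕ∞) (deriv f) := ((contDiff_infty_iff_deriv).1 hfd).2
  have hfi : Integrable f := hfd.continuous.integrable_of_hasCompactSupport hfs
  have hdi : Integrable (deriv f) := hdd.continuous.integrable_of_hasCompactSupport hds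
  have hFd : 𝓕 (deriv f) = fun x : ℝ ↦ (2 * π * Complex.I * x) • 𝓕 f x :=
    Real.fourier_deriv hfi (hfd.differentiable (by simp)) hdi
  let S : SchwartzMap ℝ ℂ := 𝓕 (hfs.toSchwartzMap hfd)
  let S' : SchwartzMap ℝ ℂ := 𝓕 (hds.toSchwartzMap hdd)
  have hS : ⇑S = 𝓕 f := rfl
  have hS' : ⇑S' = 𝓕 (deriv f) := rfl
  let h : ℝ → ℝ := fun u ↦ (𝓕 f u).re
  have hh : ∀ u, 𝓕 f u = h u := fun u ↦ Complex.ext rfl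
    (by simpa using im_fourier_ofReal_eq_zero_of_even (f := B) B.neg u)
  have sq_int (T : SchwartzMap ℝ ℂ) : Integrable fun u ↦ T u * T u :=
    T.integrable.bdd_mul T.continuous.aestronglyMeasurable
      (.of_forall fun x ↦ T.norm_le_seminorm ℝ x)
  have hi1 : Integrable fun u ↦ h u ^ 2 := by
    refine (sq_int S).re.congr (.of_forall fun u ↦ ?_)
    simp [hS, hh, ← Complex.ofReal_mul, sq]
  have hi2 : Integrable fun u ↦ (2 * π * u) ^ 2 * h u ^ 2 := by
    refine (sq_int S').re.neg.congr (.of_forall fun u ↦ ?_)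
    have : (2 * π * Complex.I * u * h u) * (2 * π * Complex.I * u * h u)
      = ((-((2 * π * u) ^ 2 * h u ^ 2) : ℝ) : ℂ) := by
      push_cast; linear_combination (4 * π ^ 2 * u ^ 2 * h u ^ 2 : ℂ) * Complex.I_sq
    simp only [hS', hFd, hh, smul_eq_mul, this, Pi.neg_apply]
    simp [-Complex.ofReal_neg]
  have hpos : 0 < ∫ u, h u ^ 2 := by
    refine integral_pos_of_integrable_nonneg_nonzero (x := 0) ?_ hi1 (fun u ↦ sq_nonneg _) ?_
    · have : Continuous (𝓕 f) := hS ▸ S.continuous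
      fun_prop
    · have : h 0 = ∫ x, B x := by
        simp only [h, Real.fourier_real_eq, f, mul_zero, neg_zero, AddChar.map_zero_eq_one,
          one_smul]
        rw [integral_complex_ofReal, Complex.ofReal_re]
      simpa [this] using B.integral_pos.ne'
  obtain ⟨c, hc, hck⟩ : ∃ c : ℝ, 0 < c ∧ c * ∫ u, (2 * π * u) ^ 2 * h u ^ 2 < ∫ u, h u ^ 2 := by
    have hJ : 0 ≤ ∫ u, (2 * π * u) ^ 2 * h u ^ 2 := integral_nonneg fun u ↦ by positivity
    refine ⟨(∫ u, h u ^ 2) / (1 + ∫ u, (2 * π * u) ^ 2 * h u ^ 2), by positivity, ?_⟩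
    rw [div_mul_eq_mul_div, div_lt_iff₀ (by positivity)]
    nlinarith
  let μ := ContinuousLinearMap.mul ℂ ℂ
  let ψ := convolution f f μ volume
  let χ := convolution (deriv f) (deriv f) μ volume
  have hψ : Continuous ψ := hfs.continuous_convolution_left μ hfd.continuous hfi.locallyIntegrable
  have hχ : Continuous χ := hds.continuous_convolution_left μ hdd.continuous hdi.locallyIntegrable
  have hψs : HasCompactSupport ψ := HasCompactSupport.convolution μ hfs hfs
  have hχs : HasCompactSupport χ := HasCompactSupport.convolution μ hds hds
  refine ⟨fun x ↦ ψ x + c • χ x, fun u ↦ h u ^ 2 - c * ((2 * π * u) ^ 2 * h u ^ 2),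
    1 / (2 * π * √c), by fun_prop, hψs.add (hχs.mono' ?_), fun u ↦ ?_, hi1.sub (hi2.const_mul c),
    ?_, by positivity, fun u hu ↦ ?_⟩
  · exact (Function.support_const_smul_subset c χ).trans (subset_tsupport _)
  · have e1 : 𝓕 ψ u = 𝓕 f u * 𝓕 f u := Real.fourier_mul_convolution_eq hfi hfi u
    have e2 : 𝓕 χ u = 𝓕 (deriv f) u * 𝓕 (deriv f) u := Real.fourier_mul_convolution_eq hdi hdi u
    have iψ : Integrable ψ := hψ.integrable_of_hasCompactSupport hψs
    have iχ : Integrable χ := hχ.integrable_of_hasCompactSupport hχs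
    have e3 : 𝓕 (fun x ↦ ψ x + c • χ x) u = 𝓕 ψ u + c * 𝓕 χ u := by
      exact fourier_add_smul iψ iχ c u
    rw [e3, e1, e2, hFd, hh]
    simp only [smul_eq_mul, hh]
    push_cast
    linear_combination (c * 4 * π ^ 2 * u ^ 2 * h u ^ 2 : ℂ) * Complex.I_sq
  · rw [integral_sub hi1 (hi2.const_mul c), integral_const_mul]
    linarith
  · have h1 : 1 ≤ c * (2 * π * u) ^ 2 := by
      rw [div_le_iff₀ (by positivity)] at hu
      have := mul_self_le_mul_self zero_le_one hu
      have e : |u| * (2 * π * √c) * (|u| * (2 * π * √c)) = |u| ^ 2 * (2 * π) ^ 2 * √c ^ 2 := by ring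
      rw [e, sq_abs, Real.sq_sqrt hc.le] at this
      linarith
    nlinarith [sq_nonneg (h u)]

/-- For every `δ > 0` there is a compactly supported continuous function whose Fourier transform is
real-valued, integrable, nonpositive outside `(-δ, δ)`, and has positive integral. -/
theorem exists_fourier_nonpos_of_le_abs {δ : ℝ} (hδ : 0 < δ) :
    ∃ (φ : ℝ → ℂ) (k : ℝ → ℝ), Continuous φ ∧ HasCompactSupport φ ∧
      (∀ u, 𝓕 φ u = k u) ∧ Integrable k ∧ 0 < ∫ u, k u ∧ ∀ u, δ ≤ |u| → k u ≤ 0 := by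
  obtain ⟨φ, k, δ₀, hφ, hφs, hk, hki, hkp, hδ₀, hkn⟩ := exists_fourier_nonpos_outside
  let s := δ₀ / δ
  have hs : 0 < s := by positivity
  refine ⟨fun t ↦ φ (s⁻¹ * t), fun u ↦ s * k (s * u), by fun_prop, ?_, fun u ↦ ?_, ?_, ?_,
    fun u hu ↦ ?_⟩
  · exact hφs.comp_homeomorph (Homeomorph.mulLeft₀ s⁻¹ (by positivity))
  · push_cast
    rw [← hk, Real.fourier_real_eq, Real.fourier_real_eq]
    have := Measure.integral_comp_mul_left (fun v : ℝ ↦ 𝐞 (-(v * (s * u))) • φ v) s⁻¹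
    rw [inv_inv, abs_of_pos hs, Complex.real_smul] at this
    rw [← this]
    refine integral_congr_ae (.of_forall fun x ↦ ?_)
    have : s⁻¹ * x * (s * u) = x * u := by field_simp
    simp only [this]
  · exact (hki.comp_mul_left' hs.ne').const_mul s
  · rw [integral_const_mul, Measure.integral_comp_mul_left]
    simp only [smul_eq_mul]
    positivity
  · refine mul_nonpos_of_nonneg_of_nonpos hs.le (hkn _ ?_)
    rw [abs_mul, abs_of_pos hs]
    calc δ₀ = s * δ := by simp only [s]; field_simp
      _ ≤ _ := by gcongr

theorem LSeries_term_add_mul_I (f : ℕ → ℂ) (s : ℂ) (t : ℝ) (n : ℕ) :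
    LSeries.term f (s + 2 * π * t * Complex.I) n = LSeries.term f s n * 𝐞 (-(t * Real.log n)) := by
  rcases eq_or_ne n 0 with rfl | hn
  · simp
  have hn' : (n : ℂ) ≠ 0 := mod_cast hn
  rw [LSeries.term_of_ne_zero hn, LSeries.term_of_ne_zero hn, Complex.cpow_add _ _ hn',
    div_mul_eq_div_div, div_eq_mul_inv (f n / _)]
  congr 1
  rw [Complex.cpow_def_of_ne_zero hn', ← Complex.exp_neg, Real.fourierChar_apply,
    ← Complex.natCast_log]
  congr 1
  push_cast
  ring

/-- Integrating a test function against an L-series on a vertical line produces a sum weighted by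
the Fourier transform of the test function. -/
theorem hasSum_term_mul_fourier {f : ℕ → ℂ} {φ : ℝ → ℂ} (hφ : Integrable φ) {s : ℂ}
    (hs : LSeriesSummable f s) (y : ℝ) :
    HasSum (fun n ↦ LSeries.term f s n * 𝓕 φ (Real.log n - y))
      (∫ t : ℝ, 𝐞 (t * y) • (φ t * LSeries f (s + 2 * π * t * Complex.I))) := by
  have key (n : ℕ) (t : ℝ) :
      𝐞 (t * y) • (φ t * LSeries.term f (s + 2 * π * t * Complex.I) n) =
        LSeries.term f s n * (𝐞 (-(t * (Real.log n - y))) • φ t) := by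
    have h : -(t * (Real.log n - y)) = t * y + -(t * Real.log n) := by ring
    rw [LSeries_term_add_mul_I, h, AddChar.map_add_eq_mul]
    simp only [Circle.smul_def, smul_eq_mul, Circle.coe_mul]
    ring
  have hint (n : ℕ) : Integrable
      fun t : ℝ ↦ 𝐞 (t * y) • (φ t * LSeries.term f (s + 2 * π * t * Complex.I) n) := by
    simp only [key]
    have := (Real.fourierIntegral_convergent_iff (Real.log n - y)).2 hφ
    simp only [RCLike.inner_apply, conj_trivial, mul_comm (Real.log n - y)] at this
    exact this.const_mul _
  have := hasSum_integral_of_summable_integral_norm hint (by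
    simp only [key, norm_mul, Circle.norm_smul, integral_const_mul]
    exact hs.norm.mul_right _)
  convert! this using 1
  · funext n
    simp only [key, integral_const_mul, Real.fourier_real_eq]
  · refine integral_congr_ae (.of_forall fun t ↦ ?_)
    simp only [Circle.smul_def, smul_eq_mul, LSeries, tsum_mul_left]

/-- Integrating a test function against `1 / (s - 1)` on the line `re s = 1 + ε`. -/
theorem integral_fourierChar_smul_div {φ : ℝ → ℂ} (hφ : Integrable φ) {ε : ℝ} (hε : 0 < ε) (y : ℝ) :
    ∫ t : ℝ, 𝐞 (t * y) • (φ t * (1 / (ε + 2 * π * t * Complex.I))) =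
      ∫ u in Set.Ioi (0 : ℝ), Real.exp (-ε * u) * 𝓕 φ (u - y) := by
  let H : ℝ → ℝ → ℂ := fun t u ↦ Real.exp (-ε * u) * 𝐞 (-(t * (u - y))) * φ t
  have hH : Integrable (Function.uncurry H) (volume.prod (volume.restrict (Set.Ioi 0))) := by
    have h1 : Integrable (fun z : ℝ × ℝ ↦ φ z.1 * (Real.exp (-ε * z.2) : ℂ))
        (volume.prod (volume.restrict (Set.Ioi 0))) :=
      hφ.mul_prod (g := fun u : ℝ ↦ (Real.exp (-ε * u) : ℂ))
        (integrableOn_exp_mul_Ioi (neg_lt_zero.2 hε) 0).ofReal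
    have h2 := h1.bdd_mul (f := fun z : ℝ × ℝ ↦ (𝐞 (-(z.1 * (z.2 - y))) : ℂ)) (c := 1)
      (Continuous.aestronglyMeasurable (by fun_prop)) (.of_forall fun z ↦ (Circle.norm_coe _).le)
    refine h2.congr (.of_forall fun z ↦ ?_)
    simp only [Function.uncurry, H]
    ring
  calc
    _ = ∫ t : ℝ, ∫ u in Set.Ioi (0 : ℝ), H t u := by
      refine integral_congr_ae (.of_forall fun t ↦ ?_)
      have hre : (-(ε + 2 * π * t * Complex.I)).re < 0 := by simpa using hε
      have e1 := integral_exp_mul_complex_Ioi hre 0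
      have e2 (u : ℝ) : H t u =
          (𝐞 (t * y) * φ t) * Complex.exp (-(ε + 2 * π * t * Complex.I) * u) := by
        have h : -(t * (u - y)) = t * y + -(t * u) := by ring
        have h' : Complex.exp (-(ε + 2 * π * t * Complex.I) * u)
            = Real.exp (-ε * u) * 𝐞 (-(t * u)) := by
          rw [Real.fourierChar_apply, Complex.ofReal_exp, ← Complex.exp_add]
          congr 1
          push_cast
          ring
        simp only [H, h, h', AddChar.map_add_eq_mul, Circle.coe_mul]
        ring
      simp only [e2, integral_const_mul, e1, Circle.smul_def, smul_eq_mul]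
      rw [Complex.ofReal_zero, mul_zero, Complex.exp_zero, neg_div_neg_eq, ← mul_assoc]
    _ = ∫ u in Set.Ioi (0 : ℝ), ∫ t : ℝ, H t u := integral_integral_swap hH
    _ = _ := by
      refine integral_congr_ae (.of_forall fun u ↦ ?_)
      simp only [H, mul_assoc, integral_const_mul, Real.fourier_real_eq, Circle.smul_def,
        smul_eq_mul]

/-- A short-interval consequence of a Wiener-Ikehara type hypothesis: if the L-series of a
nonnegative sequence `f` is continuous on `1 ≤ re s` up to a simple pole at `1` with positive
residue, then `f` does not vanish on multiplicatively short intervals far out. -/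
theorem eventually_exists_pos_of_continuousOn_LSeries_sub {f : ℕ → ℝ} (hf : ∀ n, 0 ≤ f n)
    (hfs : ∀ s : ℂ, 1 < s.re → LSeriesSummable (fun n ↦ (f n : ℂ)) s) {c : ℝ} (hc : 0 < c)
    {G : ℂ → ℂ} (hG : ContinuousOn G {s | 1 ≤ s.re})
    (hfG : ∀ s : ℂ, 1 < s.re → LSeries (fun n ↦ (f n : ℂ)) s = G s + c / (s - 1))
    {δ : ℝ} (hδ : 0 < δ) :
    ∀ᶠ y : ℝ in atTop, ∃ n : ℕ, 0 < f n ∧ |Real.log n - y| < δ := by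
  obtain ⟨φ, k, hφ, hφs, hk, hki, hkp, hkn⟩ := exists_fourier_nonpos_of_le_abs hδ
  have hφi : Integrable φ := hφ.integrable_of_hasCompactSupport hφs
  let R : ℝ → ℝ → ℂ := fun y ε ↦
    ∫ t : ℝ, 𝐞 (t * y) • (φ t * G (1 + |ε| + 2 * π * t * Complex.I))
  let M : ℝ → ℝ → ℝ := fun y ε ↦ ∫ u in Set.Ioi (0 : ℝ), Real.exp (-ε * u) * k (u - y)
  have hGc : Continuous fun p : ℝ × ℝ ↦ G (1 + |p.1| + 2 * π * p.2 * Complex.I) :=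
    hG.comp_continuous (by fun_prop) fun p ↦ by simp
  have hGi (ε : ℝ) : Integrable fun t : ℝ ↦ φ t * G (1 + |ε| + 2 * π * t * Complex.I) :=
    (hφ.mul (hGc.comp (Continuous.prodMk_right ε))).integrable_of_hasCompactSupport hφs.mul_right
  have smul_int {g : ℝ → ℂ} (hg : Integrable g) (y : ℝ) : Integrable fun t ↦ 𝐞 (t * y) • g t := by
    have := (Real.fourierIntegral_convergent_iff (-y)).2 hg
    simpa [mul_comm y] using this
  have hR_cont (y : ℝ) : Continuous (R y) := by
    have := continuous_parametric_integral_of_continuous (μ := volume) (f := fun ε t : ℝ ↦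
      𝐞 (t * y) • (φ t * G (1 + |ε| + 2 * π * t * Complex.I))) (by
        have := (hφ.comp continuous_snd).mul hGc
        simp only [Function.uncurry_def]
        exact Continuous.smul (by fun_prop) this) hφs
    refine this.congr fun ε ↦ setIntegral_eq_integral_of_forall_compl_eq_zero fun t ht ↦ ?_
    simp [image_eq_zero_of_notMem_tsupport ht]
  have hR_lim : Tendsto (fun y ↦ R y 0) atTop (𝓝 0) := by
    have := (Real.tendsto_integral_exp_smul_cocompact
      (fun t : ℝ ↦ φ t * G (1 + |(0 : ℝ)| + 2 * π * t * Complex.I))).comp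
      (tendsto_neg_atTop_atBot.mono_right atBot_le_cocompact)
    simpa [Function.comp_def, R] using this
  have hkiy (y : ℝ) : Integrable fun u ↦ k (u - y) := hki.comp_sub_right y
  have hM_lim (y : ℝ) : Tendsto (M y) (𝓝[>] 0) (𝓝 (M y 0)) := by
    refine tendsto_integral_filter_of_dominated_convergence (fun u ↦ ‖k (u - y)‖)
      (.of_forall fun ε ↦ ?_) ?_ (hkiy y).norm.integrableOn (.of_forall fun u ↦ ?_)
    · exact (Continuous.aestronglyMeasurable (by fun_prop)).mul
        (hkiy y).aestronglyMeasurable.restrict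
    · filter_upwards [self_mem_nhdsWithin] with ε hε
      filter_upwards [ae_restrict_mem measurableSet_Ioi] with u hu
      rw [norm_mul, Real.norm_of_nonneg (Real.exp_pos _).le]
      refine mul_le_of_le_one_left (norm_nonneg _) (Real.exp_le_one_iff.2 ?_)
      have : 0 < ε * u := mul_pos hε hu
      linarith
    · exact (Continuous.tendsto (by fun_prop) _).mono_left nhdsWithin_le_nhds
  have hM_lim' : Tendsto (fun y ↦ M y 0) atTop (𝓝 (∫ u, k u)) := by
    have h := tendsto_setIntegral_of_monotone (μ := volume) (f := k)
      (s := fun y : ℝ ↦ Set.Ioi (-y)) (fun y ↦ measurableSet_Ioi)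
      (fun a b hab ↦ Set.Ioi_subset_Ioi (neg_le_neg hab)) hki.integrableOn
    have hU : ⋃ y : ℝ, Set.Ioi (-y) = Set.univ :=
      Set.eq_univ_of_forall fun x ↦ Set.mem_iUnion.2 ⟨1 - x, by simp⟩
    rw [hU, setIntegral_univ] at h
    refine h.congr fun y ↦ ?_
    have := (measurePreserving_sub_right volume y).setIntegral_preimage_emb
      (MeasurableEquiv.subRight y).measurableEmbedding k (Set.Ioi (-y))
    simpa [M] using this.symm
  have identity (y : ℝ) {ε : ℝ} (hε : 0 < ε) :
      HasSum (fun n ↦ LSeries.term (fun n ↦ (f n : ℂ)) (1 + ε) n * k (Real.log n - y))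
        (R y ε + c * M y ε) := by
    have h := hasSum_term_mul_fourier hφi (hfs (1 + ε) (by simpa)) y
    simp only [hk] at h
    convert h using 1
    have hpole := integral_fourierChar_smul_div hφi hε y
    simp only [hk] at hpole
    have hM : (M y ε : ℂ) = ∫ t : ℝ, 𝐞 (t * y) • (φ t * (1 / (ε + 2 * π * t * Complex.I))) := by
      rw [hpole]
      simp only [M, ← integral_complex_ofReal]
      push_cast
      rfl
    have hpi : Integrable fun t : ℝ ↦ φ t * (1 / (ε + 2 * π * t * Complex.I)) := by
      refine Continuous.integrable_of_hasCompactSupport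
        (hφ.mul (continuous_const.div (by fun_prop) fun t h0 ↦ ?_)) hφs.mul_right
      have := congrArg Complex.re h0
      simp at this
      exact hε.ne' this
    rw [hM, ← integral_const_mul, ← integral_add (smul_int (hGi ε) y)
      ((smul_int hpi y).const_mul _)]
    refine integral_congr_ae (.of_forall fun t ↦ ?_)
    simp only [Circle.smul_def, smul_eq_mul]
    rw [hfG _ (by simpa), abs_of_pos hε]
    ring
  have hlim : Tendsto (fun y ↦ (R y 0).re + c * M y 0) atTop (𝓝 (c * ∫ u, k u)) := by
    simpa using ((Complex.continuous_re.tendsto _).comp hR_lim).add (hM_lim'.const_mul c)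
  filter_upwards [hlim.eventually_const_lt (mul_pos hc hkp)] with y hy
  have hlim2 : Tendsto (fun ε ↦ (R y ε).re + c * M y ε) (𝓝[>] 0)
      (𝓝 ((R y 0).re + c * M y 0)) :=
    (((Complex.continuous_re.comp (hR_cont y)).tendsto 0).mono_left nhdsWithin_le_nhds).add
      ((hM_lim y).const_mul c)
  obtain ⟨ε, hε, hε0⟩ := ((hlim2.eventually_const_lt hy).and self_mem_nhdsWithin).exists
  have hε0 : 0 < ε := hε0
  have hre := Complex.hasSum_re (identity y hε0)
  by_contra! hcon
  refine hε.not_ge ?_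
  have e : (R y ε + c * M y ε : ℂ).re = (R y ε).re + c * M y ε := by
    simp [← Complex.ofReal_mul]
  rw [← e, ← hre.tsum_eq]
  refine tsum_nonpos fun n ↦ ?_
  rcases eq_or_ne n 0 with rfl | hn
  · simp
  have hterm : LSeries.term (fun n ↦ (f n : ℂ)) (1 + ε) n = ((f n / n ^ (1 + ε) : ℝ) : ℂ) := by
    rw [LSeries.term_of_ne_zero hn]
    push_cast
    rw [Complex.ofReal_cpow n.cast_nonneg]
    simp
  rw [hterm, ← Complex.ofReal_mul, Complex.ofReal_re]
  rcases (hf n).eq_or_lt with h0 | h0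
  · simp [← h0]
  · exact mul_nonpos_of_nonneg_of_nonpos (by positivity) (hkn _ (hcon n h0))

open ArithmeticFunction.vonMangoldt in
/-- For every `δ > 0` and every reduced residue class, all intervals `(e^(y - δ), e^(y + δ))` with
`y` large enough contain a prime in that class. -/
theorem eventually_exists_prime_abs_log_sub_lt {q : ℕ} [NeZero q] {a : ZMod q} (ha : IsUnit a)
    {δ : ℝ} (hδ : 0 < δ) :
    ∀ᶠ y : ℝ in atTop, ∃ p : ℕ, p.Prime ∧ (p : ZMod q) = a ∧ |Real.log p - y| < δ := by
  let f : ℕ → ℝ := fun n ↦ if n.Prime then residueClass a n else 0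
  let g : ℕ → ℝ := fun n ↦ if n.Prime then 0 else residueClass a n
  have hfg (n : ℕ) : f n + g n = residueClass a n := by
    by_cases h : n.Prime <;> simp [f, g, h]
  have hf0 (n : ℕ) : 0 ≤ f n := by
    by_cases h : n.Prime <;> simp [f, h, residueClass_nonneg a n]
  have hg0 (n : ℕ) : 0 ≤ g n := by
    by_cases h : n.Prime <;> simp [g, h, residueClass_nonneg a n]
  have hterm (n : ℕ) (s : ℂ) (hs : 1 ≤ s.re) :
      ‖LSeries.term (fun n ↦ (g n : ℂ)) s n‖ ≤ g n / n := by
    rcases eq_or_ne n 0 with rfl | hn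
    · simp
    rw [LSeries.norm_term_eq, if_neg hn, Complex.norm_real, Real.norm_of_nonneg (hg0 n)]
    have h1 : (1 : ℝ) ≤ n := mod_cast Nat.one_le_iff_ne_zero.2 hn
    have := hg0 n
    gcongr
    exact Real.self_le_rpow_of_one_le h1 hs
  have hgs (s : ℂ) (hs : 1 ≤ s.re) : LSeriesSummable (fun n ↦ (g n : ℂ)) s :=
    .of_norm_bounded (summable_residueClass_non_primes_div a) fun n ↦ hterm n s hs
  have hΛs (s : ℂ) (hs : 1 < s.re) : LSeriesSummable (fun n ↦ (residueClass a n : ℂ)) s :=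
    LSeriesSummable_of_abscissaOfAbsConv_lt_re <|
      (abscissaOfAbsConv_residueClass_le_one a).trans_lt (mod_cast hs)
  have hf_eq : (fun n ↦ (f n : ℂ)) = (fun n ↦ (residueClass a n : ℂ)) - fun n ↦ (g n : ℂ) := by
    funext n
    simp only [Pi.sub_apply, ← hfg]
    push_cast
    ring
  have hcont : ContinuousOn (LSeries fun n ↦ (g n : ℂ)) {s | 1 ≤ s.re} := by
    refine continuousOn_tsum (fun n ↦ ?_) (summable_residueClass_non_primes_div a) hterm
    rcases eq_or_ne n 0 with rfl | hn
    · simpa using continuousOn_const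
    simp only [LSeries.term_of_ne_zero hn]
    have hn' : (n : ℂ) ≠ 0 := mod_cast hn
    exact (continuous_const.div (continuous_const.cpow continuous_id fun _ ↦ .inl (by simp; omega))
      fun s ↦ by simp [Complex.cpow_eq_zero_iff, hn']).continuousOn
  have hφ : (0 : ℝ) < (q.totient : ℝ)⁻¹ :=
    inv_pos.2 (mod_cast Nat.totient_pos.2 (NeZero.pos q))
  have hL (s : ℂ) (hs : 1 < s.re) : LSeries (fun n ↦ (f n : ℂ)) s =
      LFunctionResidueClassAux a s - LSeries (fun n ↦ (g n : ℂ)) s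
        + ((q.totient : ℝ)⁻¹ : ℝ) / (s - 1) := by
    rw [hf_eq, LSeries_sub (hΛs s hs) (hgs s hs.le),
      eqOn_LFunctionResidueClassAux ha hs]
    push_cast
    ring
  filter_upwards [eventually_exists_pos_of_continuousOn_LSeries_sub hf0
    (fun s hs ↦ hf_eq ▸ (hΛs s hs).sub (hgs s hs.le)) hφ
    ((continuousOn_LFunctionResidueClassAux a).sub hcont) hL hδ] with y ⟨n, hn, hny⟩
  by_cases hp : n.Prime
  · refine ⟨n, hp, ?_, hny⟩
    by_contra hna
    simp [f, hp, hna] at hn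
  · simp [f, hp] at hn

theorem Nat.xor_two_pow_eq_or (p i : ℕ) :
    p ^^^ 2 ^ i = p + 2 ^ i ∨ (p ^^^ 2 ^ i) + 2 ^ i = p := by
  induction i generalizing p with
  | zero =>
    have h1 : (p ^^^ 1) / 2 = p / 2 := by simp [Nat.xor_div_two]
    have h2 : (p ^^^ 1) % 2 = (p + 1) % 2 := by simp [Nat.xor_mod_two_eq]
    simp only [pow_zero]
    omega
  | succ i ih =>
    have h1 : (p ^^^ 2 ^ (i + 1)) / 2 = p / 2 ^^^ 2 ^ i := by simp [Nat.xor_div_two, pow_succ]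
    have h2 : (p ^^^ 2 ^ (i + 1)) % 2 = p % 2 := by
      rw [Nat.xor_mod_two_eq, pow_succ]
      omega
    have := ih (p / 2)
    rw [← h1] at this
    rw [pow_succ] at *
    omega

/-- The moduli of a pair of covering systems of congruences with period `720`. -/
def coveringPrimes : List ℕ :=
  [3, 5, 7, 11, 13, 17, 19, 31, 37, 41, 61, 73, 97, 109, 151, 241, 257, 331]

set_option exponentiation.threshold 1000 in
theorem coveringPrimes_spec : ∀ q ∈ coveringPrimes, 1 < q ∧ q ≤ 331 ∧
    q ∣ 66483084961588510124010691590 ∧ 2 ^ 720 % q = 1 := by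
  decide +kernel

theorem coveringPrimes_cover : ∀ r < 720,
    (∃ q ∈ coveringPrimes, (47867742232066880047611079 + 2 ^ r) % q = 0) ∧
    ∃ q ∈ coveringPrimes, 47867742232066880047611079 % q = 2 ^ r % q := by
  decide +kernel

set_option exponentiation.threshold 1000 in
/-- A residue class all of whose members differ from every power of two, in both directions, by a
multiple of a small prime. -/
theorem exists_residue_covering : ∃ a M : ℕ, M ≠ 0 ∧ a.Coprime M ∧ ∀ p, p ≡ a [MOD M] → ∀ i,
    (∃ q, 1 < q ∧ q ≤ 331 ∧ q ∣ p + 2 ^ i) ∧ ∃ q, 1 < q ∧ q ≤ 331 ∧ p ≡ 2 ^ i [MOD q] := by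
  refine ⟨47867742232066880047611079, 66483084961588510124010691590, by norm_num, by norm_num,
    fun p hp i ↦ ?_⟩
  have hpow {q : ℕ} (hq : q ∈ coveringPrimes) : 2 ^ (i % 720) ≡ 2 ^ i [MOD q] := by
    obtain ⟨h1, -, -, h⟩ := coveringPrimes_spec q hq
    have h720 : 2 ^ 720 ≡ 1 [MOD q] := by rw [Nat.ModEq, h, Nat.mod_eq_of_lt h1]
    conv_rhs => rw [← Nat.mod_add_div i 720, pow_add, pow_mul]
    simpa using ((h720.pow (i / 720)).mul_left (2 ^ (i % 720))).symm
  obtain ⟨⟨q, hq, h⟩, q', hq', h'⟩ := coveringPrimes_cover (i % 720) (Nat.mod_lt _ (by norm_num))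
  obtain ⟨h1, h2, h3, -⟩ := coveringPrimes_spec q hq
  obtain ⟨h1', h2', h3', -⟩ := coveringPrimes_spec q' hq'
  refine ⟨⟨q, h1, h2, ?_⟩, q', h1', h2', ?_⟩
  · exact (((hp.of_dvd h3).add (hpow hq).symm).dvd_iff dvd_rfl).2 (Nat.dvd_of_mod_eq_zero h)
  · exact (hp.of_dvd h3').trans (Nat.ModEq.trans h' (hpow hq'))

/-- For every sufficiently large `n`, there is an `n`-bit prime `p` such that
flipping any single one of its `n` bits yields a composite number or the number `1`. -/
theorem stmt_11 :
    ∃ n₀ : ℕ, ∀ n ≥ n₀, ∃ p : ℕ, p.Prime ∧ 2 ^ (n - 1) ≤ p ∧ p < 2 ^ n ∧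
      ∀ i < n, (p ^^^ 2 ^ i = 1) ∨ (1 < p ^^^ 2 ^ i ∧ ¬ (p ^^^ 2 ^ i).Prime) := by
  obtain ⟨a, M, hM, haM, hcov⟩ := exists_residue_covering
  have : NeZero M := ⟨hM⟩
  have hlog : Tendsto (fun n : ℕ ↦ Real.log (3 / 2 * 2 ^ (n - 1))) atTop atTop :=
    Real.tendsto_log_atTop.comp <| Tendsto.const_mul_atTop (by norm_num) <|
      (tendsto_pow_atTop_atTop_of_one_lt one_lt_two).comp (tendsto_sub_atTop_nat 1)
  have hev := hlog.eventually (eventually_exists_prime_abs_log_sub_lt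
    ((ZMod.isUnit_iff_coprime a M).2 haM) (Real.log_pos (show (1 : ℝ) < 4 / 3 by norm_num)))
  obtain ⟨n₀, hn₀⟩ := eventually_atTop.1 (hev.and (eventually_ge_atTop 13))
  refine ⟨n₀, fun n hn ↦ ?_⟩
  obtain ⟨⟨p, hp, hpa, hpy⟩, hn13⟩ := hn₀ n hn
  obtain ⟨m, rfl⟩ : ∃ m, n = m + 13 := ⟨n - 13, by omega⟩
  have hm : 1 ≤ 2 ^ m := Nat.one_le_two_pow
  have hp0 : (0 : ℝ) < p := mod_cast hp.pos
  rw [abs_lt, neg_lt_sub_iff_lt_add, sub_lt_iff_lt_add, ← sub_lt_iff_lt_add,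
    ← Real.log_div (by positivity) hp0.ne', ← Real.log_mul (by norm_num) (by positivity),
    Real.log_lt_log_iff (by positivity) (by norm_num), Real.log_lt_log_iff hp0 (by positivity),
    div_lt_iff₀ hp0] at hpy
  have e1 : m + 13 - 1 = m + 12 := rfl
  rw [e1, pow_add] at hpy
  have hlow : 4608 * 2 ^ m < p := by
    have : (4608 * 2 ^ m : ℝ) < p := by linarith [hpy.1]
    exact_mod_cast this
  have hup : p < 2 ^ m * 2 ^ 13 := by
    have : (p : ℝ) < 2 ^ m * 2 ^ 13 := by linarith [hpy.2]
    exact_mod_cast this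
  refine ⟨p, hp, ?_, ?_, fun i hi ↦ .inr ?_⟩
  · rw [e1, pow_add]
    omega
  · rwa [pow_add]
  have hi' : 2 ^ i ≤ 2 ^ m * 2 ^ 12 := by
    rw [← pow_add]
    exact Nat.pow_le_pow_right two_pos (by omega)
  have hlarge : 331 < p ^^^ 2 ^ i := by
    have := Nat.xor_two_pow_eq_or p i
    have := Nat.two_pow_pos i
    omega
  have hpM : p ≡ a [MOD M] := (ZMod.natCast_eq_natCast_iff _ _ _).1 hpa
  obtain ⟨q, hq1, hq2, hq⟩ : ∃ q, 1 < q ∧ q ≤ 331 ∧ q ∣ p ^^^ 2 ^ i := by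
    obtain ⟨⟨q, hq1, hq2, hq⟩, q', hq1', hq2', hq'⟩ := hcov p hpM i
    rcases Nat.xor_two_pow_eq_or p i with h | h
    · exact ⟨q, hq1, hq2, h ▸ hq⟩
    · refine ⟨q', hq1', hq2', (Nat.modEq_zero_iff_dvd).1 (Nat.ModEq.add_right_cancel' (2 ^ i) ?_)⟩
      rwa [h, zero_add]
  exact ⟨by omega, Nat.not_prime_of_dvd_of_lt hq hq1 (by omega)⟩
end

section
/- A positive proportion of primes p have the property that changing any single digit of the decimal expansion of p produces a number that is not prime. That is, there exists c > 0 such that for all sufficiently large N, the number of primes p ≤ N with this property is at least c·N/log N. -/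
open Finset ArithmeticFunction Filter Topology

/-- A bounded-partial-sum sequence weighted by a nonnegative antitone sequence. -/
lemma norm_sum_Ioc_mul_le_of_antitone {f : ℕ → ℂ} {B : ℝ} (hf : ∀ n, ‖∑ i ∈ range n, f i‖ ≤ B)
    {a : ℕ → ℝ} {M : ℕ} (ha : ∀ i, M < i → a (i + 1) ≤ a i) (ha0 : ∀ i, M < i → 0 ≤ a i) (n : ℕ) :
    ‖∑ i ∈ Ioc M n, (a i : ℂ) * f i‖ ≤ 2 * B * a (M + 1) := by
  have hB : 0 ≤ B := (norm_nonneg _).trans (hf 0)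
  rcases le_or_gt n M with h | h
  · rw [Ioc_eq_empty (by omega)]
    simpa using mul_nonneg (by positivity) (ha0 (M + 1) (by omega))
  have key := sum_Ioc_by_parts (fun i ↦ (a i : ℂ)) f h
  simp only [smul_eq_mul] at key
  rw [key]
  have h1 : ‖(a n : ℂ) * ∑ i ∈ range (n + 1), f i‖ ≤ a n * B := by
    rw [norm_mul, Complex.norm_real, Real.norm_of_nonneg (ha0 n h)]
    exact mul_le_mul_of_nonneg_left (hf _) (ha0 n h)
  have h2 : ‖(a (M + 1) : ℂ) * ∑ i ∈ range (M + 1), f i‖ ≤ a (M + 1) * B := by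
    rw [norm_mul, Complex.norm_real, Real.norm_of_nonneg (ha0 _ (by omega))]
    exact mul_le_mul_of_nonneg_left (hf _) (ha0 _ (by omega))
  have h3 : ‖∑ i ∈ Ioc M (n - 1), ((a (i + 1) : ℂ) - a i) * ∑ j ∈ range (i + 1), f j‖
      ≤ (a (M + 1) - a n) * B := by
    have hsum : ∀ k, M + 1 ≤ k → ∑ i ∈ Ioc M (k - 1), (a i - a (i + 1)) = a (M + 1) - a k := by
      intro k hk
      induction k, hk using Nat.le_induction with
      | base => simp
      | succ k hk ih =>
        obtain ⟨j, rfl⟩ : ∃ j, k = j + 1 := ⟨k - 1, by omega⟩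
        simp only [Nat.add_sub_cancel] at ih ⊢
        rw [Finset.sum_Ioc_succ_top (by omega), ih]
        ring
    rw [← hsum n h, sum_mul]
    refine (norm_sum_le _ _).trans (sum_le_sum fun i hi ↦ ?_)
    have hi' := (mem_Ioc.1 hi).1
    rw [norm_mul]
    refine mul_le_mul ?_ (hf _) (norm_nonneg _) (sub_nonneg.2 (ha i hi'))
    rw [← Complex.ofReal_sub, Complex.norm_real, Real.norm_eq_abs, abs_sub_comm,
      abs_of_nonneg (sub_nonneg.2 (ha i hi'))]
  calc _ ≤ a n * B + a (M + 1) * B + (a (M + 1) - a n) * B :=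
        (norm_sub_le _ _).trans (add_le_add ((norm_sub_le _ _).trans (add_le_add h1 h2)) h3)
    _ = _ := by ring

section Characters

variable {N : ℕ} [NeZero N] {χ : DirichletCharacter ℂ N}

lemma norm_sum_range_character_le (hχ : χ ≠ 1) (n : ℕ) :
    ‖∑ i ∈ range n, χ (i : ZMod N)‖ ≤ N := by
  have hN : 0 < N := Nat.pos_of_ne_zero (NeZero.ne N)
  have hper : ∑ i ∈ range N, χ (i : ZMod N) = 0 := by
    rw [← MulChar.sum_eq_zero_of_ne_one hχ]
    refine Finset.sum_nbij' (fun i ↦ (i : ZMod N)) ZMod.val ?_ ?_ ?_ ?_ ?_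
    · simp
    · intro a _; simpa using ZMod.val_lt a
    · intro a ha; exact ZMod.val_cast_of_lt (by simpa using ha)
    · intro a _; exact ZMod.natCast_zmod_val a
    · simp
  induction n using Nat.strong_induction_on with
  | _ n ih =>
    rcases lt_or_ge n N with h | h
    · calc _ ≤ ∑ i ∈ range n, (1 : ℝ) := norm_sum_le_of_le _ fun i _ ↦ χ.norm_le_one _
        _ ≤ N := by simpa using h.le
    · obtain ⟨m, rfl⟩ := Nat.exists_eq_add_of_le h
      rw [sum_range_add, hper, zero_add]
      simpa using ih m (by omega)

lemma norm_LFunction_sub_sum_le_of_one_lt (hχ : χ ≠ 1) {s : ℝ} (hs : 1 < s) (M : ℕ) :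
    ‖χ.LFunction s - ∑ n ∈ Ioc 0 M, χ n / (n : ℂ) ^ (s : ℂ)‖ ≤ 2 * N / (M + 1) := by
  have hs' : 1 < (s : ℂ).re := by simpa using hs
  have hsum := (ZMod.LSeriesSummable_of_one_lt_re χ hs').hasSum.tendsto_sum_nat
  rw [DirichletCharacter.LFunction_eq_LSeries χ hs', LSeries]
  have hterm : ∀ n, ∑ i ∈ range (n + 1), LSeries.term (fun n ↦ χ n) s i
      = ∑ i ∈ Ioc 0 n, χ i / (i : ℂ) ^ (s : ℂ) := by
    intro n
    induction n with
    | zero => simp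
    | succ n ih =>
      rw [sum_range_succ, ih, sum_Ioc_succ_top (Nat.zero_le n), LSeries.term_of_ne_zero (by omega)]
  have hlim := (((tendsto_add_atTop_iff_nat 1).2 hsum).sub_const
    (∑ n ∈ Ioc 0 M, χ n / (n : ℂ) ^ (s : ℂ))).norm
  refine le_of_tendsto hlim (eventually_atTop.2 ⟨M, fun n hn ↦ ?_⟩)
  rw [hterm]
  have hsplit : ∑ i ∈ Ioc 0 n, χ i / (i : ℂ) ^ (s : ℂ) - ∑ n ∈ Ioc 0 M, χ n / (n : ℂ) ^ (s : ℂ)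
      = ∑ i ∈ Ioc M n, (((i : ℝ) ^ (-s) : ℝ) : ℂ) * χ (i : ZMod N) := by
    rw [← Finset.sum_Ioc_consecutive _ (Nat.zero_le M) hn, add_sub_cancel_left]
    refine sum_congr rfl fun i _ ↦ ?_
    rw [Complex.ofReal_cpow (Nat.cast_nonneg i), Complex.ofReal_neg, Complex.cpow_neg,
      Complex.ofReal_natCast, div_eq_mul_inv, mul_comm]
  rw [hsplit]
  refine (norm_sum_Ioc_mul_le_of_antitone (norm_sum_range_character_le hχ) ?_ ?_ n).trans ?_
  · intro i hi
    exact Real.rpow_le_rpow_of_nonpos (by exact_mod_cast (by omega : 0 < i)) (by simp) (by linarith)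
  · intro i _; positivity
  · rw [div_eq_mul_inv]
    gcongr
    rw [← Real.rpow_neg_one]
    push_cast
    exact Real.rpow_le_rpow_of_exponent_le (by simp) (by linarith)

lemma norm_LFunction_one_sub_sum_le (hχ : χ ≠ 1) (M : ℕ) :
    ‖χ.LFunction 1 - ∑ n ∈ Ioc 0 M, χ n / n‖ ≤ 2 * N / (M + 1) := by
  have hc : Tendsto (fun s : ℝ ↦ ‖χ.LFunction s - ∑ n ∈ Ioc 0 M, χ n / (n : ℂ) ^ (s : ℂ)‖)
      (𝓝[>] 1) (𝓝 ‖χ.LFunction (1 : ℝ) - ∑ n ∈ Ioc 0 M, χ n / (n : ℂ) ^ ((1 : ℝ) : ℂ)‖) := by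
    refine Tendsto.mono_left (Continuous.tendsto ?_ 1) nhdsWithin_le_nhds
    refine Continuous.norm (Continuous.sub
      ((DirichletCharacter.differentiable_LFunction hχ).continuous.comp Complex.continuous_ofReal)
      (continuous_finsetSum _ fun n hn ↦ ?_))
    have hn0 : (n : ℂ) ≠ 0 := by exact_mod_cast (mem_Ioc.1 hn).1.ne'
    exact continuous_const.div (Continuous.const_cpow Complex.continuous_ofReal (Or.inl hn0))
      fun s ↦ by simp [Complex.cpow_eq_zero_iff, hn0]
  simp only [Complex.ofReal_one, Complex.cpow_one] at hc
  refine le_of_tendsto hc (eventually_nhdsWithin_of_forall fun s hs ↦ ?_)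
  exact norm_LFunction_sub_sum_le_of_one_lt hχ hs M

lemma exists_norm_sum_character_mul_log_div_le (hχ : χ ≠ 1) :
    ∃ C : ℝ, ∀ M : ℕ, ‖∑ n ∈ Ioc 0 M, ((Real.log n / n : ℝ) : ℂ) * χ n‖ ≤ C := by
  refine ⟨3 + 2 * N * (Real.log 4 / 4), fun M ↦ ?_⟩
  have htail := norm_sum_Ioc_mul_le_of_antitone (norm_sum_range_character_le hχ)
    (a := fun n ↦ Real.log n / n) (M := 3) ?_ ?_ M
  · have hhead : ∀ k : ℕ, k ≤ 3 → ‖∑ n ∈ Ioc 0 k, ((Real.log n / n : ℝ) : ℂ) * χ n‖ ≤ 3 := by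
      intro k hk
      calc _ ≤ ∑ n ∈ Ioc 0 k, (1 : ℝ) := norm_sum_le_of_le _ fun i hi ↦ by
              have hi0 : (0 : ℝ) < i := by exact_mod_cast (mem_Ioc.1 hi).1
              rw [norm_mul, Complex.norm_real]
              refine mul_le_one₀ ?_ (norm_nonneg _) (χ.norm_le_one _)
              rw [Real.norm_of_nonneg (div_nonneg (Real.log_natCast_nonneg i) hi0.le),
                div_le_one hi0]
              exact (Real.log_le_sub_one_of_pos hi0).trans (by linarith)
        _ ≤ 3 := by simpa using by exact_mod_cast hk
    norm_num at htail
    rcases le_or_gt M 3 with h | h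
    · have : 0 ≤ 2 * (N : ℝ) * (Real.log 4 / 4) := (norm_nonneg _).trans htail
      linarith [hhead M h]
    · rw [← sum_Ioc_consecutive _ (Nat.zero_le 3) h.le]
      refine (norm_add_le _ _).trans (add_le_add (hhead 3 le_rfl) ?_)
      simpa using htail
  · intro i hi
    have hi' : (4 : ℝ) ≤ i := by exact_mod_cast hi
    refine Real.log_div_self_antitoneOn ?_ ?_ (by push_cast; linarith)
    · change Real.exp 1 ≤ i; linarith [Real.exp_one_lt_d9]
    · change Real.exp 1 ≤ (i + 1 : ℕ); push_cast; linarith [Real.exp_one_lt_d9]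
  · intro i hi; exact div_nonneg (Real.log_natCast_nonneg i) (Nat.cast_nonneg i)

omit [NeZero N] in
lemma sum_character_mul_log_div_eq (M : ℕ) :
    ∑ n ∈ Ioc 0 M, ((Real.log n / n : ℝ) : ℂ) * χ n =
      ∑ m ∈ Ioc 0 M, ((vonMangoldt m / m : ℝ) : ℂ) * χ m * ∑ k ∈ Ioc 0 (M / m), χ k / k := by
  let f : ArithmeticFunction ℂ := ⟨fun m ↦ ((vonMangoldt m / m : ℝ) : ℂ) * χ m, by simp⟩
  let g : ArithmeticFunction ℂ := ⟨fun k ↦ χ k / k, by simp⟩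
  have h := sum_Ioc_mul_eq_sum_sum f g M
  refine Eq.trans (sum_congr rfl fun n hn ↦ ?_) h
  have hdiv := Nat.sum_divisorsAntidiagonal (fun i _ ↦ vonMangoldt i) (n := n)
  rw [mul_apply, ← vonMangoldt_sum, ← hdiv, sum_div, Complex.ofReal_sum, sum_mul]
  refine sum_congr rfl fun x hx ↦ ?_
  obtain ⟨hx1, hx2⟩ := Nat.mem_divisorsAntidiagonal.1 hx
  have h1 : (x.1 : ℂ) ≠ 0 := by rintro h; simp_all
  have h2 : (x.2 : ℂ) ≠ 0 := by rintro h; simp_all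
  rw [← hx1]
  simp only [f, g, ArithmeticFunction.coe_mk]
  push_cast
  rw [map_mul]
  field_simp

lemma sum_vonMangoldt_div_mul_inv_le {M : ℕ} (hM : 0 < M) :
    ∑ m ∈ Ioc 0 M, vonMangoldt m / m * (1 / ((M / m : ℕ) + 1)) ≤ Real.log 4 + 4 := by
  have hM' : (0 : ℝ) < M := by exact_mod_cast hM
  calc _ ≤ ∑ m ∈ Ioc 0 M, vonMangoldt m / M := by
        refine sum_le_sum fun m hm ↦ ?_
        have hm' : (0 : ℝ) < m := by exact_mod_cast (mem_Ioc.1 hm).1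
        rw [div_mul_div_comm, mul_one]
        refine div_le_div_of_nonneg_left vonMangoldt_nonneg hM' ?_
        have : M < (M / m + 1) * m := by
          rw [mul_comm]; exact Nat.lt_mul_div_succ M (mem_Ioc.1 hm).1
        rw [mul_comm]
        exact_mod_cast this.le
    _ = Chebyshev.psi M / M := by rw [Chebyshev.psi, Nat.floor_natCast, sum_div]
    _ ≤ _ := by
        rw [div_le_iff₀ hM']
        exact Chebyshev.psi_le_const_mul_self hM'.le

lemma exists_norm_sum_character_mul_vonMangoldt_div_le (hχ : χ ≠ 1) :
    ∃ C : ℝ, ∀ M : ℕ, ‖∑ n ∈ Ioc 0 M, ((vonMangoldt n / n : ℝ) : ℂ) * χ n‖ ≤ C := by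
  obtain ⟨C, hC⟩ := exists_norm_sum_character_mul_log_div_le hχ
  have hL : 0 < ‖χ.LFunction 1‖ :=
    norm_pos_iff.2 (DirichletCharacter.LFunction_apply_one_ne_zero hχ)
  have hC0 : 0 ≤ C := (norm_nonneg _).trans (hC 0)
  have hlog : 0 ≤ Real.log 4 := Real.log_nonneg (by norm_num)
  refine ⟨(C + 2 * N * (Real.log 4 + 4)) / ‖χ.LFunction 1‖, fun M ↦ ?_⟩
  rcases Nat.eq_zero_or_pos M with rfl | hM
  · simp only [Ioc_self, sum_empty, norm_zero]; positivity
  rw [le_div_iff₀ hL, ← norm_mul, sum_mul]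
  have hsplit : ∑ m ∈ Ioc 0 M, ((vonMangoldt m / m : ℝ) : ℂ) * χ m * χ.LFunction 1 =
      ∑ n ∈ Ioc 0 M, ((Real.log n / n : ℝ) : ℂ) * χ n +
      ∑ m ∈ Ioc 0 M, ((vonMangoldt m / m : ℝ) : ℂ) * χ m *
        (χ.LFunction 1 - ∑ k ∈ Ioc 0 (M / m), χ k / k) := by
    rw [sum_character_mul_log_div_eq, ← sum_add_distrib]
    exact sum_congr rfl fun m _ ↦ by ring
  rw [hsplit]
  refine (norm_add_le _ _).trans (add_le_add (hC M) ?_)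
  refine le_trans ?_ (mul_le_mul_of_nonneg_left (sum_vonMangoldt_div_mul_inv_le hM)
    (by positivity : (0 : ℝ) ≤ 2 * N))
  rw [mul_sum]
  refine norm_sum_le_of_le _ fun m _ ↦ ?_
  rw [norm_mul, norm_mul, Complex.norm_real, Real.norm_of_nonneg
    (div_nonneg vonMangoldt_nonneg (Nat.cast_nonneg m))]
  calc _ ≤ vonMangoldt m / m * 1 * (2 * N / ((M / m : ℕ) + 1)) := by
        gcongr
        · exact χ.norm_le_one _
        · exact norm_LFunction_one_sub_sum_le hχ _
    _ = _ := by ring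

end Characters

lemma sum_Ioc_log_eq (M : ℕ) :
    ∑ n ∈ Ioc 0 M, Real.log n = ∑ m ∈ Ioc 0 M, vonMangoldt m * (M / m : ℕ) := by
  rw [← sum_Ioc_mul_zeta_eq_sum, vonMangoldt_mul_zeta]
  rfl

lemma sum_Ioc_log_bounds (M : ℕ) :
    M * Real.log M - M ≤ ∑ n ∈ Ioc 0 M, Real.log n ∧
      ∑ n ∈ Ioc 0 M, Real.log n ≤ M * Real.log M := by
  constructor
  · induction M with
    | zero => simp
    | succ n ih =>
      rw [sum_Ioc_succ_top (Nat.zero_le n)]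
      rcases Nat.eq_zero_or_pos n with rfl | hn
      · simp
      have hn' : (0 : ℝ) < n := by exact_mod_cast hn
      have h : Real.log ((n + 1) / n) ≤ (n + 1) / n - 1 := Real.log_le_sub_one_of_pos (by positivity)
      rw [Real.log_div (by positivity) hn'.ne'] at h
      have h2 : n * (Real.log (n + 1) - Real.log n) ≤ 1 := by
        calc _ ≤ n * (((n : ℝ) + 1) / n - 1) := by gcongr
          _ = 1 := by field_simp; ring
      push_cast
      linarith
  · calc _ ≤ ∑ n ∈ Ioc 0 M, Real.log M := by
          refine sum_le_sum fun n hn ↦ ?_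
          have := mem_Ioc.1 hn
          exact Real.log_le_log (by exact_mod_cast this.1) (by exact_mod_cast this.2)
      _ = _ := by simp

/-- Mertens' first theorem. -/
lemma abs_sum_vonMangoldt_div_sub_log_le {M : ℕ} (hM : 0 < M) :
    |∑ n ∈ Ioc 0 M, vonMangoldt n / n - Real.log M| ≤ Real.log 4 + 4 := by
  have hM' : (0 : ℝ) < M := by exact_mod_cast hM
  have hlog : 0 ≤ Real.log 4 := Real.log_nonneg (by norm_num)
  obtain ⟨h1, h2⟩ := sum_Ioc_log_bounds M
  have hψ := Chebyshev.psi_le_const_mul_self hM'.le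
  rw [Chebyshev.psi, Nat.floor_natCast] at hψ
  rw [sum_Ioc_log_eq] at h1 h2
  have hmul : M * ∑ n ∈ Ioc 0 M, vonMangoldt n / n =
      ∑ n ∈ Ioc 0 M, vonMangoldt n * ((M : ℝ) / n) := by
    rw [mul_sum]; exact sum_congr rfl fun n _ ↦ by ring
  have h3 : ∑ m ∈ Ioc 0 M, vonMangoldt m * (M / m : ℕ) ≤ M * ∑ n ∈ Ioc 0 M, vonMangoldt n / n := by
    rw [hmul]
    exact sum_le_sum fun n _ ↦ mul_le_mul_of_nonneg_left Nat.cast_div_le vonMangoldt_nonneg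
  have h4 : M * ∑ n ∈ Ioc 0 M, vonMangoldt n / n ≤
      ∑ m ∈ Ioc 0 M, vonMangoldt m * (M / m : ℕ) + ∑ n ∈ Ioc 0 M, vonMangoldt n := by
    rw [hmul, ← sum_add_distrib]
    refine sum_le_sum fun n hn ↦ ?_
    have hn' : (0 : ℝ) < n := by exact_mod_cast (mem_Ioc.1 hn).1
    rw [← mul_add_one]
    refine mul_le_mul_of_nonneg_left ?_ vonMangoldt_nonneg
    rw [div_le_iff₀ hn', mul_comm]
    exact_mod_cast (Nat.lt_mul_div_succ M (mem_Ioc.1 hn).1).le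
  rw [abs_le]
  constructor
  · have : M * Real.log M ≤ M * (∑ n ∈ Ioc 0 M, vonMangoldt n / n + 1) := by linarith
    have := le_of_mul_le_mul_left this hM'
    linarith
  · have : M * ∑ n ∈ Ioc 0 M, vonMangoldt n / n ≤ M * (Real.log M + (Real.log 4 + 4)) := by linarith
    have := le_of_mul_le_mul_left this hM'
    linarith

lemma sum_residueClass_eq {N : ℕ} [NeZero N] {a : ZMod N} (ha : IsUnit a) (s : Finset ℕ) :
    ((N.totient * ∑ n ∈ s, vonMangoldt.residueClass a n / n : ℝ) : ℂ) =
      ∑ χ : DirichletCharacter ℂ N, χ a⁻¹ * ∑ n ∈ s, ((vonMangoldt n / n : ℝ) : ℂ) * χ n := by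
  simp_rw [mul_sum]
  rw [sum_comm, Complex.ofReal_sum]
  refine sum_congr rfl fun n _ ↦ ?_
  have h := DirichletCharacter.sum_char_inv_mul_char_eq ℂ ha (n : ZMod N)
  calc _ = ((vonMangoldt n / n : ℝ) : ℂ) * (if a = n then (N.totient : ℂ) else 0) := by
        by_cases han : (n : ZMod N) = a
        · rw [if_pos han.symm, vonMangoldt.residueClass, Set.indicator_of_mem (by exact han)]
          push_cast; ring
        · rw [if_neg (Ne.symm han), vonMangoldt.residueClass, Set.indicator_of_notMem (by exact han)]
          simp
    _ = _ := by
        rw [← h, mul_sum]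
        exact sum_congr rfl fun χ _ ↦ by ring

lemma exists_sum_nonprime_vonMangoldt_div_le :
    ∃ C : ℝ, ∀ s : Finset ℕ, ∑ n ∈ s with ¬ n.Prime, vonMangoldt n / n ≤ C := by
  have h := vonMangoldt.summable_residueClass_non_primes_div (q := 1) 0
  have hall : ∀ n : ℕ, vonMangoldt.residueClass (0 : ZMod 1) n = vonMangoldt n := fun n ↦
    Set.indicator_of_mem (s := {n : ℕ | (n : ZMod 1) = 0}) (Subsingleton.elim (n : ZMod 1) 0) _
  simp only [hall] at h
  refine ⟨_, fun s ↦ le_trans (le_of_eq ?_) (h.sum_le_tsum s fun n _ ↦ ?_)⟩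
  · rw [sum_filter]
    exact sum_congr rfl fun n _ ↦ by by_cases hn : n.Prime <;> simp [hn]
  · split_ifs
    · simp
    · exact div_nonneg vonMangoldt_nonneg (Nat.cast_nonneg n)

/-- A lower bound of Mertens type for primes in an arithmetic progression. -/
theorem exists_le_sum_log_div_primes_residue (N : ℕ) [NeZero N] (a : ZMod N) (ha : IsUnit a) :
    ∃ K : ℝ, ∀ y x : ℕ, 0 < y → y ≤ x →
      Real.log x - Real.log y - K ≤
        N.totient * ∑ p ∈ (Ioc y x).filter (fun p : ℕ ↦ p.Prime ∧ (p : ZMod N) = a), Real.log p / p := by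
  classical
  choose! C hC using fun (χ : DirichletCharacter ℂ N) (hχ : χ ≠ 1) ↦
    exists_norm_sum_character_mul_vonMangoldt_div_le hχ
  obtain ⟨D, hD⟩ := exists_sum_nonprime_vonMangoldt_div_le
  have htot : (0 : ℝ) ≤ N.totient := Nat.cast_nonneg _
  refine ⟨2 * (Real.log 4 + 4) + (D + ∑ p ∈ N.primeFactors, Real.log p / p) +
    ∑ χ ∈ univ.erase (1 : DirichletCharacter ℂ N), 2 * C χ + N.totient * D, fun y x hy hyx ↦ ?_⟩
  have hΛ : ∀ n : ℕ, 0 ≤ vonMangoldt n / n := fun n ↦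
    div_nonneg vonMangoldt_nonneg (Nat.cast_nonneg n)
  have hmert : Real.log x - Real.log y - 2 * (Real.log 4 + 4) ≤
      ∑ n ∈ Ioc y x, vonMangoldt n / n := by
    have h1 := abs_le.1 (abs_sum_vonMangoldt_div_sub_log_le hy)
    have h2 := abs_le.1 (abs_sum_vonMangoldt_div_sub_log_le (hy.trans_le hyx))
    rw [← sum_Ioc_consecutive _ (Nat.zero_le y) hyx] at h2
    linarith [h1.2, h2.1]
  have htriv : ∑ n ∈ Ioc y x, vonMangoldt n / n - (D + ∑ p ∈ N.primeFactors, Real.log p / p) ≤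
      (∑ n ∈ Ioc y x, ((vonMangoldt n / n : ℝ) : ℂ) * (1 : DirichletCharacter ℂ N) n).re := by
    have hpt : ∀ n ∈ Ioc y x, vonMangoldt n / n -
        ((if ¬ n.Prime then vonMangoldt n / n else 0) +
          if n ∈ N.primeFactors then vonMangoldt n / n else 0) ≤
        (((vonMangoldt n / n : ℝ) : ℂ) * (1 : DirichletCharacter ℂ N) n).re := by
      intro n hn
      rw [Complex.re_ofReal_mul]
      by_cases hu : IsUnit (n : ZMod N)
      · rw [MulChar.one_apply hu, Complex.one_re, mul_one]
        split_ifs <;> linarith [hΛ n]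
      · rw [MulChar.map_nonunit _ hu, Complex.zero_re, mul_zero]
        rw [ZMod.isUnit_iff_coprime] at hu
        by_cases hp : n.Prime
        · have hdvd : n ∣ N := by
            by_contra hnd
            exact hu ((Nat.Prime.coprime_iff_not_dvd hp).2 hnd)
          rw [if_neg (by simpa using hp), if_pos (Nat.mem_primeFactors.2 ⟨hp, hdvd, NeZero.ne N⟩)]
          linarith
        · rw [if_pos hp]
          split_ifs <;> linarith [hΛ n]
    have hsum := sum_le_sum hpt
    rw [sum_sub_distrib, sum_add_distrib, ← Complex.re_sum, ← sum_filter, ← sum_filter] at hsum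
    have hpf : ∑ n ∈ Ioc y x with n ∈ N.primeFactors, vonMangoldt n / n ≤
        ∑ p ∈ N.primeFactors, Real.log p / p := by
      calc _ ≤ ∑ p ∈ N.primeFactors, vonMangoldt p / p :=
            sum_le_sum_of_subset_of_nonneg (fun p hp ↦ (mem_filter.1 hp).2) fun p _ _ ↦ hΛ p
        _ = _ := sum_congr rfl fun p hp ↦ by
            rw [vonMangoldt_apply_prime (Nat.prime_of_mem_primeFactors hp)]
    linarith [hD (Ioc y x)]
  have hchar : ∀ χ ∈ univ.erase (1 : DirichletCharacter ℂ N),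
      -(2 * C χ) ≤ (χ a⁻¹ * ∑ n ∈ Ioc y x, ((vonMangoldt n / n : ℝ) : ℂ) * χ n).re := by
    intro χ hχ
    have hχ1 := ne_of_mem_erase hχ
    have hn : ‖χ a⁻¹ * ∑ n ∈ Ioc y x, ((vonMangoldt n / n : ℝ) : ℂ) * χ n‖ ≤ 2 * C χ := by
      rw [norm_mul]
      have hdiff : ‖∑ n ∈ Ioc y x, ((vonMangoldt n / n : ℝ) : ℂ) * χ n‖ ≤ 2 * C χ := by
        have := sum_Ioc_consecutive (fun n ↦ ((vonMangoldt n / n : ℝ) : ℂ) * χ n)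
          (Nat.zero_le y) hyx
        rw [eq_sub_of_add_eq' this]
        refine (norm_sub_le _ _).trans ?_
        linarith [hC χ hχ1 x, hC χ hχ1 y]
      refine (mul_le_of_le_one_left (norm_nonneg _) (χ.norm_le_one _)).trans hdiff
    exact (abs_le.1 ((Complex.abs_re_le_norm _).trans hn)).1
  have hres := congrArg Complex.re (sum_residueClass_eq ha (Ioc y x))
  rw [Complex.ofReal_re, ← add_sum_erase _ _ (mem_univ (1 : DirichletCharacter ℂ N)),
    Complex.add_re, Complex.re_sum, MulChar.one_apply (IsUnit.of_mul_eq_one a (ZMod.inv_mul_of_unit a ha)), one_mul] at hres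
  have hcs := sum_le_sum hchar
  rw [sum_neg_distrib] at hcs
  have hprime : ∑ n ∈ Ioc y x, vonMangoldt.residueClass a n / n ≤
      ∑ p ∈ (Ioc y x).filter (fun p : ℕ ↦ p.Prime ∧ (p : ZMod N) = a), Real.log p / p + D := by
    refine le_trans ?_ (add_le_add_right (hD (Ioc y x)) _)
    rw [sum_filter, sum_filter, ← sum_add_distrib]
    refine sum_le_sum fun n _ ↦ ?_
    by_cases hp : n.Prime
    · by_cases hna : (n : ZMod N) = a
      · simp [vonMangoldt.residueClass, hp, hna, vonMangoldt_apply_prime hp]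
      · simp [vonMangoldt.residueClass, hp, hna]
    · simp only [hp, false_and, if_false, not_false_eq_true, if_true, zero_add]
      exact div_le_div_of_nonneg_right (vonMangoldt.residueClass_le a n) (Nat.cast_nonneg n)
  have := mul_le_mul_of_nonneg_left hprime htot
  linarith

section Sieve

lemma sum_range_mul_of_coprime {a b : ℕ} (hab : a.Coprime b) (ha : 0 < a) (hb : 0 < b)
    (φ ψ : ℕ → ℝ) :
    ∑ n ∈ range (a * b), φ (n % a) * ψ (n % b) =
      (∑ i ∈ range a, φ i) * ∑ j ∈ range b, ψ j := by
  rw [sum_mul_sum, ← sum_product']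
  refine sum_bij' (fun n _ ↦ (n % a, n % b))
    (fun x _ ↦ (Nat.chineseRemainder hab x.1 x.2 : ℕ)) ?_ ?_ ?_ ?_ ?_
  · intro n _
    simp [Nat.mod_lt _ ha, Nat.mod_lt _ hb]
  · intro x _
    exact mem_range.2 (Nat.chineseRemainder_lt_mul hab x.1 x.2 ha.ne' hb.ne')
  · intro n hn
    have h := Nat.chineseRemainder_modEq_unique hab (a := n % a) (b := n % b) (z := n)
      (Nat.mod_modEq n a).symm (Nat.mod_modEq n b).symm
    exact (Nat.ModEq.eq_of_lt_of_lt h (mem_range.1 hn)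
      (Nat.chineseRemainder_lt_mul hab _ _ ha.ne' hb.ne')).symm
  · rintro ⟨i, j⟩ hx
    simp only [mem_product, mem_range] at hx
    have h := (Nat.chineseRemainder hab i j).2
    exact Prod.ext (Nat.ModEq.eq_of_lt_of_lt ((Nat.mod_modEq _ _).trans h.1) (Nat.mod_lt _ ha) hx.1)
      (Nat.ModEq.eq_of_lt_of_lt ((Nat.mod_modEq _ _).trans h.2) (Nat.mod_lt _ hb) hx.2)
  · intro n _; rfl

lemma sum_range_prod_prod_of_primes (s : Finset ℕ) (hs : ∀ r ∈ s, r.Prime) (u : ℕ → ℕ → ℝ) :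
    ∑ n ∈ range (∏ r ∈ s, r), ∏ r ∈ s, u r (n % r) = ∏ r ∈ s, ∑ n ∈ range r, u r n := by
  induction s using Finset.induction_on with
  | empty => simp
  | insert p s hp ih =>
    have hs' : ∀ r ∈ s, r.Prime := fun r hr ↦ hs r (mem_insert_of_mem hr)
    have hpp := hs p (mem_insert_self p s)
    have hcop : p.Coprime (∏ r ∈ s, r) := Nat.Coprime.prod_right fun r hr ↦
      (Nat.coprime_primes hpp (hs' r hr)).2 fun h ↦ hp (h ▸ hr)
    have hpos : 0 < ∏ r ∈ s, r := prod_pos fun r hr ↦ (hs' r hr).pos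
    rw [prod_insert hp, prod_insert hp, ← ih hs',
      ← sum_range_mul_of_coprime hcop hpp.pos hpos (u p) fun n ↦ ∏ r ∈ s, u r (n % r)]
    refine sum_congr rfl fun n _ ↦ ?_
    rw [prod_insert hp]
    congr 1
    exact prod_congr rfl fun r hr ↦ by rw [Nat.mod_mod_of_dvd _ (dvd_prod_of_mem _ hr)]

lemma sum_range_le_of_periodic {H : ℕ → ℝ} {m : ℕ} (hm : 0 < m) (hper : ∀ n, H (m + n) = H n)
    (hH : ∀ n, H n ≤ 1) (hT : 0 ≤ ∑ n ∈ range m, H n) (X : ℕ) :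
    ∑ n ∈ range X, H n ≤ X * ((∑ n ∈ range m, H n) / m) + m := by
  have hm' : (0 : ℝ) < m := by exact_mod_cast hm
  induction X using Nat.strong_induction_on with
  | _ X ih =>
    rcases lt_or_ge X m with h | h
    · have h1 : ∑ n ∈ range X, H n ≤ X := by
        simpa using sum_le_sum (s := range X) fun n _ ↦ hH n
      have h2 : (X : ℝ) ≤ m := by exact_mod_cast h.le
      have : 0 ≤ (X : ℝ) * ((∑ n ∈ range m, H n) / m) := by positivity
      linarith
    · obtain ⟨Y, rfl⟩ := Nat.exists_eq_add_of_le h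
      rw [sum_range_add]
      simp only [hper]
      have := ih Y (by omega)
      have h3 : (m : ℝ) * ((∑ n ∈ range m, H n) / m) = ∑ n ∈ range m, H n := by field_simp
      push_cast
      linarith

variable (E : ℕ → Finset ℕ)

/-- The function on residues mod `r` that is `1` off `E r` and has mean zero when `#(E r) = 2`. -/
noncomputable def sieveFactor (r n : ℕ) : ℝ := if n ∈ E r then -((r - 2) / 2) else 1

variable {E}

lemma sum_sieveFactor {r : ℕ} (hE : E r ⊆ range r) (hc : #(E r) = 2) :
    ∑ n ∈ range r, sieveFactor E r n = 0 := by
  have hr : 2 ≤ r := by simpa [hc] using card_le_card hE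
  simp only [sieveFactor]
  rw [sum_ite, filter_mem_eq_inter, inter_eq_right.2 hE, filter_notMem_eq_sdiff]
  simp only [sum_const, hc, card_sdiff_of_subset hE, card_range, nsmul_eq_mul]
  push_cast [hr]
  ring

lemma sum_sieveFactor_mul_self {r : ℕ} (hE : E r ⊆ range r) (hc : #(E r) = 2) :
    ∑ n ∈ range r, sieveFactor E r n * sieveFactor E r n = r * ((r - 2) / 2) := by
  have hr : 2 ≤ r := by simpa [hc] using card_le_card hE
  have : ∀ n, sieveFactor E r n * sieveFactor E r n =
      if n ∈ E r then ((r - 2) / 2 : ℝ) ^ 2 else 1 := by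
    intro n
    simp only [sieveFactor]
    split_ifs <;> ring
  simp only [this]
  rw [sum_ite, filter_mem_eq_inter, inter_eq_right.2 hE, filter_notMem_eq_sdiff]
  simp only [sum_const, hc, card_sdiff_of_subset hE, card_range, nsmul_eq_mul]
  push_cast [hr]
  ring

lemma abs_weight_mul_prod_sieveFactor_le {s : Finset ℕ} (hs : ∀ r ∈ s, 5 ≤ r) (n : ℕ) :
    |(∏ r ∈ s, 2 / ((r : ℝ) - 2)) * ∏ r ∈ s, sieveFactor E r (n % r)| ≤ 1 := by
  rw [← prod_mul_distrib, abs_prod]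
  refine prod_le_one (fun _ _ ↦ abs_nonneg _) fun r hr ↦ ?_
  have h5 : (5 : ℝ) ≤ r := by exact_mod_cast hs r hr
  have h3 : 0 < (r : ℝ) - 2 := by linarith
  unfold sieveFactor
  split_ifs
  · rw [abs_le]
    have : 2 / ((r : ℝ) - 2) * -((r - 2) / 2) = -1 := by field_simp
    rw [this]; norm_num
  · rw [mul_one, abs_of_nonneg (by positivity), div_le_one h3]
    linarith

/-- Correlations of the weighted products over two sets of primes. -/
lemma sum_range_mul_sieveFactor_le {s t : Finset ℕ} (hs : ∀ r ∈ s ∪ t, r.Prime ∧ 5 ≤ r)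
    (hE : ∀ r ∈ s ∪ t, E r ⊆ range r ∧ #(E r) = 2) (X : ℕ) :
    ∑ n ∈ range X, ((∏ r ∈ s, 2 / ((r : ℝ) - 2)) * ∏ r ∈ s, sieveFactor E r (n % r)) *
        ((∏ r ∈ t, 2 / ((r : ℝ) - 2)) * ∏ r ∈ t, sieveFactor E r (n % r)) ≤
      X * (if s = t then ∏ r ∈ s, 2 / ((r : ℝ) - 2) else 0) + (∏ r ∈ s ∪ t, r : ℕ) := by
  classical
  set gs := ∏ r ∈ s, 2 / ((r : ℝ) - 2) with hgs
  set gt := ∏ r ∈ t, 2 / ((r : ℝ) - 2) with hgt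
  set m := ∏ r ∈ s ∪ t, r with hm
  have hmpos : 0 < m := prod_pos fun r hr ↦ (hs r hr).1.pos
  set H : ℕ → ℝ := fun n ↦ (gs * ∏ r ∈ s, sieveFactor E r (n % r)) *
        (gt * ∏ r ∈ t, sieveFactor E r (n % r)) with hH
  have hpermod : ∀ n, ∀ r ∈ s ∪ t, (m + n) % r = n % r := fun n r hr ↦ by
    rw [Nat.add_mod, Nat.mod_eq_zero_of_dvd (dvd_prod_of_mem _ hr), zero_add, Nat.mod_mod]
  have hper : ∀ n, H (m + n) = H n := fun n ↦ by
    simp only [hH]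
    congr 2
    · exact prod_congr rfl fun r hr ↦ by rw [hpermod n r (mem_union_left _ hr)]
    · exact prod_congr rfl fun r hr ↦ by rw [hpermod n r (mem_union_right _ hr)]
  have hH1 : ∀ n, H n ≤ 1 := fun n ↦ by
    refine (le_abs_self _).trans ?_
    rw [hH, abs_mul]
    exact mul_le_one₀ (abs_weight_mul_prod_sieveFactor_le
        (fun r hr ↦ (hs r (mem_union_left _ hr)).2) n) (abs_nonneg _)
      (abs_weight_mul_prod_sieveFactor_le (fun r hr ↦ (hs r (mem_union_right _ hr)).2) n)
  have hT : ∑ n ∈ range m, H n = m * (if s = t then gs else 0) := by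
    set u : ℕ → ℕ → ℝ := fun r n ↦ (if r ∈ s then sieveFactor E r n else 1) *
      (if r ∈ t then sieveFactor E r n else 1) with hu
    have hHu : ∀ n, H n = gs * gt * ∏ r ∈ s ∪ t, u r (n % r) := fun n ↦ by
      simp only [hH, hu, prod_mul_distrib, prod_ite_mem]
      rw [union_inter_cancel_left, union_inter_cancel_right]
      ring
    simp only [hHu]
    rw [← mul_sum, sum_range_prod_prod_of_primes _ (fun r hr ↦ (hs r hr).1)]
    split_ifs with hst
    · subst hst
      rw [union_self] at hs hE hm ⊢
      have h1 : ∏ r ∈ s, ∑ n ∈ range r, u r n = ∏ r ∈ s, ((r : ℝ) * ((r - 2) / 2)) :=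
        prod_congr rfl fun r hr ↦ by
          simp only [hu, if_pos hr]
          exact sum_sieveFactor_mul_self (hE r hr).1 (hE r hr).2
      rw [h1, prod_mul_distrib, hm]
      push_cast
      have h2 : gs * ∏ r ∈ s, (((r : ℝ) - 2) / 2) = 1 := by
        rw [hgs, ← prod_mul_distrib]
        refine prod_eq_one fun r hr ↦ ?_
        have : (5 : ℝ) ≤ r := by exact_mod_cast (hs r hr).2
        have : (r : ℝ) - 2 ≠ 0 := by linarith
        field_simp
      calc _ = gs * (∏ r ∈ s, (r : ℝ)) * (gs * ∏ r ∈ s, (((r : ℝ) - 2) / 2)) := by ring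
        _ = _ := by rw [h2]; ring
    · rw [mul_zero]
      obtain ⟨r, hr, h0⟩ : ∃ r ∈ s ∪ t, ∑ n ∈ range r, u r n = 0 := by
        by_contra! hne
        refine hst (Finset.ext fun r ↦ ?_)
        by_contra hiff
        have hr : r ∈ s ∪ t := by rw [mem_union]; tauto
        refine hne r hr ?_
        rw [← sum_sieveFactor (hE r hr).1 (hE r hr).2]
        refine sum_congr rfl fun n _ ↦ ?_
        simp only [hu]
        by_cases h1 : r ∈ s <;> by_cases h2 : r ∈ t
        · exact absurd (iff_of_true h1 h2) hiff
        · rw [if_pos h1, if_neg h2, mul_one]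
        · rw [if_neg h1, if_pos h2, one_mul]
        · exact absurd (iff_of_false h1 h2) hiff
      rw [prod_eq_zero hr h0, mul_zero]
  have hg0 : 0 ≤ gs := prod_nonneg fun r hr ↦ by
    have : (5 : ℝ) ≤ r := by exact_mod_cast (hs r (mem_union_left _ hr)).2
    exact div_nonneg zero_le_two (by linarith)
  have := sum_range_le_of_periodic hmpos hper hH1 (by rw [hT]; split_ifs <;> positivity) X
  rwa [hT, mul_div_cancel_left₀ _ (by exact_mod_cast hmpos.ne')] at this

/-- The subsets of `P` whose product is at most `z`. -/
def subsetsProdLE (P : Finset ℕ) (z : ℕ) : Finset (Finset ℕ) :=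
  P.powerset.filter fun s ↦ ∏ r ∈ s, r ≤ z

lemma mem_subsetsProdLE {P : Finset ℕ} {z : ℕ} {s : Finset ℕ} :
    s ∈ subsetsProdLE P z ↔ s ⊆ P ∧ ∏ r ∈ s, r ≤ z := by
  simp [subsetsProdLE]

lemma card_subsetsProdLE_le {P : Finset ℕ} (hP : ∀ r ∈ P, r.Prime) (z : ℕ) :
    #(subsetsProdLE P z) ≤ z := by
  calc _ ≤ #(Ioc 0 z) := by
        refine card_le_card_of_injOn (fun s ↦ ∏ r ∈ s, r) ?_ ?_
        · intro s hs
          obtain ⟨h1, h2⟩ := mem_subsetsProdLE.1 (mem_coe.1 hs)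
          exact mem_coe.2 (mem_Ioc.2 ⟨prod_pos fun r hr ↦ (hP r (h1 hr)).pos, h2⟩)
        · intro s hs t ht hst
          have hs := (mem_subsetsProdLE.1 (mem_coe.1 hs)).1
          have ht := (mem_subsetsProdLE.1 (mem_coe.1 ht)).1
          rw [← Nat.primeFactors_prod fun r hr ↦ hP r (hs hr),
            ← Nat.primeFactors_prod fun r hr ↦ hP r (ht hr)]
          exact congrArg _ hst
    _ = z := by simp

/-- Selberg's upper bound sieve for two forbidden residue classes modulo each prime of `P`. -/
lemma card_sifted_mul_sum_le {P : Finset ℕ} (hP : ∀ r ∈ P, r.Prime ∧ 5 ≤ r)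
    (hE : ∀ r ∈ P, E r ⊆ range r ∧ #(E r) = 2) {z : ℕ} (hz : 0 < z) (X : ℕ) :
    (#{n ∈ range X | ∀ r ∈ P, n % r ∉ E r} : ℝ) *
      ∑ s ∈ subsetsProdLE P z, ∏ r ∈ s, 2 / ((r : ℝ) - 2) ≤ X + (z : ℝ) ^ 4 := by
  classical
  set D := subsetsProdLE P z with hD
  set g : Finset ℕ → ℝ := fun s ↦ ∏ r ∈ s, 2 / ((r : ℝ) - 2) with hg
  set F : Finset ℕ → ℕ → ℝ := fun s n ↦ g s * ∏ r ∈ s, sieveFactor E r (n % r) with hF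
  set G := ∑ s ∈ D, g s with hG
  have hsub : ∀ s ∈ D, s ⊆ P := fun s hs ↦ (mem_subsetsProdLE.1 hs).1
  have hg0 : ∀ s ∈ D, 0 ≤ g s := fun s hs ↦ prod_nonneg fun r hr ↦ by
    have : (5 : ℝ) ≤ r := by exact_mod_cast (hP r (hsub s hs hr)).2
    exact div_nonneg zero_le_two (by linarith)
  have hG1 : 1 ≤ G := by
    have h := single_le_sum hg0 (show ∅ ∈ D from mem_subsetsProdLE.2 ⟨empty_subset _, by simpa⟩)
    have h0 : g ∅ = 1 := prod_empty
    rw [← h0]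
    exact h
  have hlow : (#{n ∈ range X | ∀ r ∈ P, n % r ∉ E r} : ℝ) * G ^ 2 ≤
      ∑ n ∈ range X, (∑ s ∈ D, F s n) ^ 2 := by
    rw [← nsmul_eq_mul, ← sum_const]
    refine le_trans (le_of_eq (sum_congr rfl fun n hn ↦ ?_))
      (sum_le_sum_of_subset_of_nonneg (filter_subset _ _) fun _ _ _ ↦ sq_nonneg _)
    congr 1
    refine sum_congr rfl fun s hs ↦ ?_
    have hn' := (mem_filter.1 hn).2
    have : ∏ r ∈ s, sieveFactor E r (n % r) = 1 := prod_eq_one fun r hr ↦ by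
      rw [sieveFactor, if_neg (hn' r (hsub s hs hr))]
    simp only [hF, this, mul_one]
  have hup : ∑ n ∈ range X, (∑ s ∈ D, F s n) ^ 2 ≤ X * G + (z : ℝ) ^ 4 := by
    simp only [sq, sum_mul_sum]
    rw [sum_comm]
    calc _ ≤ ∑ s ∈ D, ∑ t ∈ D, (X * (if s = t then g s else 0) + (z : ℝ) ^ 2) := by
          refine sum_le_sum fun s hs ↦ ?_
          rw [sum_comm]
          refine sum_le_sum fun t ht ↦ ?_
          have hst : s ∪ t ⊆ P := union_subset (hsub s hs) (hsub t ht)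
          refine (sum_range_mul_sieveFactor_le (fun r hr ↦ hP r (hst hr))
            (fun r hr ↦ hE r (hst hr)) X).trans ?_
          gcongr
          have h1 : ∏ r ∈ s ∪ t, r ≤ (∏ r ∈ s, r) * ∏ r ∈ t, r := by
            rw [← prod_union_inter]
            exact Nat.le_mul_of_pos_right _ (prod_pos fun r hr ↦
              (hP r (hsub s hs (mem_inter.1 hr).1)).1.pos)
          have h2 := h1.trans (Nat.mul_le_mul (mem_subsetsProdLE.1 hs).2 (mem_subsetsProdLE.1 ht).2)
          rw [sq]
          exact_mod_cast h2
      _ = X * G + (#D : ℝ) ^ 2 * (z : ℝ) ^ 2 := by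
          simp only [sum_add_distrib, ← mul_sum, sum_ite_eq, sum_const, nsmul_eq_mul]
          have : ∑ s ∈ D, (if s ∈ D then g s else 0) = G :=
            sum_congr rfl fun s hs ↦ if_pos hs
          rw [this]
          ring
      _ ≤ X * G + (z : ℝ) ^ 2 * (z : ℝ) ^ 2 := by
          gcongr
          exact card_subsetsProdLE_le (fun r hr ↦ (hP r hr).1) z
      _ = _ := by ring
  have hz4 : (z : ℝ) ^ 4 ≤ (z : ℝ) ^ 4 * G := le_mul_of_one_le_right (by positivity) hG1
  have hGpos : 0 < G := by linarith
  refine le_of_mul_le_mul_right ?_ hGpos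
  calc _ = (#{n ∈ range X | ∀ r ∈ P, n % r ∉ E r} : ℝ) * G ^ 2 := by ring
    _ ≤ X * G + (z : ℝ) ^ 4 := hlow.trans hup
    _ ≤ _ := by rw [add_mul]; linarith

end Sieve

section SieveDensity

lemma sq_sum_prod_inv_sub_one_le {P : Finset ℕ} (hP : ∀ r ∈ P, 5 ≤ r) {w z : ℕ}
    (hwz : w ^ 2 ≤ z) :
    (∑ s ∈ subsetsProdLE P w, ∏ r ∈ s, 1 / ((r : ℝ) - 1)) ^ 2 ≤
      ∑ s ∈ subsetsProdLE P z, ∏ r ∈ s, 2 / ((r : ℝ) - 2) := by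
  classical
  set h : ℕ → ℝ := fun r ↦ 1 / ((r : ℝ) - 1) with hh
  have hh0 : ∀ r ∈ P, 0 ≤ h r := fun r hr ↦ by
    have : (5 : ℝ) ≤ r := by exact_mod_cast hP r hr
    exact one_div_nonneg.2 (by linarith)
  have key : ∀ t ⊆ P, ∑ s ∈ t.powerset, ∑ u ∈ s.powerset, (∏ r ∈ t, h r) * ∏ r ∈ u, h r ≤
      ∏ r ∈ t, 2 / ((r : ℝ) - 2) := fun t ht ↦ by
    have h1 : ∀ s ∈ t.powerset, ∑ u ∈ s.powerset, (∏ r ∈ t, h r) * ∏ r ∈ u, h r =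
        (∏ r ∈ t, h r) * ∏ r ∈ s, (1 + h r) := fun s _ ↦ by
      rw [prod_one_add, mul_sum]
    rw [sum_congr rfl h1, ← mul_sum, ← prod_one_add, ← prod_mul_distrib]
    refine prod_le_prod (fun r hr ↦ ?_) fun r hr ↦ ?_
    · have := hh0 r (ht hr); positivity
    · have h5 : (5 : ℝ) ≤ r := by exact_mod_cast hP r (ht hr)
      have e : h r * (1 + (1 + h r)) = (2 * r - 1) / ((r : ℝ) - 1) ^ 2 := by
        have : (r : ℝ) - 1 ≠ 0 := by linarith
        simp only [hh]; field_simp; ring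
      rw [e, div_le_div_iff₀ (by nlinarith) (by linarith)]
      nlinarith
  refine le_trans ?_ (sum_le_sum fun t ht ↦ key t (mem_subsetsProdLE.1 ht).1)
  rw [sq, sum_mul_sum, ← sum_product']
  have e2 : ∀ t ∈ subsetsProdLE P z, ∑ s ∈ t.powerset, ∑ u ∈ s.powerset,
      (∏ r ∈ t, h r) * ∏ r ∈ u, h r =
      ∑ q ∈ t.powerset.sigma fun s ↦ s.powerset, (∏ r ∈ t, h r) * ∏ r ∈ q.2, h r := fun t _ ↦ by
    rw [sum_sigma]
  rw [sum_congr rfl e2, sum_sigma']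
  have hmap : ∀ x ∈ subsetsProdLE P w ×ˢ subsetsProdLE P w,
      (⟨x.1 ∪ x.2, ⟨x.1, x.1 ∩ x.2⟩⟩ : Σ _ : Finset ℕ, Σ _ : Finset ℕ, Finset ℕ) ∈
        (subsetsProdLE P z).sigma fun t ↦ t.powerset.sigma fun s ↦ s.powerset := by
    rintro ⟨a, b⟩ hx
    obtain ⟨ha, hb⟩ := mem_product.1 hx
    have ha := mem_subsetsProdLE.1 ha
    have hb := mem_subsetsProdLE.1 hb
    simp only [mem_sigma, mem_powerset, mem_subsetsProdLE]
    refine ⟨⟨union_subset ha.1 hb.1, ?_⟩, subset_union_left, inter_subset_left⟩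
    calc ∏ r ∈ a ∪ b, r ≤ (∏ r ∈ a, r) * ∏ r ∈ b, r := by
          rw [← prod_union_inter]
          exact Nat.le_mul_of_pos_right _ (prod_pos fun r hr ↦ by
            have := hP r (ha.1 (mem_inter.1 hr).1); omega)
      _ ≤ w * w := Nat.mul_le_mul ha.2 hb.2
      _ ≤ z := by rwa [← sq]
  refine le_trans (le_of_eq ?_) (sum_le_sum_of_subset_of_nonneg
    (s := (subsetsProdLE P w ×ˢ subsetsProdLE P w).image fun x ↦ ⟨x.1 ∪ x.2, ⟨x.1, x.1 ∩ x.2⟩⟩)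
    (image_subset_iff.2 hmap) ?_)
  rotate_left
  · rintro ⟨t, s, u⟩ hq _
    simp only [mem_sigma, mem_powerset, mem_subsetsProdLE] at hq
    exact mul_nonneg (prod_nonneg fun r hr ↦ hh0 r (hq.1.1 hr))
      (prod_nonneg fun r hr ↦ hh0 r (hq.1.1 (hq.2.1 (hq.2.2 hr))))
  rw [sum_image]
  · refine sum_congr rfl fun x _ ↦ ?_
    simp only
    rw [prod_union_inter]
  · rintro ⟨a, b⟩ _ ⟨a', b'⟩ _ hab
    simp only [Sigma.mk.injEq, heq_eq_eq] at hab
    obtain ⟨h1, rfl, h2⟩ := hab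
    refine Prod.ext rfl (Finset.ext fun r ↦ ?_)
    have h1 := Finset.ext_iff.1 h1 r
    have h2 := Finset.ext_iff.1 h2 r
    simp only [mem_union, mem_inter] at h1 h2 ⊢
    tauto

lemma sum_inv_primeFactors_eq_le {s : Finset ℕ} (hs : ∀ r ∈ s, r.Prime) (w : ℕ) :
    ∑ n ∈ (Ioc 0 w).filter (fun n ↦ n.primeFactors = s), (1 / n : ℝ) ≤
      ∏ r ∈ s, 1 / ((r : ℝ) - 1) := by
  classical
  set Q := ∏ r ∈ s, r with hQ
  have hQ0 : 0 < Q := prod_pos fun r hr ↦ (hs r hr).pos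
  let f : ℕ →* ℝ := ⟨⟨fun n ↦ (n : ℝ)⁻¹, by simp⟩, fun a b ↦ by push_cast; rw [mul_inv]⟩
  obtain ⟨-, hsum⟩ := EulerProduct.summable_and_hasSum_factoredNumbers_prod_filter_prime_geometric
    (f := f) (fun {p} hp ↦ by
      change ‖(p : ℝ)⁻¹‖ < 1
      rw [norm_inv, Real.norm_natCast]
      exact inv_lt_one_of_one_lt₀ (by exact_mod_cast hp.one_lt)) s
  set N := (Ioc 0 w).filter (fun n ↦ n.primeFactors = s) with hN
  have hdvd : ∀ n ∈ N, Q * (n / Q) = n := fun n hn ↦ by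
    have h := (mem_filter.1 hn).2
    refine Nat.mul_div_cancel' ?_
    rw [hQ, ← h]
    exact Nat.prod_primeFactors_dvd n
  have hmem : ∀ m ∈ N.image (· / Q), m ∈ Nat.factoredNumbers s := fun m hm ↦ by
    obtain ⟨n, hn, rfl⟩ := mem_image.1 hm
    have hn0 := (mem_Ioc.1 (mem_filter.1 hn).1).1
    have hd := hdvd n hn
    refine Nat.mem_factoredNumbers.2 ⟨fun h ↦ ?_, fun p hp ↦ ?_⟩
    · rw [h] at hd; omega
    · rw [← (mem_filter.1 hn).2]
      have hp1 := Nat.prime_of_mem_primeFactorsList hp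
      have hp2 := Nat.dvd_of_mem_primeFactorsList hp
      exact Nat.mem_primeFactors.2 ⟨hp1, hd ▸ hp2.mul_left Q, hn0.ne'⟩
  have hle := sum_le_hasSum ((N.image (· / Q)).subtype (· ∈ Nat.factoredNumbers s))
    (fun m _ ↦ inv_nonneg.2 (Nat.cast_nonneg (m : ℕ))) hsum
  rw [filter_true_of_mem hs] at hle
  have e1 : ∑ m ∈ (N.image (· / Q)).subtype (· ∈ Nat.factoredNumbers s), f m =
      ∑ n ∈ N, ((n / Q : ℕ) : ℝ)⁻¹ := by
    rw [sum_subtype_of_mem (f := fun m : ℕ ↦ f m) hmem, sum_image]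
    · rfl
    · intro a ha b hb hab
      rw [← hdvd a ha, ← hdvd b hb]
      exact congrArg (Q * ·) hab
  calc ∑ n ∈ N, (1 / n : ℝ) = (Q : ℝ)⁻¹ * ∑ n ∈ N, ((n / Q : ℕ) : ℝ)⁻¹ := by
        rw [mul_sum]
        refine sum_congr rfl fun n hn ↦ ?_
        rw [one_div, ← mul_inv]
        congr 1
        exact_mod_cast (hdvd n hn).symm
    _ ≤ (Q : ℝ)⁻¹ * ∏ p ∈ s, (1 - f p)⁻¹ := by
        rw [← e1]
        gcongr
    _ = _ := by
        rw [hQ]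
        push_cast
        rw [← prod_inv_distrib, ← prod_mul_distrib]
        refine prod_congr rfl fun r hr ↦ ?_
        change (r : ℝ)⁻¹ * (1 - (r : ℝ)⁻¹)⁻¹ = _
        have h1 : (1 : ℝ) < r := by exact_mod_cast (hs r hr).one_lt
        rw [← mul_inv, mul_sub, mul_inv_cancel₀ (by linarith), mul_one, one_div]

/-- The primes up to `z` not dividing `B`. -/
def primesLENotDvd (B z : ℕ) : Finset ℕ := (Iic z).filter fun r ↦ r.Prime ∧ ¬ r ∣ B

lemma mem_primesLENotDvd {B z r : ℕ} :
    r ∈ primesLENotDvd B z ↔ r ≤ z ∧ r.Prime ∧ ¬ r ∣ B := by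
  simp [primesLENotDvd]

lemma log_le_prod_mul_sum {B w z : ℕ} (hB : B ≠ 0) (hw : w ≤ z) :
    Real.log w ≤ (∏ r ∈ B.primeFactors, (1 + 1 / ((r : ℝ) - 1))) *
      ∑ s ∈ subsetsProdLE (primesLENotDvd B z) w, ∏ r ∈ s, 1 / ((r : ℝ) - 1) := by
  classical
  set S := subsetsProdLE (primesLENotDvd B z) w with hS
  set h : ℕ → ℝ := fun r ↦ 1 / ((r : ℝ) - 1) with hh
  have h1 : Real.log w ≤ ∑ n ∈ Ioc 0 w, (1 / n : ℝ) := by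
    rcases Nat.eq_zero_or_pos w with rfl | hw0
    · simp
    have := log_add_one_le_harmonic w
    refine (Real.log_le_log (by exact_mod_cast hw0) (by push_cast; linarith)).trans
      (this.trans (le_of_eq ?_))
    rw [harmonic_eq_sum_Icc]
    push_cast
    simp only [one_div]
    rfl
  refine h1.trans ?_
  set V := (Ioc 0 w).image Nat.primeFactors with hV
  have hVp : ∀ s ∈ V, ∀ r ∈ s, r.Prime := fun s hs r hr ↦ by
    obtain ⟨n, -, rfl⟩ := mem_image.1 hs
    exact Nat.prime_of_mem_primeFactors hr
  have h2 : ∑ n ∈ Ioc 0 w, (1 / n : ℝ) ≤ ∑ s ∈ V, ∏ r ∈ s, h r := by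
    rw [← sum_fiberwise_of_maps_to (t := V) (g := Nat.primeFactors)
      fun n hn ↦ mem_image_of_mem _ hn]
    exact sum_le_sum fun s hs ↦ sum_inv_primeFactors_eq_le (hVp s hs) w
  refine h2.trans ?_
  rw [prod_one_add, sum_mul_sum, ← sum_product']
  have h0 : ∀ s : Finset ℕ, (∀ r ∈ s, r.Prime) → 0 ≤ ∏ r ∈ s, h r := fun s hs ↦
    prod_nonneg fun r hr ↦ one_div_nonneg.2 (by
      have : (1 : ℝ) < r := by exact_mod_cast (hs r hr).one_lt
      linarith)
  have hsplit : ∀ s : Finset ℕ, s ∩ B.primeFactors ∪ s \ B.primeFactors = s := fun s ↦ by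
    rw [union_comm]; exact sdiff_union_inter _ _
  refine le_trans (le_of_eq ?_) (sum_le_sum_of_subset_of_nonneg
    (s := V.image fun s ↦ (s ∩ B.primeFactors, s \ B.primeFactors)) ?_ ?_)
  · refine Eq.symm ((sum_image ?_).trans ?_)
    · intro s _ t _ hst
      rw [← hsplit s, ← hsplit t]
      exact congrArg₂ (· ∪ ·) (congrArg Prod.fst hst) (congrArg Prod.snd hst)
    · refine sum_congr rfl fun s _ ↦ ?_
      change (∏ r ∈ s ∩ _, h r) * ∏ r ∈ s \ _, h r = _
      rw [prod_inter_mul_prod_sdiff]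
  · intro q hq
    obtain ⟨s, hs, rfl⟩ := mem_image.1 hq
    obtain ⟨n, hn, rfl⟩ := mem_image.1 hs
    have hn := mem_Ioc.1 hn
    refine mem_product.2 ⟨mem_powerset.2 inter_subset_right, mem_subsetsProdLE.2 ⟨?_, ?_⟩⟩
    · intro r hr
      obtain ⟨hr1, hr2⟩ := mem_sdiff.1 hr
      refine mem_primesLENotDvd.2 ⟨?_, Nat.prime_of_mem_primeFactors hr1, fun hd ↦ hr2
        (Nat.mem_primeFactors.2 ⟨Nat.prime_of_mem_primeFactors hr1, hd, hB⟩)⟩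
      exact (Nat.le_of_dvd hn.1 (Nat.dvd_of_mem_primeFactors hr1)).trans (hn.2.trans hw)
    · refine le_trans (Nat.le_of_dvd hn.1 ?_) hn.2
      exact (prod_dvd_prod_of_subset _ _ _ sdiff_subset).trans (Nat.prod_primeFactors_dvd n)
  · rintro ⟨a, b⟩ hq _
    obtain ⟨ha, hb⟩ := mem_product.1 hq
    exact mul_nonneg (h0 a fun r hr ↦ Nat.prime_of_mem_primeFactors (mem_powerset.1 ha hr))
      (h0 b fun r hr ↦ (mem_primesLENotDvd.1 ((mem_subsetsProdLE.1 hb).1 hr)).2.1)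

end SieveDensity

section PrimePairs

/-- The ratio `B / φ(B)`, as a product over the prime factors of `B`. -/
noncomputable def invDensity (B : ℕ) : ℝ := ∏ r ∈ B.primeFactors, (1 + 1 / ((r : ℝ) - 1))

lemma one_le_invDensity (B : ℕ) : 1 ≤ invDensity B :=
  Finset.one_le_prod fun r hr ↦ by
    have : (1 : ℝ) < r := by exact_mod_cast (Nat.prime_of_mem_primeFactors hr).one_lt
    have : 0 ≤ 1 / ((r : ℝ) - 1) := one_div_nonneg.2 (by linarith)
    linarith

lemma card_sifted_mul_sq_log_le {B w z : ℕ} (hB : B ≠ 0) (h6 : 6 ∣ B) (hw : 0 < w)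
    (hz : z = w ^ 2)
    {E : ℕ → Finset ℕ} (hE : ∀ r, r.Prime → ¬ r ∣ B → E r ⊆ range r ∧ #(E r) = 2) (X : ℕ) :
    (#{n ∈ range X | ∀ r ∈ primesLENotDvd B z, n % r ∉ E r} : ℝ) * Real.log w ^ 2 ≤
      (X + (w : ℝ) ^ 8) * invDensity B ^ 2 := by
  have hP : ∀ r ∈ primesLENotDvd B z, r.Prime ∧ 5 ≤ r := fun r hr ↦ by
    obtain ⟨-, hp, hd⟩ := mem_primesLENotDvd.1 hr
    refine ⟨hp, ?_⟩
    by_contra! h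
    have h2 := hp.two_le
    interval_cases r
    · exact hd (dvd_trans (by norm_num) h6)
    · exact hd (dvd_trans (by norm_num) h6)
    · exact absurd hp (by norm_num)
  have h1 := card_sifted_mul_sum_le hP (fun r hr ↦ hE r (hP r hr).1 (mem_primesLENotDvd.1 hr).2.2)
    (hz ▸ pow_pos hw 2) X
  have h2 := sq_sum_prod_inv_sub_one_le (fun r hr ↦ (hP r hr).2) hz.ge
  have h3 := log_le_prod_mul_sum (z := z) hB (hz ▸ Nat.le_self_pow two_ne_zero w)
  rw [← invDensity] at h3
  set G := ∑ s ∈ subsetsProdLE (primesLENotDvd B z) z, ∏ r ∈ s, 2 / ((r : ℝ) - 2)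
  have h4 : Real.log w ^ 2 ≤ invDensity B ^ 2 * G := by
    calc _ ≤ _ := pow_le_pow_left₀ (Real.log_natCast_nonneg w) h3 2
      _ = invDensity B ^ 2 * _ ^ 2 := mul_pow _ _ _
      _ ≤ _ := by gcongr
  calc _ ≤ _ * (invDensity B ^ 2 * G) := mul_le_mul_of_nonneg_left h4 (Nat.cast_nonneg _)
    _ = (_ * G) * invDensity B ^ 2 := by ring
    _ ≤ (X + (w : ℝ) ^ 8) * invDensity B ^ 2 := by
      gcongr
      refine h1.trans (le_of_eq ?_)
      rw [hz]
      push_cast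
      ring

lemma card_linear_pair_mul_sq_log_le {B W w z : ℕ} (hB : B ≠ 0) (h6 : 6 ∣ B) (hW : W ∣ B)
    (hw : 0 < w) (hz : z = w ^ 2) (b : ℕ) {h : ℤ} (hh : ∀ r : ℕ, r.Prime → ¬ r ∣ B → ¬ (r : ℤ) ∣ h) (X : ℕ) :
    (#{n ∈ range X | ∀ r ∈ primesLENotDvd B z,
      ¬ (r : ℤ) ∣ (W * n + b : ℕ) ∧ ¬ (r : ℤ) ∣ (W * n + b : ℕ) + h} : ℝ) * Real.log w ^ 2 ≤
      (X + (w : ℝ) ^ 8) * invDensity B ^ 2 := by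
  set E : ℕ → Finset ℕ := fun r ↦
    {(-b * (W : ZMod r)⁻¹ : ZMod r).val, (-(b + h) * (W : ZMod r)⁻¹ : ZMod r).val} with hE
  refine le_trans ?_ (card_sifted_mul_sq_log_le hB h6 hw hz (E := E) (fun r hr hrB ↦ ?_) X)
  · refine mul_le_mul_of_nonneg_right (Nat.cast_le.2 (card_le_card
      (monotone_filter_right _ fun n _ hn r hr hmem ↦ ?_))) (sq_nonneg _)
    obtain ⟨-, hrp, hrB⟩ := mem_primesLENotDvd.1 hr
    have := Fact.mk hrp
    have hW0 : (W : ZMod r) ≠ 0 := fun h0 ↦ hrB (((ZMod.natCast_eq_zero_iff _ _).1 h0).trans hW)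
    rw [← ZMod.val_natCast, hE, mem_insert, mem_singleton] at hmem
    rcases hmem with h1 | h1
    · have h1 := ZMod.val_injective r h1
      refine (hn r hr).1 ((ZMod.intCast_zmod_eq_zero_iff_dvd _ r).1 ?_)
      push_cast
      rw [h1]; field_simp; ring
    · have h1 := ZMod.val_injective r h1
      refine (hn r hr).2 ((ZMod.intCast_zmod_eq_zero_iff_dvd _ r).1 ?_)
      push_cast
      rw [h1]; field_simp; ring
  · have := Fact.mk hr
    have hW0 : (W : ZMod r) ≠ 0 := fun h0 ↦ hrB (((ZMod.natCast_eq_zero_iff _ _).1 h0).trans hW)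
    refine ⟨?_, card_pair fun heq ↦ ?_⟩
    · rw [hE, insert_subset_iff, singleton_subset_iff, mem_range, mem_range]
      exact ⟨ZMod.val_lt _, ZMod.val_lt _⟩
    · have h1 := mul_right_cancel₀ (inv_ne_zero hW0) (ZMod.val_injective r heq)
      refine hh r hr hrB ((ZMod.intCast_zmod_eq_zero_iff_dvd _ r).1 ?_)
      linear_combination h1

lemma card_prime_pair_mul_sq_log_le {B W w : ℕ} (hB : B ≠ 0) (h6 : 6 ∣ B) (hW : W ∣ B)
    (hw : 0 < w) (b : ℕ) {h : ℤ} (hh : ∀ r : ℕ, r.Prime → ¬ r ∣ B → ¬ (r : ℤ) ∣ h) (x : ℕ) :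
    (#{p ∈ Iic x | p.Prime ∧ p % W = b ∧ Prime ((p : ℤ) + h)} : ℝ) * Real.log w ^ 2 ≤
      ((x : ℝ) / W + 7 * (w : ℝ) ^ 8) * invDensity B ^ 2 := by
  obtain ⟨z, hz⟩ : ∃ z, z = w ^ 2 := ⟨_, rfl⟩
  set T := {n ∈ range (x / W + 1) | ∀ r ∈ primesLENotDvd B z,
      ¬ (r : ℤ) ∣ (W * n + b : ℕ) ∧ ¬ (r : ℤ) ∣ (W * n + b : ℕ) + h} with hT
  have hsub : {p ∈ Iic x | p.Prime ∧ p % W = b ∧ Prime ((p : ℤ) + h)} ⊆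
      Iic (w ^ 2) ∪ (Icc (-(w ^ 2 : ℤ) - h) (w ^ 2 - h)).image Int.toNat ∪
        T.image fun n ↦ W * n + b := by
    intro p hp
    obtain ⟨hpx, hpp, hpb, hph⟩ := mem_filter.1 hp
    have hpx := mem_Iic.1 hpx
    by_cases h1 : p ≤ w ^ 2
    · exact mem_union_left _ (mem_union_left _ (mem_Iic.2 h1))
    by_cases h2 : |(p : ℤ) + h| ≤ w ^ 2
    · refine mem_union_left _ (mem_union_right _ (mem_image.2 ⟨p, ?_, Int.toNat_natCast p⟩))
      have := abs_le.1 h2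
      rw [mem_Icc]
      constructor <;> linarith
    refine mem_union_right _ (mem_image.2 ⟨p / W, ?_, ?_⟩)
    swap
    · simp only [← hpb]
      exact Nat.div_add_mod p W
    have hpe : W * (p / W) + b = p := by rw [← hpb]; exact Nat.div_add_mod p W
    refine mem_filter.2 ⟨mem_range.2 (Nat.lt_succ_of_le (Nat.div_le_div_right hpx)), fun r hr ↦ ?_⟩
    obtain ⟨hr1, hr2, -⟩ := mem_primesLENotDvd.1 hr
    rw [hpe]
    constructor
    · intro hd
      have := (Nat.prime_dvd_prime_iff_eq hr2 hpp).1 (Int.natCast_dvd_natCast.1 hd)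
      omega
    · intro hd
      have h3 := (Nat.prime_dvd_prime_iff_eq hr2 (Int.prime_iff_natAbs_prime.1 hph)).1
        (Int.natCast_dvd.1 hd)
      apply h2
      rw [Int.abs_eq_natAbs, ← h3]
      exact_mod_cast hr1.trans hz.le
  have hcard : (#{p ∈ Iic x | p.Prime ∧ p % W = b ∧ Prime ((p : ℤ) + h)} : ℝ) ≤
      3 * (w : ℝ) ^ 2 + 2 + #T := by
    have h1 := (card_le_card hsub).trans (card_union_le _ _)
    have h2 := card_union_le (Iic (w ^ 2)) ((Icc (-(w ^ 2 : ℤ) - h) (w ^ 2 - h)).image Int.toNat)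
    have h3 : #((Icc (-(w ^ 2 : ℤ) - h) (w ^ 2 - h)).image Int.toNat) ≤ 2 * w ^ 2 + 1 := by
      refine card_image_le.trans (le_of_eq ?_)
      rw [Int.card_Icc]
      have : (w : ℤ) ^ 2 - h + 1 - (-w ^ 2 - h) = (2 * w ^ 2 + 1 : ℕ) := by push_cast; ring
      rw [this, Int.toNat_natCast]
    have h4 : #(T.image fun n ↦ W * n + b) ≤ #T := card_image_le
    rw [Nat.card_Iic] at h2
    have h5 : #{p ∈ Iic x | p.Prime ∧ p % W = b ∧ Prime ((p : ℤ) + h)} ≤ 3 * w ^ 2 + 2 + #T := by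
      omega
    exact_mod_cast h5
  have hsieve := card_linear_pair_mul_sq_log_le hB h6 hW hw hz b hh (x / W + 1)
  rw [← hT] at hsieve
  have hw1 : (1 : ℝ) ≤ w := by exact_mod_cast hw
  have hlog : Real.log w ^ 2 ≤ (w : ℝ) ^ 2 :=
    pow_le_pow_left₀ (Real.log_natCast_nonneg w) (Real.log_le_self (by positivity)) 2
  have hρ : 1 ≤ invDensity B ^ 2 := one_le_pow₀ (one_le_invDensity B)
  have hdiv : ((x / W + 1 : ℕ) : ℝ) ≤ x / W + 1 := by
    push_cast
    have := Nat.cast_div_le (α := ℝ) (m := x) (n := W)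
    linarith
  have h48 : (w : ℝ) ^ 4 ≤ (w : ℝ) ^ 8 := pow_le_pow_right₀ hw1 (by norm_num)
  have h28 : (w : ℝ) ^ 2 ≤ (w : ℝ) ^ 8 := pow_le_pow_right₀ hw1 (by norm_num)
  have h08 : 1 ≤ (w : ℝ) ^ 8 := one_le_pow₀ hw1
  calc _ ≤ (3 * (w : ℝ) ^ 2 + 2 + #T) * Real.log w ^ 2 := by gcongr
    _ = (3 * (w : ℝ) ^ 2 + 2) * Real.log w ^ 2 + #T * Real.log w ^ 2 := by ring
    _ ≤ (3 * (w : ℝ) ^ 2 + 2) * (w : ℝ) ^ 2 * invDensity B ^ 2 +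
        (x / W + 1 + (w : ℝ) ^ 8) * invDensity B ^ 2 := by
      refine add_le_add ?_ (hsieve.trans (by gcongr))
      calc _ ≤ (3 * (w : ℝ) ^ 2 + 2) * (w : ℝ) ^ 2 := by gcongr
        _ ≤ _ := le_mul_of_one_le_right (by positivity) hρ
    _ = (3 * (w : ℝ) ^ 4 + 2 * (w : ℝ) ^ 2 + x / W + 1 + (w : ℝ) ^ 8) * invDensity B ^ 2 := by ring
    _ ≤ _ := mul_le_mul_of_nonneg_right (by linarith) (by positivity)

lemma exists_card_prime_pair_le {B W : ℕ} (hB : B ≠ 0) (h6 : 6 ∣ B) (hW : W ∣ B) :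
    ∃ x₀ : ℕ, ∀ x : ℕ, x₀ ≤ x → ∀ (b : ℕ) (h : ℤ),
      (∀ r : ℕ, r.Prime → ¬ r ∣ B → ¬ (r : ℤ) ∣ h) →
      (#{p ∈ Iic x | p.Prime ∧ p % W = b ∧ Prime ((p : ℤ) + h)} : ℝ) ≤
        2048 * invDensity B ^ 2 * (x / W) / Real.log x ^ 2 := by
  have hW0 : 0 < W := Nat.pos_of_ne_zero fun h0 ↦ hB (by simpa [h0] using hW)
  refine ⟨2 ^ 16 + (7 * W) ^ 2, fun x hx b h hh ↦ ?_⟩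
  have hex : ∃ w, 2 ≤ w ∧ w ^ 16 ≤ x ∧ x < (w + 1) ^ 16 := by
    refine ⟨Nat.nthRoot 16 x, ?_, Nat.pow_nthRoot_le (.inl (by norm_num)),
      Nat.lt_pow_nthRoot_add_one (by norm_num) x⟩
    by_contra! hlt
    have := Nat.lt_pow_nthRoot_add_one (n := 16) (by norm_num) x
    have h2 : (Nat.nthRoot 16 x + 1) ^ 16 ≤ 2 ^ 16 := Nat.pow_le_pow_left (by omega) 16
    omega
  obtain ⟨w, hw2, hw1, hw3⟩ := hex
  have key := card_prime_pair_mul_sq_log_le hB h6 hW (by omega : 0 < w) b hh x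
  have hx1 : (2 : ℝ) ^ 16 + (7 * W) ^ 2 ≤ x := by exact_mod_cast hx
  have hxpos : (0 : ℝ) < x := by have : (0 : ℝ) ≤ (7 * (W : ℝ)) ^ 2 := by positivity
                                 linarith
  have hWr : (0 : ℝ) < W := by exact_mod_cast hW0
  have h7 : 7 * (w : ℝ) ^ 8 ≤ x / W := by
    rw [le_div_iff₀ hWr]
    have hs : ((w : ℝ) ^ 8) ^ 2 ≤ x := by rw [← pow_mul]; exact_mod_cast hw1
    have h1 : (w : ℝ) ^ 8 ≤ √x := Real.le_sqrt_of_sq_le hs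
    have h2 : 7 * (W : ℝ) ≤ √x := Real.le_sqrt_of_sq_le (by linarith)
    calc 7 * (w : ℝ) ^ 8 * W = (w : ℝ) ^ 8 * (7 * W) := by ring
      _ ≤ √x * √x := by gcongr
      _ = x := Real.mul_self_sqrt hxpos.le
  have hlog : Real.log x ≤ 32 * Real.log w := by
    have h0 : w + 1 ≤ w ^ 2 := by
      have := Nat.mul_le_mul_right w hw2
      rw [sq]
      linarith
    have h1 : x ≤ w ^ 32 := by
      calc x ≤ (w + 1) ^ 16 := hw3.le
        _ ≤ (w ^ 2) ^ 16 := Nat.pow_le_pow_left h0 16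
        _ = w ^ 32 := by ring
    calc Real.log x ≤ Real.log ((w : ℝ) ^ 32) := Real.log_le_log hxpos (by exact_mod_cast h1)
      _ = _ := by rw [Real.log_pow]; norm_num
  have hlogpos : 0 < Real.log x := Real.log_pos (by
    have : (0 : ℝ) ≤ (7 * (W : ℝ)) ^ 2 := by positivity
    linarith)
  rw [le_div_iff₀ (by positivity)]
  have hC0 : (0 : ℝ) ≤ #{p ∈ Iic x | p.Prime ∧ p % W = b ∧ Prime ((p : ℤ) + h)} :=
    Nat.cast_nonneg _
  generalize (#{p ∈ Iic x | p.Prime ∧ p % W = b ∧ Prime ((p : ℤ) + h)} : ℝ) = C at key hC0 ⊢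
  have h1 : Real.log x ^ 2 ≤ (32 * Real.log w) ^ 2 := pow_le_pow_left₀ hlogpos.le hlog 2
  have h2 := mul_le_mul_of_nonneg_left h1 hC0
  have h3 : (x / W + 7 * (w : ℝ) ^ 8) * invDensity B ^ 2 ≤ (x / W + x / W) * invDensity B ^ 2 :=
    mul_le_mul_of_nonneg_right (by linarith) (sq_nonneg _)
  linarith

end PrimePairs

section PrimeReciprocals

lemma not_summable_one_div_primes_residue (N : ℕ) [NeZero N] (a : ZMod N) (ha : IsUnit a) :
    ¬ Summable fun p : ℕ ↦ if p.Prime ∧ (p : ZMod N) = a then (1 / p : ℝ) else 0 := by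
  set f : ℕ → ℝ := fun p ↦ if p.Prime ∧ (p : ZMod N) = a then (1 / p : ℝ) else 0 with hf
  obtain ⟨K, hK⟩ := exists_le_sum_log_div_primes_residue N a ha
  obtain ⟨A, hA⟩ := ((Real.tendsto_log_atTop.comp tendsto_natCast_atTop_atTop).eventually
    (eventually_ge_atTop (K + 1))).and (eventually_ge_atTop 2) |>.exists
  obtain ⟨hA1, hA2⟩ := hA
  have hA1 : K + 1 ≤ Real.log A := hA1
  have hlogA : 0 < Real.log A := Real.log_pos (by exact_mod_cast hA2)
  have hN : (0 : ℝ) < N.totient := by exact_mod_cast Nat.totient_pos.2 (NeZero.pos N)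
  have hf0 : ∀ n, 0 ≤ f n := fun n ↦ by simp only [hf]; split_ifs <;> positivity
  set c : ℝ := 1 / (N.totient * Real.log A) with hc
  have hc0 : 0 < c := by positivity
  have hwin : ∀ k : ℕ, c * (1 / ((k : ℝ) + 1)) ≤ ∑ p ∈ Ioc (A ^ k) (A ^ (k + 1)), f p := fun k ↦ by
    have hle : A ^ k ≤ A ^ (k + 1) := Nat.pow_le_pow_right (by omega) (by omega)
    have h1 := hK (A ^ k) (A ^ (k + 1)) (by positivity) hle
    push_cast at h1
    rw [Real.log_pow, Real.log_pow] at h1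
    push_cast at h1
    have h2 : ∑ p ∈ (Ioc (A ^ k) (A ^ (k + 1))).filter (fun p : ℕ ↦ p.Prime ∧ (p : ZMod N) = a),
        Real.log p / p ≤ ((k + 1) * Real.log A) * ∑ p ∈ Ioc (A ^ k) (A ^ (k + 1)), f p := by
      simp only [hf]
      rw [← sum_filter, mul_sum]
      refine sum_le_sum fun p hp ↦ ?_
      have hp1 := mem_Ioc.1 (mem_filter.1 hp).1
      rw [mul_one_div]
      gcongr
      have : Real.log p ≤ Real.log ((A : ℝ) ^ (k + 1)) := Real.log_le_log
        (by exact_mod_cast (by omega : 0 < p)) (by exact_mod_cast hp1.2)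
      rw [Real.log_pow] at this
      push_cast at this
      exact this
    have h3 : 1 ≤ N.totient *
        (((k + 1) * Real.log A) * ∑ p ∈ Ioc (A ^ k) (A ^ (k + 1)), f p) :=
      le_trans (by linarith) (h1.trans (mul_le_mul_of_nonneg_left h2 hN.le))
    rw [hc, div_mul_div_comm, one_mul, div_le_iff₀ (by positivity)]
    linarith
  intro hs
  have hdisj : ∀ m : ℕ, ∑ k ∈ range m, ∑ p ∈ Ioc (A ^ k) (A ^ (k + 1)), f p =
      ∑ p ∈ Ioc 1 (A ^ m), f p := fun m ↦ by
    induction m with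
    | zero => simp
    | succ m ih =>
      rw [sum_range_succ, ih, sum_Ioc_consecutive _ (Nat.one_le_pow _ _ (by omega))
        (Nat.pow_le_pow_right (by omega) (by omega))]
  have hharm : ¬ Summable fun k : ℕ ↦ c * (1 / ((k : ℝ) + 1)) := fun h ↦ by
    have := (summable_mul_left_iff hc0.ne').1 h
    refine Real.not_summable_one_div_natCast ((summable_nat_add_iff 1).1 ?_)
    simpa using this
  refine hharm (summable_of_sum_range_le (c := ∑' n, f n) (fun k ↦ by positivity) fun m ↦ ?_)
  calc _ ≤ ∑ k ∈ range m, ∑ p ∈ Ioc (A ^ k) (A ^ (k + 1)), f p := sum_le_sum fun k _ ↦ hwin k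
    _ ≤ _ := by
      rw [hdisj]
      exact hs.sum_le_tsum _ fun n _ ↦ hf0 n

lemma exists_finset_primes_residue_sum {N : ℕ} [NeZero N] {a : ZMod N} (ha : IsUnit a) {s : ℝ}
    (hs : 0 < s) (y : ℕ) :
    ∃ L : Finset ℕ, (∀ p ∈ L, p.Prime ∧ (p : ZMod N) = a ∧ y < p) ∧
      s ≤ ∑ p ∈ L, (1 / p : ℝ) ∧ ∑ p ∈ L, (1 / p : ℝ) ≤ s + 1 := by
  set f : ℕ → ℝ := fun p ↦ if p.Prime ∧ (p : ZMod N) = a then (1 / p : ℝ) else 0 with hf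
  have hf0 : ∀ n, 0 ≤ f n := fun n ↦ by simp only [hf]; split_ifs <;> positivity
  have hf1 : ∀ n, f n ≤ 1 := fun n ↦ by
    simp only [hf]
    split_ifs with h
    · exact div_le_one_of_le₀ (by exact_mod_cast h.1.one_le) (Nat.cast_nonneg _)
    · exact zero_le_one
  have hns : ¬ Summable fun n ↦ f (n + (y + 1)) := fun h ↦
    not_summable_one_div_primes_residue N a ha ((summable_nat_add_iff (y + 1)).1 h)
  have htend := (not_summable_iff_tendsto_nat_atTop_of_nonneg fun n ↦ hf0 (n + (y + 1))).1 hns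
  have hex := (htend.eventually (eventually_ge_atTop s)).exists
  classical
  have hn := Nat.find_spec hex
  set n := Nat.find hex with hndef
  have hn0 : n ≠ 0 := fun h0 ↦ by rw [h0, sum_range_zero] at hn; linarith
  obtain ⟨m, hm⟩ := Nat.exists_eq_succ_of_ne_zero hn0
  have hlt := Nat.find_min hex (m := m) (by omega)
  rw [hm, sum_range_succ] at hn
  have hsum : ∑ p ∈ (Ico (y + 1) (y + 1 + (m + 1))).filter
      (fun p : ℕ ↦ p.Prime ∧ (p : ZMod N) = a), (1 / p : ℝ) =
      ∑ i ∈ range m, f (i + (y + 1)) + f (m + (y + 1)) := by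
    rw [sum_filter, sum_Ico_eq_sum_range, Nat.add_sub_cancel_left, sum_range_succ]
    simp only [hf, add_comm]
  refine ⟨_, fun p hp ↦ ?_, hsum ▸ hn, ?_⟩
  · obtain ⟨h1, h2⟩ := mem_filter.1 hp
    exact ⟨h2.1, h2.2, (mem_Ico.1 h1).1⟩
  · rw [hsum]
    have := hf1 (m + (y + 1))
    linarith

lemma exists_disjoint_finsets_primes_residue_sum {N : ℕ} [NeZero N] {a : ZMod N} (ha : IsUnit a)
    {s : ℝ} (hs : 0 < s) :
    ∃ L : ℕ → Finset ℕ, (∀ k, ∀ p ∈ L k, p.Prime ∧ (p : ZMod N) = a) ∧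
      (∀ k, s ≤ ∑ p ∈ L k, (1 / p : ℝ) ∧ ∑ p ∈ L k, (1 / p : ℝ) ≤ s + 1) ∧
      Pairwise fun j k ↦ Disjoint (L j) (L k) := by
  choose F hF using exists_finset_primes_residue_sum ha hs
  set y : ℕ → ℕ := fun k ↦ (fun n ↦ max n ((F n).sup id))^[k] 0 with hy
  have hsucc : ∀ k, y (k + 1) = max (y k) ((F (y k)).sup id) := fun k ↦
    Function.iterate_succ_apply' _ _ _
  have hmono : Monotone y := monotone_nat_of_le_succ fun k ↦ by
    rw [hsucc]; exact le_max_left _ _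
  refine ⟨fun k ↦ F (y k), fun k p hp ↦ ⟨((hF _).1 p hp).1, ((hF _).1 p hp).2.1⟩,
    fun k ↦ (hF _).2, ?_⟩
  refine (pairwise_disjoint_on _).2 fun j k hjk ↦ disjoint_left.2 fun p hj hk ↦ ?_
  have h1 : p ≤ y (j + 1) := by
    rw [hsucc]
    exact (le_sup (f := id) hj).trans (le_max_right _ _)
  have h2 := ((hF _).1 p hk).2.2
  have h3 := hmono (Nat.succ_le_of_lt hjk)
  exact absurd (h1.trans h3) (not_le.2 h2)

end PrimeReciprocals

section Covering

lemma exists_prime_orderOf_ten {l : ℕ} (hl : l.Prime) (h1 : l ≡ 1 [MOD Nat.factorial 36]) :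
    ∃ q : ℕ, q.Prime ∧ orderOf (10 : ZMod q) = l ∧ 36 * l < q := by
  have hmod : ∀ m, 0 < m → m ≤ 36 → l ≡ 1 [MOD m] := fun m h0 hm ↦
    h1.of_dvd (Nat.dvd_factorial h0 hm)
  set R := ∑ i ∈ range l, 10 ^ i with hR
  have hRone : R ≠ 1 := by
    have h2 := hl.two_le
    obtain ⟨k, rfl⟩ := Nat.exists_eq_add_of_le h2
    have : R = 1 + 10 + ∑ i ∈ range k, 10 ^ (2 + i) := by
      rw [hR, sum_range_add]; rfl
    omega
  set q := R.minFac with hq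
  have hqp : q.Prime := Nat.minFac_prime hRone
  have := Fact.mk hqp
  have := Fact.mk hl
  have hqR : ((R : ℕ) : ZMod q) = 0 := (ZMod.natCast_eq_zero_iff _ _).2 (Nat.minFac_dvd R)
  have hq3 : q ≠ 3 := fun h3 ↦ by
    have h := hmod 3 (by norm_num) (by norm_num)
    have h0 : 3 ∣ R := h3 ▸ Nat.minFac_dvd R
    have : R ≡ l [MOD 3] := by
      have hsum : R ≡ ∑ i ∈ range l, 1 [MOD 3] := by
        refine (ZMod.natCast_eq_natCast_iff _ _ _).1 ?_
        rw [hR]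
        push_cast
        have h10 : (10 : ZMod 3) = 1 := by decide
        simp [h10]
      simpa using hsum
    have := this.trans h
    have := (Nat.modEq_zero_iff_dvd.2 h0).symm.trans this
    exact absurd this (by decide)
  have hpow : (10 : ZMod q) ^ l = 1 := by
    have hg := mul_geom_sum (10 : ZMod q) l
    rw [hR] at hqR
    push_cast at hqR
    rw [hqR, mul_zero] at hg
    exact (sub_eq_zero.1 hg.symm)
  have hord : orderOf (10 : ZMod q) = l := by
    refine orderOf_eq_prime hpow fun h10 ↦ ?_
    have h9 : ((9 : ℕ) : ZMod q) = 0 := by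
      have : (10 : ZMod q) = 9 + 1 := by norm_num
      rw [this] at h10
      simpa using h10
    have h9 : q ∣ 3 ^ 2 := (ZMod.natCast_eq_zero_iff 9 q).1 h9
    exact hq3 ((Nat.prime_dvd_prime_iff_eq hqp Nat.prime_three).1 (hqp.dvd_of_dvd_pow h9))
  have h100 : (10 : ZMod q) ≠ 0 := fun h0 ↦ by
    rw [h0, zero_pow hl.ne_zero] at hpow
    exact zero_ne_one hpow
  obtain ⟨k, hk⟩ := hord ▸ ZMod.orderOf_dvd_card_sub_one h100
  refine ⟨q, hqp, hord, ?_⟩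
  by_contra! hle
  have hq2 := hqp.two_le
  have hqk : q = l * k + 1 := by omega
  have hk0 : k ≠ 0 := fun h0 ↦ by rw [h0] at hqk; omega
  have hk36 : k < 36 := by
    by_contra! h
    have := Nat.mul_le_mul_left l h
    omega
  have hd : (k + 1) ∣ q := by
    have h := hmod (k + 1) (by omega) (by omega)
    have h2 : q ≡ 1 * k + 1 [MOD k + 1] := hqk ▸ (h.mul_right k).add_right 1
    rw [one_mul] at h2
    exact Nat.modEq_zero_iff_dvd.1 (h2.trans (Nat.modEq_zero_iff_dvd.2 dvd_rfl))
  rcases (Nat.dvd_prime hqp).1 hd with h | h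
  · omega
  · have := hl.two_le
    have : 2 * k ≤ l * k := Nat.mul_le_mul_right k this
    omega

end Covering

section CoveringSystem

lemma totient_prod_div_prod_le {s : Finset ℕ} (hs : ∀ r ∈ s, r.Prime) :
    ((∏ r ∈ s, r : ℕ).totient : ℝ) / (∏ r ∈ s, r : ℕ) ≤ Real.exp (-∑ r ∈ s, (1 / r : ℝ)) := by
  have h0 : ((∏ r ∈ s, r : ℕ) : ℝ) ≠ 0 := by
    exact_mod_cast (prod_pos fun r hr ↦ (hs r hr).pos).ne'
  have h := Nat.totient_eq_mul_prod_factors (∏ r ∈ s, r)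
  rw [Nat.primeFactors_prod hs] at h
  have h' : ((∏ r ∈ s, r : ℕ).totient : ℝ) =
      (∏ r ∈ s, r : ℕ) * ∏ p ∈ s, (1 - (p : ℝ)⁻¹) := by
    have h2 := congrArg (Rat.cast : ℚ → ℝ) h
    push_cast at h2 ⊢
    exact h2
  rw [h', mul_div_cancel_left₀ _ h0, ← sum_neg_distrib, Real.exp_sum]
  refine prod_le_prod (fun r hr ↦ ?_) fun r _ ↦ ?_
  · have : (1 : ℝ) ≤ r := by exact_mod_cast (hs r hr).one_le
    exact sub_nonneg.2 (inv_le_one_of_one_le₀ this)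
  · have := Real.add_one_le_exp (-(1 / r : ℝ))
    rw [one_div] at this ⊢
    linarith

lemma invDensity_prod_le {s : Finset ℕ} (hs : ∀ r ∈ s, r.Prime) :
    invDensity (∏ r ∈ s, r) ≤ Real.exp (∑ r ∈ s, 1 / ((r : ℝ) - 1)) := by
  rw [invDensity, Nat.primeFactors_prod hs, Real.exp_sum]
  refine prod_le_prod (fun r hr ↦ ?_) fun r _ ↦ ?_
  · have : (1 : ℝ) < r := by exact_mod_cast (hs r hr).one_lt
    have : 0 ≤ 1 / ((r : ℝ) - 1) := one_div_nonneg.2 (by linarith)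
    linarith
  · rw [add_comm]
    exact Real.add_one_le_exp _

/-- The possible differences of two distinct decimal digits. -/
noncomputable def digitDiffs : Finset ℤ := (Icc (-9) 9).erase 0

/-- A residue class `b` mod `W` such that, for `p` in this class and `i` outside a sparse set
of exponents, `p + d * 10 ^ i` has a common factor with `W`. -/
lemma exists_covering_class {ε : ℝ} (hε : 0 < ε) :
    ∃ (W b : ℕ) (P : ℤ → ℕ), 0 < W ∧ b < W ∧ b.Coprime W ∧
      (∀ d ∈ digitDiffs, 0 < P d ∧ ((P d).totient : ℝ) / P d * invDensity W ≤ ε) ∧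
      ∀ d ∈ digitDiffs, ∀ i : ℕ, ¬ (P d).Coprime i → ∀ p : ℕ, p % W = b →
        ∃ q : ℕ, q.Prime ∧ q ∣ W ∧ (q : ℤ) ∣ p + d * 10 ^ i := by
  classical
  obtain ⟨s, hs0, hs⟩ : ∃ s : ℝ, 0 < s ∧ Real.exp (1 / 2 - s / 2) ≤ ε := by
    refine ⟨max 1 (1 - 2 * Real.log ε), by positivity, ?_⟩
    rw [← Real.le_log_iff_exp_le hε]
    linarith [le_max_right 1 (1 - 2 * Real.log ε)]
  have : NeZero (Nat.factorial 36) := ⟨Nat.factorial_ne_zero _⟩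
  obtain ⟨L', hL', hsum', hdisj'⟩ :=
    exists_disjoint_finsets_primes_residue_sum (N := Nat.factorial 36) isUnit_one hs0
  set L : ℤ → Finset ℕ := fun d ↦ L' (d + 9).toNat with hL
  have hdisj : ∀ d ∈ digitDiffs, ∀ e ∈ digitDiffs, d ≠ e → Disjoint (L d) (L e) := by
    intro d hd e he hne
    refine hdisj' fun h ↦ hne ?_
    have := mem_Icc.1 (mem_of_mem_erase hd)
    have := mem_Icc.1 (mem_of_mem_erase he)
    omega
  set A := digitDiffs.biUnion L with hA
  have hAp : ∀ l ∈ A, l.Prime := fun l hl ↦ by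
    obtain ⟨d, -, hd⟩ := mem_biUnion.1 hl
    exact (hL' _ l hd).1
  have hq : ∀ l : ℕ, ∃ q : ℕ, l ∈ A → q.Prime ∧ orderOf (10 : ZMod q) = l ∧ 36 * l < q := by
    intro l
    by_cases hl : l ∈ A
    · obtain ⟨d, -, hd⟩ := mem_biUnion.1 hl
      obtain ⟨q, h⟩ := exists_prime_orderOf_ten (hAp l hl)
        ((ZMod.natCast_eq_natCast_iff _ _ _).1 (by rw [(hL' _ l hd).2, Nat.cast_one]))
      exact ⟨q, fun _ ↦ h⟩
    · exact ⟨0, fun h ↦ absurd h hl⟩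
  choose q hq using hq
  have hinj : Set.InjOn q A := fun l hl m hm hlm ↦ by
    rw [← (hq l hl).2.1, ← (hq m hm).2.1, hlm]
  set Q := A.image q with hQ
  have hQp : ∀ r ∈ Q, r.Prime := fun r hr ↦ by
    obtain ⟨l, hl, rfl⟩ := mem_image.1 hr
    exact (hq l hl).1
  set W := ∏ r ∈ Q, r with hW
  have hWpos : 0 < W := prod_pos fun r hr ↦ (hQp r hr).pos
  have hqW : ∀ l ∈ A, q l ∣ W := fun l hl ↦ dvd_prod_of_mem _ (mem_image_of_mem q hl)
  have hcol : ∀ l : ℕ, ∃ d : ℤ, l ∈ A → d ∈ digitDiffs ∧ l ∈ L d := by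
    intro l
    by_cases hl : l ∈ A
    · obtain ⟨d, hd⟩ := mem_biUnion.1 hl
      exact ⟨d, fun _ ↦ hd⟩
    · exact ⟨0, fun h ↦ absurd h hl⟩
  choose col hcol using hcol
  obtain ⟨b₀, hb₀⟩ := Nat.chineseRemainderOfFinset (fun l ↦ (-col l % (q l : ℤ)).toNat) q A
    (fun l hl ↦ (hq l hl).1.ne_zero) (fun l hl m hm hlm ↦
      (Nat.coprime_primes (hq l hl).1 (hq m hm).1).2 fun h ↦ hlm (hinj hl hm h))
  have hclass : ∀ l ∈ A, ∀ p : ℕ, p % W = b₀ % W → (q l : ℤ) ∣ p + col l := fun l hl p hp ↦ by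
    have h1 : p ≡ (-col l % (q l : ℤ)).toNat [MOD q l] :=
      (Nat.ModEq.of_dvd (hqW l hl) hp).trans (hb₀ l hl)
    have hq0 : (q l : ℤ) ≠ 0 := by exact_mod_cast (hq l hl).1.ne_zero
    have h2 := Int.natCast_modEq_iff.2 h1
    rw [Int.toNat_of_nonneg (Int.emod_nonneg _ hq0)] at h2
    have h3 := (h2.trans (Int.mod_modEq _ _)).symm.dvd
    simpa using h3
  have hnd : ∀ l ∈ A, ¬ (q l : ℤ) ∣ col l := fun l hl hd ↦ by
    have h1 := mem_erase.1 (hcol l hl).1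
    have h2 := mem_Icc.1 h1.2
    have h3 := Int.le_of_dvd (abs_pos.2 h1.1) ((dvd_abs _ _).2 hd)
    have h4 : |col l| ≤ 9 := abs_le.2 ⟨by linarith [h2.1], h2.2⟩
    have h5 := (hq l hl).2.2
    have h6 := (hAp l hl).pos
    have h7 : 36 < q l := by omega
    have : ((36 : ℕ) : ℤ) < q l := by exact_mod_cast h7
    push_cast at this
    linarith
  have hinvW : invDensity W ≤ Real.exp ((s + 1) / 2) := by
    refine (invDensity_prod_le hQp).trans (Real.exp_le_exp.2 ?_)
    rw [hQ, sum_image hinj]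
    calc ∑ l ∈ A, 1 / ((q l : ℝ) - 1) ≤ ∑ l ∈ A, 1 / 36 * (1 / l : ℝ) := by
          refine sum_le_sum fun l hl ↦ ?_
          have h1 : (0 : ℝ) < l := by exact_mod_cast (hAp l hl).pos
          have h2 : 36 * (l : ℝ) + 1 ≤ q l := by exact_mod_cast (hq l hl).2.2
          rw [one_div_mul_one_div]
          exact one_div_le_one_div_of_le (by positivity) (by linarith)
      _ = 1 / 36 * ∑ d ∈ digitDiffs, ∑ l ∈ L d, (1 / l : ℝ) := by
          rw [← mul_sum, hA, sum_biUnion]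
          intro d hd e he hne
          exact hdisj d hd e he hne
      _ ≤ 1 / 36 * ∑ d ∈ digitDiffs, (s + 1) := by
          gcongr with d _
          exact (hsum' _).2
      _ = (s + 1) / 2 := by
          have : #digitDiffs = 18 := by decide
          rw [sum_const, this]
          ring
  refine ⟨W, b₀ % W, fun d ↦ ∏ l ∈ L d, l, hWpos, Nat.mod_lt _ hWpos, ?_, fun d hd ↦ ?_, ?_⟩
  · refine Nat.Coprime.prod_right fun r hr ↦ ?_
    obtain ⟨l, hl, rfl⟩ := mem_image.1 hr
    refine ((Nat.Prime.coprime_iff_not_dvd (hq l hl).1).2 fun hd ↦ hnd l hl ?_).symm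
    have h1 := hclass l hl (b₀ % W) (Nat.mod_mod _ _)
    exact (dvd_add_right (Int.natCast_dvd_natCast.2 hd)).1 h1
  · have hp : ∀ l ∈ L d, l.Prime := fun l hl ↦ (hL' _ l hl).1
    refine ⟨prod_pos fun l hl ↦ (hp l hl).pos, le_trans ?_ hs⟩
    have h1 := totient_prod_div_prod_le hp
    have h2 : Real.exp (-∑ l ∈ L d, (1 / l : ℝ)) ≤ Real.exp (-s) :=
      Real.exp_le_exp.2 (neg_le_neg (hsum' _).1)
    calc _ ≤ Real.exp (-s) * Real.exp ((s + 1) / 2) := by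
          refine mul_le_mul (h1.trans h2) hinvW ?_ (Real.exp_pos _).le
          exact prod_nonneg fun r hr ↦ by
            have : (1 : ℝ) < r := by exact_mod_cast (Nat.prime_of_mem_primeFactors hr).one_lt
            have : 0 ≤ 1 / ((r : ℝ) - 1) := one_div_nonneg.2 (by linarith)
            linarith
      _ = _ := by rw [← Real.exp_add]; congr 1; ring
  · intro d hd i hi p hp
    obtain ⟨l, hl, hli⟩ : ∃ l ∈ L d, l ∣ i := by
      by_contra! h
      exact hi (Nat.Coprime.prod_left fun l hl ↦
        ((hL' _ l hl).1.coprime_iff_not_dvd).2 (h l hl))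
    have hlA : l ∈ A := mem_biUnion.2 ⟨d, hd, hl⟩
    refine ⟨q l, (hq l hlA).1, hqW l hlA, ?_⟩
    have hcd : col l = d := by
      by_contra hne
      exact disjoint_left.1 (hdisj _ (hcol l hlA).1 d hd hne) (hcol l hlA).2 hl
    have h1 := hclass l hlA p hp
    rw [hcd] at h1
    have h10 : (10 : ZMod (q l)) ^ i = 1 :=
      orderOf_dvd_iff_pow_eq_one.1 ((hq l hlA).2.1.symm ▸ hli)
    rw [← ZMod.intCast_zmod_eq_zero_iff_dvd] at h1 ⊢
    push_cast at h1 ⊢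
    rw [h10, mul_one, h1]

end CoveringSystem

section DigitChanges

lemma card_digitDiffs : #digitDiffs = 18 := by decide

lemma invDensity_mul_le (a b : ℕ) (ha : a ≠ 0) (hb : b ≠ 0) :
    invDensity (a * b) ≤ invDensity a * invDensity b := by
  have h1 : ∀ r ∈ a.primeFactors ∪ b.primeFactors, (1 : ℝ) ≤ 1 + 1 / ((r : ℝ) - 1) := fun r hr ↦ by
    have hp : r.Prime := by
      rcases mem_union.1 hr with h | h <;> exact Nat.prime_of_mem_primeFactors h
    have : (1 : ℝ) < r := by exact_mod_cast hp.one_lt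
    have : 0 ≤ 1 / ((r : ℝ) - 1) := one_div_nonneg.2 (by linarith)
    linarith
  rw [invDensity, invDensity, invDensity, Nat.primeFactors_mul ha hb, ← prod_union_inter]
  refine le_mul_of_one_le_right (prod_nonneg fun r hr ↦ zero_le_one.trans (h1 r hr))
    (Finset.one_le_prod fun r hr ↦ h1 r (mem_union_left _ (mem_inter.1 hr).1))

lemma totient_mul_invDensity (n : ℕ) : (n.totient : ℝ) * invDensity n = n := by
  have h2 := congrArg (Rat.cast : ℚ → ℝ) (Nat.totient_eq_mul_prod_factors n)
  push_cast at h2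
  rw [h2, invDensity, mul_assoc, ← prod_mul_distrib, prod_eq_one, mul_one]
  intro r hr
  have : (1 : ℝ) < r := by exact_mod_cast (Nat.prime_of_mem_primeFactors hr).one_lt
  have h0 : (r : ℝ) - 1 ≠ 0 := by linarith
  field_simp
  ring

/-- `p` becomes a prime after adding some `d * 10 ^ i`, where `d` is a difference of digits. -/
def HasPrimeDigitChange (p : ℕ) : Prop :=
  ∃ d ∈ digitDiffs, ∃ i : ℕ, 10 ^ i ≤ p ∧ Prime ((p : ℤ) + d * 10 ^ i)

lemma not_dvd_digitDiff_mul {d : ℤ} (hd : d ∈ digitDiffs) {r W : ℕ} (hr : r.Prime)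
    (hrW : ¬ r ∣ 210 * W) (i : ℕ) : ¬ (r : ℤ) ∣ d * 10 ^ i := by
  intro h
  have h210 : ¬ r ∣ 210 := fun h ↦ hrW (h.mul_right W)
  rcases (Nat.prime_iff_prime_int.1 hr).dvd_or_dvd h with h | h
  · have h1 := mem_erase.1 hd
    have h2 := mem_Icc.1 h1.2
    have h3 : (r : ℤ) ≤ 9 := (Int.le_of_dvd (abs_pos.2 h1.1) ((dvd_abs _ _).2 h)).trans
      (abs_le.2 ⟨by linarith [h2.1], h2.2⟩)
    have h4 : r ≤ 9 := by exact_mod_cast h3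
    interval_cases r <;> revert hr h210 <;> decide
  · have h1 : r ∣ 10 ^ i := by exact_mod_cast h
    exact h210 ((hr.dvd_of_dvd_pow h1).trans (by norm_num))

open Classical in
lemma card_hasPrimeDigitChange_le {W b : ℕ} {P : ℤ → ℕ}
    (hcov : ∀ d ∈ digitDiffs, ∀ i : ℕ, ¬ (P d).Coprime i → ∀ p : ℕ, p % W = b →
        ∃ q : ℕ, q.Prime ∧ q ∣ W ∧ (q : ℤ) ∣ p + d * 10 ^ i) (hW : 0 < W) {M : ℝ} {x : ℕ}
    (hM : ∀ d ∈ digitDiffs, ∀ i : ℕ,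
      (#{p ∈ Iic x | p.Prime ∧ p % W = b ∧ Prime ((p : ℤ) + d * 10 ^ i)} : ℝ) ≤ M) :
    (#{p ∈ Iic x | p.Prime ∧ p % W = b ∧ HasPrimeDigitChange p} : ℝ) ≤
      ∑ d ∈ digitDiffs, (#{i ∈ range (Nat.log 10 x + 1) | (P d).Coprime i} * M +
        (Nat.log 10 x + 1) * (2 * W + 1)) := by
  set S : ℤ → ℕ → Finset ℕ := fun d i ↦
    {p ∈ Iic x | p.Prime ∧ p % W = b ∧ Prime ((p : ℤ) + d * 10 ^ i)} with hS
  set T : ℤ → ℕ → Finset ℕ := fun d i ↦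
    (Icc (-(W : ℤ) - d * 10 ^ i) (W - d * 10 ^ i)).image Int.toNat with hT
  set I : ℤ → Finset ℕ := fun d ↦ {i ∈ range (Nat.log 10 x + 1) | (P d).Coprime i} with hI
  have hTc : ∀ d i, #(T d i) ≤ 2 * W + 1 := fun d i ↦ by
    refine card_image_le.trans (le_of_eq ?_)
    rw [Int.card_Icc]
    have : (W : ℤ) - d * 10 ^ i + 1 - (-W - d * 10 ^ i) = (2 * W + 1 : ℕ) := by push_cast; ring
    rw [this, Int.toNat_natCast]
  have hsub : {p ∈ Iic x | p.Prime ∧ p % W = b ∧ HasPrimeDigitChange p} ⊆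
      digitDiffs.biUnion fun d ↦ (I d).biUnion (S d) ∪
        (range (Nat.log 10 x + 1)).biUnion (T d) := by
    intro p hp
    obtain ⟨hpx, hpp, hpb, d, hd, i, hi, hprime⟩ := mem_filter.1 hp
    have hir : i ∈ range (Nat.log 10 x + 1) := mem_range.2 (Nat.lt_succ_of_le
      (Nat.le_log_of_pow_le (by norm_num) (hi.trans (mem_Iic.1 hpx))))
    refine mem_biUnion.2 ⟨d, hd, ?_⟩
    by_cases hc : (P d).Coprime i
    · exact mem_union_left _ (mem_biUnion.2 ⟨i, mem_filter.2 ⟨hir, hc⟩,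
        mem_filter.2 ⟨hpx, hpp, hpb, hprime⟩⟩)
    · refine mem_union_right _ (mem_biUnion.2 ⟨i, hir, mem_image.2 ⟨p, ?_, Int.toNat_natCast p⟩⟩)
      obtain ⟨q, hq, hqW, hqd⟩ := hcov d hd i hc p hpb
      have h3 := (Nat.prime_dvd_prime_iff_eq hq (Int.prime_iff_natAbs_prime.1 hprime)).1
        (Int.natCast_dvd.1 hqd)
      have h4 : |(p : ℤ) + d * 10 ^ i| ≤ W := by
        rw [Int.abs_eq_natAbs, ← h3]
        exact_mod_cast Nat.le_of_dvd hW hqW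
      have := abs_le.1 h4
      rw [mem_Icc]
      constructor <;> linarith
  have h1 := (card_le_card hsub).trans card_biUnion_le
  refine (Nat.cast_le (α := ℝ).2 h1).trans ?_
  push_cast
  refine sum_le_sum fun d hd ↦ ?_
  refine (Nat.cast_le (α := ℝ).2 (card_union_le _ _)).trans ?_
  push_cast
  refine add_le_add ?_ ?_
  · refine (Nat.cast_le (α := ℝ).2 card_biUnion_le).trans ?_
    push_cast
    rw [← nsmul_eq_mul]
    exact sum_le_card_nsmul _ _ _ fun i _ ↦ hM d hd i
  · have : #((range (Nat.log 10 x + 1)).biUnion (T d)) ≤ (Nat.log 10 x + 1) * (2 * W + 1) := by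
      refine (card_biUnion_le_card_mul _ _ _ fun i _ ↦ hTc d i).trans ?_
      rw [card_range]
    exact_mod_cast this

lemma natLog_ten_le_log {x : ℕ} (hx : 0 < x) : (Nat.log 10 x : ℝ) ≤ Real.log x := by
  have h1 : ((10 : ℝ) ^ Nat.log 10 x) ≤ x := by exact_mod_cast Nat.pow_log_le_self 10 hx.ne'
  have h2 := Real.log_le_log (by positivity) h1
  rw [Real.log_pow] at h2
  have h3 : 1 ≤ Real.log 10 := by
    rw [Real.le_log_iff_exp_le (by norm_num)]
    linarith [Real.exp_one_lt_d9]
  nlinarith [Nat.cast_nonneg (α := ℝ) (Nat.log 10 x)]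

open Classical in
lemma exists_class_card_hasPrimeDigitChange_le {δ : ℝ} (hδ : 0 < δ) :
    ∃ W b : ℕ, 0 < W ∧ b < W ∧ b.Coprime W ∧ ∃ x₀ : ℕ, ∀ x : ℕ, x₀ ≤ x →
      (#{p ∈ Iic x | p.Prime ∧ p % W = b ∧ HasPrimeDigitChange p} : ℝ) ≤
        δ * x / (W.totient * Real.log x) := by
  have hρ := one_le_invDensity 210
  set ρ := invDensity 210 with hρdef
  obtain ⟨W, b, P, hW, hbW, hcop, hP, hcov⟩ := exists_covering_class
    (ε := δ / (147456 * ρ ^ 2)) (by positivity)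
  refine ⟨W, b, hW, hbW, hcop, ?_⟩
  have hφ : (0 : ℝ) < W.totient := by exact_mod_cast Nat.totient_pos.2 hW
  have hWr : (0 : ℝ) < W := by exact_mod_cast hW
  have hρW := one_le_invDensity W
  obtain ⟨x₁, hx₁⟩ := exists_card_prime_pair_le (B := 210 * W) (W := W) (by positivity)
    (Dvd.dvd.mul_right (by norm_num) W) (Dvd.intro_left 210 rfl)
  have hev1 : ∀ᶠ x : ℕ in atTop, (1 + ∑ d ∈ digitDiffs, (P d : ℝ)) ≤ Real.log x :=
    (Real.tendsto_log_atTop.comp tendsto_natCast_atTop_atTop).eventually (eventually_ge_atTop _)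
  have hev2 : ∀ᶠ x : ℕ in atTop, 36 * (2 * W + 1) * Real.log x ^ 2 ≤ δ / 2 * x / W.totient := by
    have h := (Real.isLittleO_pow_log_id_atTop (n := 2)).comp_tendsto
      (tendsto_natCast_atTop_atTop (R := ℝ))
    have hc : 0 < δ / 2 / W.totient / (36 * (2 * (W : ℝ) + 1)) := by positivity
    filter_upwards [h.def hc] with x hx
    simp only [Function.comp, id, Real.norm_eq_abs, Nat.abs_cast, abs_pow, sq_abs] at hx
    calc 36 * (2 * W + 1) * Real.log x ^ 2 ≤
          36 * (2 * W + 1) * (δ / 2 / W.totient / (36 * (2 * (W : ℝ) + 1)) * x) := by gcongr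
      _ = _ := by field_simp
  obtain ⟨x₂, hx₂⟩ := eventually_atTop.1 (hev1.and hev2)
  refine ⟨max 1 (max x₁ x₂), fun x hx ↦ ?_⟩
  have hx0 : 0 < x := (le_max_left _ _).trans hx
  obtain ⟨hlog1, hlog2⟩ := hx₂ x ((le_max_right _ _).trans ((le_max_right _ _).trans hx))
  have hpair := hx₁ x ((le_max_left _ _).trans ((le_max_right _ _).trans hx)) b
  have hlogx : 1 ≤ Real.log x := by
    have : 0 ≤ ∑ d ∈ digitDiffs, (P d : ℝ) := sum_nonneg fun _ _ ↦ Nat.cast_nonneg _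
    linarith
  set ℓ := Real.log x with hℓ
  have hℓ0 : 0 < ℓ := by linarith
  have hxr : (0 : ℝ) < x := by exact_mod_cast hx0
  refine (card_hasPrimeDigitChange_le hcov hW fun d hd i ↦
    hpair (d * 10 ^ i) fun r hr hrB ↦ not_dvd_digitDiff_mul hd hr hrB i).trans ?_
  have hL := natLog_ten_le_log hx0
  have hterm : ∀ d ∈ digitDiffs, ((#{i ∈ range (Nat.log 10 x + 1) | (P d).Coprime i} : ℕ) : ℝ) *
      (2048 * invDensity (210 * W) ^ 2 * (x / W) / ℓ ^ 2) +
        (Nat.log 10 x + 1) * (2 * W + 1) ≤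
      δ / 36 * (x / (W.totient * ℓ)) + 2 * ℓ * (2 * W + 1) := fun d hd ↦ by
    obtain ⟨hP0, hPε⟩ := hP d hd
    have hP0r : (0 : ℝ) < P d := by exact_mod_cast hP0
    refine add_le_add ?_ (mul_le_mul_of_nonneg_right (by linarith) (by positivity))
    have hcount : ((#{i ∈ range (Nat.log 10 x + 1) | (P d).Coprime i} : ℕ) : ℝ) ≤
        (P d).totient / P d * (2 * ℓ) := by
      have h1 := Nat.Ico_filter_coprime_le 0 (Nat.log 10 x + 1) hP0.ne'
      rw [zero_add, ← range_eq_Ico] at h1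
      have h2 : (((Nat.log 10 x + 1) / P d : ℕ) : ℝ) ≤ (Nat.log 10 x + 1 : ℕ) / P d :=
        Nat.cast_div_le
      push_cast at h2
      have h3 : (P d : ℝ) ≤ ∑ d ∈ digitDiffs, (P d : ℝ) :=
        single_le_sum (f := fun d ↦ (P d : ℝ)) (fun _ _ ↦ Nat.cast_nonneg _) hd
      calc _ ≤ (((P d).totient * ((Nat.log 10 x + 1) / P d + 1) : ℕ) : ℝ) := Nat.cast_le.2 h1
        _ ≤ (P d).totient * (((Nat.log 10 x : ℝ) + 1) / P d + 1) := by
          push_cast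
          gcongr
        _ = (P d).totient / P d * (Nat.log 10 x + 1 + P d) := by field_simp
        _ ≤ _ := by
          gcongr
          linarith
    have hinv : invDensity (210 * W) ^ 2 ≤ (ρ * invDensity W) ^ 2 :=
      pow_le_pow_left₀ (zero_le_one.trans (one_le_invDensity _))
        (invDensity_mul_le 210 W (by norm_num) hW.ne') 2
    have hWφ := totient_mul_invDensity W
    calc _ ≤ (P d).totient / P d * (2 * ℓ) *
          (2048 * (ρ * invDensity W) ^ 2 * (x / W) / ℓ ^ 2) := by gcongr
      _ = ((P d).totient / P d * invDensity W) *
          (4096 * ρ ^ 2 * (invDensity W / W) * x / ℓ) := by field_simp; ring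
      _ ≤ δ / (147456 * ρ ^ 2) * (4096 * ρ ^ 2 * (invDensity W / W) * x / ℓ) := by
          refine mul_le_mul_of_nonneg_right hPε (by positivity)
      _ = δ / 36 * (x / (W.totient * ℓ)) := by
          have : invDensity W / W = 1 / W.totient := by
            rw [← hWφ]
            field_simp
          rw [this]
          field_simp
          ring
  refine (sum_le_sum hterm).trans ?_
  rw [sum_const, card_digitDiffs, nsmul_eq_mul]
  have h5 : 36 * (2 * (W : ℝ) + 1) * ℓ ≤ δ / 2 * (x / (W.totient * ℓ)) := by
    have : δ / 2 * (x / (W.totient * ℓ)) = (δ / 2 * x / W.totient) / ℓ := by field_simp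
    rw [this, le_div_iff₀ hℓ0]
    linarith
  have h6 : δ * x / (W.totient * ℓ) = δ * (x / (W.totient * ℓ)) := mul_div_assoc _ _ _
  rw [h6]
  push_cast
  linarith

end DigitChanges

section PositiveProportion

/-- A dyadic bound for `∑ log p / p` over a set with few elements. -/
lemma sum_log_div_le_of_card_le {Q : ℕ → Prop} [DecidablePred Q] {δ : ℝ} {x₀ : ℕ}
    (hQ : ∀ x : ℕ, x₀ ≤ x → (#{p ∈ Iic x | Q p} : ℝ) ≤ δ * x / Real.log x) {y : ℕ}
    (hy : x₀ ≤ y) (hy0 : 0 < y) (J : ℕ) :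
    ∑ p ∈ Ioc y (2 ^ J * y) with Q p, Real.log p / p ≤ 2 * δ * J := by
  induction J with
  | zero => simp
  | succ J ih =>
    have h2J : 0 < 2 ^ J * y := by positivity
    have hle : 2 ^ J * y ≤ 2 ^ (J + 1) * y :=
      Nat.mul_le_mul_right _ (Nat.pow_le_pow_right (by norm_num) (by omega))
    have hyle : y ≤ 2 ^ J * y := Nat.le_mul_of_pos_left _ (by positivity)
    rw [sum_filter] at ih ⊢
    rw [← sum_Ioc_consecutive _ hyle hle, ← sum_filter (s := Ioc (2 ^ J * y) (2 ^ (J + 1) * y))]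
    set x := 2 ^ (J + 1) * y with hx
    have hx2 : x = 2 * (2 ^ J * y) := by rw [hx]; ring
    have hlogx : 0 < Real.log x := Real.log_pos (by exact_mod_cast (by omega : 1 < x))
    have hxr : (x : ℝ) = 2 * ((2 ^ J * y : ℕ) : ℝ) := by rw [hx2]; push_cast; ring
    have hpos : (0 : ℝ) < (2 ^ J * y : ℕ) := by exact_mod_cast h2J
    have hblock : ∑ p ∈ Ioc (2 ^ J * y) x with Q p, Real.log p / p ≤ 2 * δ := by
      calc _ ≤ #{p ∈ Ioc (2 ^ J * y) x | Q p} • (Real.log x / (2 ^ J * y : ℕ)) := by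
            refine sum_le_card_nsmul _ _ _ fun p hp ↦ ?_
            have hp1 := mem_Ioc.1 (mem_filter.1 hp).1
            have h1 : (0 : ℝ) < p := by exact_mod_cast h2J.trans hp1.1
            have h2 : Real.log p ≤ Real.log x := Real.log_le_log h1 (by exact_mod_cast hp1.2)
            have h3 : ((2 ^ J * y : ℕ) : ℝ) ≤ p := by exact_mod_cast hp1.1.le
            exact div_le_div₀ hlogx.le h2 hpos h3
        _ ≤ (#{p ∈ Iic x | Q p} : ℝ) * (Real.log x / (2 ^ J * y : ℕ)) := by
            rw [nsmul_eq_mul]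
            refine mul_le_mul_of_nonneg_right (Nat.cast_le.2 (card_le_card ?_)) (by positivity)
            exact filter_subset_filter _ fun p hp ↦ mem_Iic.2 (mem_Ioc.1 hp).2
        _ ≤ δ * x / Real.log x * (Real.log x / (2 ^ J * y : ℕ)) :=
            mul_le_mul_of_nonneg_right (hQ x (by omega)) (by positivity)
        _ = 2 * δ := by
            generalize Real.log x = l at hlogx
            rw [hxr]
            field_simp
    push_cast
    linarith

open Classical in
/-- A positive proportion of the primes do not become prime under any digit change. -/
lemma exists_le_card_not_hasPrimeDigitChange :
    ∃ c : ℝ, 0 < c ∧ ∃ N₀ : ℕ, ∀ N : ℕ, N₀ ≤ N →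
      c * N / Real.log N ≤ #{p ∈ Iic N | p.Prime ∧ ¬ HasPrimeDigitChange p} := by
  obtain ⟨W, b, hW, hbW, hcop, x₀, hx₀⟩ :=
    exists_class_card_hasPrimeDigitChange_le (δ := 1 / 8) (by norm_num)
  have : NeZero W := ⟨hW.ne'⟩
  obtain ⟨K, hK⟩ := exists_le_sum_log_div_primes_residue W (b : ZMod W)
    ((ZMod.isUnit_iff_coprime b W).2 hcop)
  have hφ : (0 : ℝ) < W.totient := by exact_mod_cast Nat.totient_pos.2 hW
  obtain ⟨J, hJ⟩ := exists_nat_ge (4 * (K + 1))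
  have hclass : ∀ p : ℕ, (p : ZMod W) = b ↔ p % W = b := fun p ↦ by
    rw [ZMod.natCast_eq_natCast_iff, Nat.ModEq, Nat.mod_eq_of_lt hbW]
  have hgood : ∀ y : ℕ, x₀ ≤ y → 1 < y →
      (y : ℝ) / (W.totient * Real.log (2 ^ J * y : ℕ)) ≤
        #{p ∈ Iic (2 ^ J * y) | p.Prime ∧ ¬ HasPrimeDigitChange p} := by
    intro y hy hy1
    have hyle : y ≤ 2 ^ J * y := Nat.le_mul_of_pos_left _ (by positivity)
    have hyr : (0 : ℝ) < y := by exact_mod_cast (by omega : 0 < y)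
    set x := 2 ^ J * y with hx
    have hlogx : 0 < Real.log x := Real.log_pos (by exact_mod_cast (by omega : 1 < x))
    have h1 := hK y x (by omega) hyle
    have hlog : Real.log x - Real.log y = J * Real.log 2 := by
      rw [hx]
      push_cast
      rw [Real.log_mul (by positivity) hyr.ne', Real.log_pow]
      ring
    have hbad := sum_log_div_le_of_card_le (δ := 1 / 8 / W.totient)
      (Q := fun p ↦ p.Prime ∧ p % W = b ∧ HasPrimeDigitChange p)
      (fun x hx ↦ (hx₀ x hx).trans (le_of_eq (by simp only [div_eq_mul_inv, mul_inv]; ring))) hy (by omega) J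
    have hsplit : ∑ p ∈ (Ioc y x).filter (fun p : ℕ ↦ p.Prime ∧ (p : ZMod W) = b),
        Real.log p / p ≤
        ∑ p ∈ Ioc y x with (p.Prime ∧ p % W = b ∧ HasPrimeDigitChange p), Real.log p / p +
        ∑ p ∈ Ioc y x with (p.Prime ∧ ¬ HasPrimeDigitChange p), Real.log p / p := by
      rw [sum_filter, sum_filter, sum_filter, ← sum_add_distrib]
      refine sum_le_sum fun p _ ↦ ?_
      have h0 : 0 ≤ Real.log p / p :=
        div_nonneg (Real.log_natCast_nonneg p) (Nat.cast_nonneg p)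
      simp only [hclass]
      by_cases hp1 : p.Prime <;> by_cases hp2 : p % W = b <;>
        by_cases hp3 : HasPrimeDigitChange p <;> simp [hp1, hp2, hp3, h0]
    have hcount : ∑ p ∈ Ioc y x with (p.Prime ∧ ¬ HasPrimeDigitChange p), Real.log p / p ≤
        #{p ∈ Iic x | p.Prime ∧ ¬ HasPrimeDigitChange p} * (Real.log x / y) := by
      calc _ ≤ #{p ∈ Ioc y x | p.Prime ∧ ¬ HasPrimeDigitChange p} • (Real.log x / y) := by
            refine sum_le_card_nsmul _ _ _ fun p hp ↦ ?_
            have hp1 := mem_Ioc.1 (mem_filter.1 hp).1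
            have h2 : (y : ℝ) ≤ p := by exact_mod_cast hp1.1.le
            exact div_le_div₀ hlogx.le (Real.log_le_log (hyr.trans_le h2)
              (by exact_mod_cast hp1.2)) hyr h2
        _ ≤ _ := by
            rw [nsmul_eq_mul]
            refine mul_le_mul_of_nonneg_right (Nat.cast_le.2 (card_le_card ?_)) (by positivity)
            exact filter_subset_filter _ fun p hp ↦ mem_Iic.2 (mem_Ioc.1 hp).2
    generalize (#{p ∈ Iic x | p.Prime ∧ ¬ HasPrimeDigitChange p} : ℝ) = C at hcount ⊢
    have hsum := hsplit.trans (add_le_add hbad hcount)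
    have h2 := h1.trans (mul_le_mul_of_nonneg_left hsum hφ.le)
    rw [hlog] at h2
    have h3 : W.totient * (2 * (1 / 8 / (W.totient : ℝ)) * J + C * (Real.log x / y)) =
        J / 4 + C * (W.totient * Real.log x) / y := by
      field_simp
      ring
    rw [h3] at h2
    have hlog2 := Real.log_two_gt_d9
    have hJ0 : (0 : ℝ) ≤ J := Nat.cast_nonneg J
    have h4 : 1 ≤ C * (W.totient * Real.log x) / y := by nlinarith
    rw [one_le_div hyr] at h4
    rwa [div_le_iff₀ (by positivity)]
  refine ⟨1 / (W.totient * 2 ^ (J + 1)), by positivity, 2 ^ J * (x₀ + 2), fun N hN ↦ ?_⟩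
  have h2J : 0 < 2 ^ J := by positivity
  set y := N / 2 ^ J with hy
  have hyx : x₀ + 2 ≤ y := (Nat.le_div_iff_mul_le h2J).2 (by rw [mul_comm]; exact hN)
  have hyN : 2 ^ J * y ≤ N := Nat.mul_div_le N (2 ^ J)
  have hNy : N ≤ 2 ^ (J + 1) * y := by
    have h1 := Nat.lt_mul_div_succ N h2J
    rw [← hy] at h1
    have h2 : 2 ^ J * (y + 1) ≤ 2 ^ J * (2 * y) := Nat.mul_le_mul_left _ (by omega)
    rw [pow_succ, mul_assoc]
    exact h1.le.trans h2
  have h1x : 1 < 2 ^ J * y := lt_of_lt_of_le (by omega : 1 < y) (Nat.le_mul_of_pos_left _ h2J)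
  have hlogx : 0 < Real.log (2 ^ J * y : ℕ) := Real.log_pos (by exact_mod_cast h1x)
  have hloglog : Real.log (2 ^ J * y : ℕ) ≤ Real.log N :=
    Real.log_le_log (by exact_mod_cast (by omega : 0 < 2 ^ J * y)) (by exact_mod_cast hyN)
  have hNyr : (N : ℝ) ≤ 2 ^ (J + 1) * y := by exact_mod_cast hNy
  calc 1 / (W.totient * 2 ^ (J + 1)) * N / Real.log N
      ≤ 1 / (W.totient * 2 ^ (J + 1)) * (2 ^ (J + 1) * y) / Real.log (2 ^ J * y : ℕ) := by gcongr
    _ = y / (W.totient * Real.log (2 ^ J * y : ℕ)) := by field_simp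
    _ ≤ _ := hgood y (by omega) (by omega)
    _ ≤ _ := Nat.cast_le.2 (card_le_card (filter_subset_filter _ (Iic_subset_Iic.2 hyN)))

end PositiveProportion

/-- A positive proportion of primes become non-prime upon changing any single
decimal digit: there is `c > 0` such that for all large `N`, at least
`c·N/log N` primes `p ≤ N` have the property that replacing the digit of `p`
at any existing position by any different digit yields a non-prime. -/
theorem stmt_12 :
    ∃ c : ℝ, 0 < c ∧ ∃ N₀ : ℕ, ∀ N : ℕ, N₀ ≤ N →
      c * N / Real.log N ≤
        Nat.card {p : ℕ | p ≤ N ∧ p.Prime ∧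
          ∀ i : ℕ, 10 ^ i ≤ p → ∀ d' : ℕ, d' ≤ 9 → d' ≠ p / 10 ^ i % 10 →
            ¬ Prime ((p : ℤ) + ((d' : ℤ) - (p / 10 ^ i % 10 : ℕ)) * 10 ^ i)} := by
  classical
  obtain ⟨c, hc, N₀, h⟩ := exists_le_card_not_hasPrimeDigitChange
  refine ⟨c, hc, N₀, fun N hN ↦ (h N hN).trans (Nat.cast_le.2 ?_)⟩
  rw [Nat.card_coe_set_eq, ← Set.ncard_coe_finset]
  refine Set.ncard_le_ncard (fun p hp ↦ ?_) ((Set.finite_Iic N).subset fun p hp ↦ hp.1)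
  obtain ⟨hpN, hpp, hnot⟩ := mem_filter.1 (mem_coe.1 hp)
  refine ⟨mem_Iic.1 hpN, hpp, fun i hi d' hd' hne hprime ↦ hnot ⟨_, ?_, i, hi, hprime⟩⟩
  have := Nat.mod_lt (p / 10 ^ i) (show 0 < 10 by norm_num)
  refine mem_erase.2 ⟨fun h0 ↦ hne (by omega), mem_Icc.2 ⟨by omega, by omega⟩⟩
end
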